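/- Let α ∈ (0,1) be irrational. For Lebesgue-almost every β ∈ (0,1), the spectrum of the Schrödinger operator H_{V_{α,β,θ}} is a Cantor set of Lebesgue measure zero for every θ ∈ (0,1). -/

import Mathlib

open Filter MeasureTheory Set

noncomputable section

/-- `SL(2,ℝ)`. -/
abbrev SL2 : Type := Matrix.SpecialLinearGroup (Fin 2) ℝ

/-- The left shift on two-sided sequences. -/
def shift (𝒜 : Type*) : (ℤ → 𝒜) → ℤ → 𝒜 := fun ω n => ω (n + 1)

/-- A subshift: a closed, shift-invariant set of two-sided sequences. -/
def IsSubshift {𝒜 : Type*} [TopologicalSpace 𝒜] (Ω : Set (ℤ → 𝒜)) : Prop :=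
  IsClosed Ω ∧ shift 𝒜 '' Ω = Ω

/-- A minimal subshift: every two-sided orbit is dense. -/
def IsMinimalSubshift {𝒜 : Type*} [TopologicalSpace 𝒜] (Ω : Set (ℤ → 𝒜)) : Prop :=
  IsSubshift Ω ∧ ∀ ω ∈ Ω, Ω ⊆ closure (Set.range fun k : ℤ => fun n : ℤ => ω (n + k))

/-- An aperiodic subshift: no nontrivial shift fixes a point of `Ω`. -/
def IsAperiodicSubshift {𝒜 : Type*} (Ω : Set (ℤ → 𝒜)) : Prop :=
  ∀ ω ∈ Ω, ∀ n : ℤ, n ≠ 0 → (fun m => ω (m + n)) ≠ ω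

/-- The word `w` occurs in `ω` starting at position `k`. -/
def OccursAt {𝒜 : Type*} (ω : ℤ → 𝒜) (w : List 𝒜) (k : ℤ) : Prop :=
  ∀ i : Fin w.length, ω (k + i) = w.get i

/-- `w` belongs to `𝒲(Ω)`, the set of finite words of the subshift `Ω`. -/
def IsWordOf {𝒜 : Type*} (Ω : Set (ℤ → 𝒜)) (w : List 𝒜) : Prop :=
  ∃ ω ∈ Ω, ∃ k : ℤ, OccursAt ω w k

/-- `V_w = {ω ∈ Ω : ω(1)⋯ω(|w|) = w}`. -/
def Vset {𝒜 : Type*} (Ω : Set (ℤ → 𝒜)) (w : List 𝒜) : Set (ℤ → 𝒜) :=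
  {ω ∈ Ω | OccursAt ω w 1}

/-- `U_w = {ω ∈ Ω : w occurs in ω around position one}`. -/
def Uset {𝒜 : Type*} (Ω : Set (ℤ → 𝒜)) (w : List 𝒜) : Set (ℤ → 𝒜) :=
  {ω ∈ Ω | ∃ n : ℕ, n < w.length ∧ OccursAt ω w (1 - n)}

/-- Boshernitzan's condition (B): there are an ergodic probability measure `ν` (concentrated
on `Ω`), a constant `C > 0` and lengths `l n → ∞` with `|w| ν(V_w) ≥ C` whenever `|w| = l n`;
equivalently `limsup n η_ν(n) > 0`. -/
def CondB {𝒜 : Type*} [MeasurableSpace 𝒜] (Ω : Set (ℤ → 𝒜)) : Prop :=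
  ∃ ν : Measure (ℤ → 𝒜), IsProbabilityMeasure ν ∧ ν Ωᶜ = 0 ∧ Ergodic (shift 𝒜) ν ∧
    ∃ C > (0 : ℝ), ∃ l : ℕ → ℕ, Tendsto l atTop atTop ∧
      ∀ n : ℕ, ∀ w : List 𝒜, IsWordOf Ω w → w.length = l n →
        C ≤ (w.length : ℝ) * (ν (Vset Ω w)).toReal

/-- Condition (B'): there are an ergodic probability measure `ν` (concentrated on `Ω`),
a constant `C' > 0` and lengths `l n → ∞` with `ν(U_w) ≥ C'` whenever `|w| = l n`. -/
def CondB' {𝒜 : Type*} [MeasurableSpace 𝒜] (Ω : Set (ℤ → 𝒜)) : Prop :=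
  ∃ ν : Measure (ℤ → 𝒜), IsProbabilityMeasure ν ∧ ν Ωᶜ = 0 ∧ Ergodic (shift 𝒜) ν ∧
    ∃ C > (0 : ℝ), ∃ l : ℕ → ℕ, Tendsto l atTop atTop ∧
      ∀ n : ℕ, ∀ w : List 𝒜, IsWordOf Ω w → w.length = l n →
        C ≤ (ν (Uset Ω w)).toReal

/-- Unique ergodicity: there is exactly one shift-invariant Borel probability measure
concentrated on `Ω`. -/
def UniquelyErgodicSubshift {𝒜 : Type*} [MeasurableSpace 𝒜] (Ω : Set (ℤ → 𝒜)) : Prop :=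
  ∃! ν : Measure (ℤ → 𝒜),
    IsProbabilityMeasure ν ∧ ν Ωᶜ = 0 ∧ MeasurePreserving (shift 𝒜) ν ν

/-- A function on sequences is locally constant (on `Ω`) if its value only depends on
the coordinates `ω(−N)⋯ω(N)` for some `N`. -/
def LocConstOn {𝒜 β : Type*} (Ω : Set (ℤ → 𝒜)) (A : (ℤ → 𝒜) → β) : Prop :=
  ∃ N : ℕ, ∀ ω ∈ Ω, ∀ ρ ∈ Ω, (∀ i : ℤ, |i| ≤ (N : ℤ) → ω i = ρ i) → A ω = A ρ

/-- The cocycle `A(n,ω) = A(T^{n−1}ω)⋯A(ω)`. -/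
def cocycle {𝒜 G : Type*} [Monoid G] (A : (ℤ → 𝒜) → G) : ℕ → (ℤ → 𝒜) → G
  | 0, _ => 1
  | n + 1, ω => A ((shift 𝒜)^[n] ω) * cocycle A n ω

/-- A concrete norm on 2×2 real matrices (the Frobenius norm). -/
def matNorm (M : Matrix (Fin 2) (Fin 2) ℝ) : ℝ :=
  Real.sqrt (∑ i : Fin 2, ∑ j : Fin 2, (M i j) ^ 2)

/-- `A : Ω → SL(2,ℝ)` is uniform: `(1/n) log‖A(n,ω)‖` converges, uniformly on `Ω`,
to a constant `Λ(A)`. -/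
def IsUniformOn {𝒜 : Type*} (Ω : Set (ℤ → 𝒜)) (A : (ℤ → 𝒜) → SL2) : Prop :=
  ∃ Λ : ℝ, TendstoUniformlyOn
    (fun (n : ℕ) (ω : ℤ → 𝒜) =>
      (n : ℝ)⁻¹ * Real.log (matNorm ((cocycle A n ω : SL2) : Matrix (Fin 2) (Fin 2) ℝ)))
    (fun _ => Λ) atTop Ω

/-- Property (P): every locally constant `SL(2,ℝ)`-valued function on `Ω` is uniform. -/
def PropP {𝒜 : Type*} (Ω : Set (ℤ → 𝒜)) : Prop :=
  ∀ A : (ℤ → 𝒜) → SL2, LocConstOn Ω A → IsUniformOn Ω A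

/-- The word `ω(1)⋯ω(n)`. -/
def wordOf {𝒜 : Type*} (ω : ℤ → 𝒜) (n : ℕ) : List 𝒜 :=
  (List.range n).map fun i => ω (1 + i)

/-- A subadditive function on the words of `Ω`. -/
def SubadditiveOn {𝒜 : Type*} (Ω : Set (ℤ → 𝒜)) (F : List 𝒜 → ℝ) : Prop :=
  ∀ x y : List 𝒜, IsWordOf Ω x → IsWordOf Ω y → IsWordOf Ω (x ++ y) →
    F (x ++ y) ≤ F x + F y

/-- The complexity function `p(n) = #{w ∈ 𝒲(Ω) : |w| = n}`. -/
def complexity {𝒜 : Type*} (Ω : Set (ℤ → 𝒜)) (n : ℕ) : ℕ :=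
  Set.ncard {w : List 𝒜 | IsWordOf Ω w ∧ w.length = n}

/-- A right-special word. -/
def RightSpecial {𝒜 : Type*} (Ω : Set (ℤ → 𝒜)) (w : List 𝒜) : Prop :=
  ∃ a b : 𝒜, a ≠ b ∧ IsWordOf Ω (w ++ [a]) ∧ IsWordOf Ω (w ++ [b])

/-- A left-special word. -/
def LeftSpecial {𝒜 : Type*} (Ω : Set (ℤ → 𝒜)) (w : List 𝒜) : Prop :=
  ∃ a b : 𝒜, a ≠ b ∧ IsWordOf Ω (a :: w) ∧ IsWordOf Ω (b :: w)

/-- `σ ∈ ℬ^ℤ` is the image of `ω ∈ 𝒜^ℤ` under the substitution `S`, with `S(ω(0))`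
starting at position `0`. -/
def IsSubstImage {𝒜 ℬ : Type*} (S : 𝒜 → List ℬ) (ω : ℤ → 𝒜) (σ : ℤ → ℬ) : Prop :=
  ∃ c : ℤ → ℤ, c 0 = 0 ∧ (∀ k : ℤ, c (k + 1) = c k + (S (ω k)).length) ∧
    ∀ k : ℤ, ∀ j : Fin (S (ω k)).length, σ (c k + j) = (S (ω k)).get j

/-- `Ω(S) = {T^k S(ω) : ω ∈ Ω, k ∈ ℤ}`. -/
def SubstSubshift {𝒜 ℬ : Type*} (S : 𝒜 → List ℬ) (Ω : Set (ℤ → 𝒜)) : Set (ℤ → ℬ) :=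
  {τ | ∃ ω ∈ Ω, ∃ σ : ℤ → ℬ, IsSubstImage S ω σ ∧ ∃ k : ℤ, τ = fun n => σ (n + k)}

/-- `S` is recognizable with respect to `(Ω,T)`: there is a locally constant
`S̃ : Ω(S) → Ω × ℤ` with `S̃(T^k S(ω)) = (ω,k)` for `0 ≤ k ≤ |S(ω(0))|`. -/
def Recognizable {𝒜 ℬ : Type*} (S : 𝒜 → List ℬ) (Ω : Set (ℤ → 𝒜)) : Prop :=
  ∃ St : (ℤ → ℬ) → (ℤ → 𝒜) × ℤ, LocConstOn (SubstSubshift S Ω) St ∧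
    ∀ ω ∈ Ω, ∀ σ : ℤ → ℬ, IsSubstImage S ω σ →
      ∀ k : ℕ, k ≤ (S (ω 0)).length → St (fun n => σ (n + k)) = (ω, (k : ℤ))

/-- A Cantor set: compact, empty interior, no isolated points. -/
def IsCantorSet (S : Set ℝ) : Prop :=
  IsCompact S ∧ interior S = ∅ ∧ ∀ x ∈ S, AccPt x (Filter.principal S)

/-- `H` is the Schrödinger operator on `ℓ²(ℤ)` with potential `V`:
`(Hu)(n) = u(n+1) + u(n−1) + V(n)u(n)`. -/
def IsSchrodingerOp (V : ℤ → ℝ)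
    (H : lp (fun _ : ℤ => ℝ) 2 →L[ℝ] lp (fun _ : ℤ => ℝ) 2) : Prop :=
  ∀ u : lp (fun _ : ℤ => ℝ) 2, ∀ n : ℤ,
    (H u : ∀ _ : ℤ, ℝ) n = (u : ∀ _ : ℤ, ℝ) (n + 1) + (u : ∀ _ : ℤ, ℝ) (n - 1)
      + V n * (u : ∀ _ : ℤ, ℝ) n

/-- The circle map potential `V_{α,β,θ}(n) = χ_{[1−β,1)}(nα + θ mod 1)`. -/
def circleV (α β θ : ℝ) : ℤ → ℝ := fun n =>
  (Set.Ico (1 - β) 1).indicator (fun _ => (1 : ℝ)) (Int.fract (n * α + θ))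

/-- The coding `v_n(α,β,θ) = χ_{[0,β)}(nα + θ mod 1)` of the rotation by `α`. -/
def circleSeq (α β θ : ℝ) : ℤ → Bool := fun n =>
  if Int.fract (n * α + θ) < β then true else false

/-- The circle map subshift `Ω_{α,β}`. -/
def circleSubshift (α β : ℝ) : Set (ℤ → Bool) :=
  closure {ω | ∃ θ : ℝ, 0 ≤ θ ∧ θ < 1 ∧ ω = circleSeq α β θ}

/-- The one-step transfer matrix `M^E(ω)`. -/
def transferMat (E : ℝ) (ω : ℤ → ℝ) : Matrix (Fin 2) (Fin 2) ℝ :=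
  !![E - ω 1, -1; 1, 0]

/-- The Lyapunov exponent `γ(E) = inf_{n ≥ 1} (1/n) ∫ log‖M^E(n,ω)‖ dμ(ω)`. -/
def lyapunov (μ : Measure (ℤ → ℝ)) (E : ℝ) : ℝ :=
  ⨅ n : ℕ+, ((n : ℕ) : ℝ)⁻¹ *
    ∫ ω, Real.log (matNorm (cocycle (transferMat E) (n : ℕ) ω)) ∂μ

end

namespace CircleMapSpectrum

open scoped Topology
open Complex (I)

/-! ### Half-line `m`-functions -/

/-- The left-shift of a one-sided sequence. -/
def tail (v : ℕ → ℝ) : ℕ → ℝ := fun n => v (n + 1)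

/-- The truncated `m`-function of the half-line operator with potential `v`. -/
noncomputable def mApprox : ℕ → (ℕ → ℝ) → ℂ → ℂ
  | 0, _, _ => 0
  | N + 1, v, z => -(mApprox N (tail v) z + z - v 0)⁻¹

/-- Sequences with values in `[0,1]`. -/
def UnitSeq (v : ℕ → ℝ) : Prop := ∀ n, v n ∈ Icc (0 : ℝ) 1

theorem UnitSeq.tail {v : ℕ → ℝ} (hv : UnitSeq v) : UnitSeq (tail v) := fun n => hv (n + 1)

theorem im_neg_inv (w : ℂ) : (-w⁻¹).im = w.im * ‖w⁻¹‖ ^ 2 := by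
  rw [Complex.neg_im, Complex.inv_im, norm_inv, inv_pow, Complex.sq_norm]
  ring

theorem mApprox_im_nonneg (N : ℕ) (v : ℕ → ℝ) {z : ℂ} (hz : 0 < z.im) :
    0 ≤ (mApprox N v z).im := by
  induction N generalizing v with
  | zero => simp [mApprox]
  | succ N ih =>
    rw [mApprox, im_neg_inv]
    have := ih (CircleMapSpectrum.tail v)
    have h : 0 ≤ (mApprox N (CircleMapSpectrum.tail v) z + z - v 0).im := by
      simp; linarith
    positivity

theorem mApprox_im_succ (N : ℕ) (v : ℕ → ℝ) (z : ℂ) :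
    (mApprox (N + 1) v z).im
      = ((mApprox N (tail v) z).im + z.im) * ‖mApprox (N + 1) v z‖ ^ 2 := by
  rw [mApprox, im_neg_inv, norm_neg]
  simp

theorem mApprox_norm_le (N : ℕ) (v : ℕ → ℝ) {z : ℂ} (hz : 0 < z.im) :
    ‖mApprox N v z‖ ≤ z.im⁻¹ := by
  cases N with
  | zero => simp [mApprox, hz.le]
  | succ N =>
    rw [mApprox, norm_neg, norm_inv]
    have := mApprox_im_nonneg N (tail v) hz
    have h : z.im ≤ (mApprox N (CircleMapSpectrum.tail v) z + z - v 0).im := by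
      simp; linarith
    exact inv_anti₀ hz (h.trans (Complex.im_le_norm _))

theorem mApprox_denom_ne (N : ℕ) (v : ℕ → ℝ) (a : ℝ) {z : ℂ} (hz : 0 < z.im) :
    mApprox N v z + z - a ≠ 0 := by
  intro h
  have h2 := congrArg Complex.im h
  have := mApprox_im_nonneg N v hz
  simp at h2
  linarith

theorem norm_shift_le {w z : ℂ} {r a : ℝ} (hw : ‖w‖ ≤ r) (ha : a ∈ Icc (0 : ℝ) 1) :
    ‖w + z - a‖ ≤ r + ‖z‖ + 1 := by
  have h1 : ‖(a : ℂ)‖ ≤ 1 := by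
    rw [Complex.norm_real, Real.norm_eq_abs, abs_of_nonneg ha.1]; exact ha.2
  calc ‖w + z - a‖ ≤ ‖w + z‖ + ‖(a : ℂ)‖ := norm_sub_le _ _
    _ ≤ ‖w‖ + ‖z‖ + 1 := by linarith [norm_add_le w z]
    _ ≤ _ := by linarith

/-- A lower bound for the imaginary part of truncated `m`-functions. -/
noncomputable def imLower (z : ℂ) : ℝ := z.im * ((z.im⁻¹ + ‖z‖ + 1)⁻¹) ^ 2

theorem imLower_pos {z : ℂ} (hz : 0 < z.im) : 0 < imLower z := by
  unfold imLower
  positivity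

theorem imLower_le_im (N : ℕ) {v : ℕ → ℝ} (hv : UnitSeq v) {z : ℂ} (hz : 0 < z.im) :
    imLower z ≤ (mApprox (N + 1) v z).im := by
  rw [mApprox_im_succ, imLower]
  have h0 := mApprox_im_nonneg N (tail v) hz
  have h1 : (z.im⁻¹ + ‖z‖ + 1)⁻¹ ≤ ‖mApprox (N + 1) v z‖ := by
    rw [mApprox, norm_neg, norm_inv]
    refine inv_anti₀ (norm_pos_iff.2 (mApprox_denom_ne _ _ _ hz)) ?_
    exact norm_shift_le (mApprox_norm_le N _ hz) (hv 0)
  have : 0 < (z.im⁻¹ + ‖z‖ + 1)⁻¹ := by positivity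
  gcongr
  linarith

/-- The contraction rate of one step of the Riccati recursion. -/
noncomputable def rate (z : ℂ) : ℝ := (1 + z.im ^ 2)⁻¹

theorem rate_pos (z : ℂ) : 0 < rate z := by unfold rate; positivity

theorem rate_lt_one {z : ℂ} (hz : 0 < z.im) : rate z < 1 := by
  unfold rate
  exact inv_lt_one_of_one_lt₀ (by nlinarith [pow_pos hz 2])

/-- The initial constant of the Riccati contraction. -/
noncomputable def initConst (z : ℂ) : ℝ := (2 * z.im⁻¹) ^ 2 * ((imLower z)⁻¹) ^ 2

theorem mApprox_contraction (k l N : ℕ) {v v' : ℕ → ℝ} (hv : UnitSeq v) (hv' : UnitSeq v')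
    {z : ℂ} (hz : 0 < z.im) (h : ∀ i < N, v i = v' i) :
    ‖mApprox (N + (k + 1)) v z - mApprox (N + (l + 1)) v' z‖ ^ 2 ≤
      initConst z * (rate z ^ 2) ^ N *
        ((mApprox (N + (k + 1)) v z).im * (mApprox (N + (l + 1)) v' z).im) := by
  induction N generalizing v v' with
  | zero =>
    simp only [zero_add, pow_zero, mul_one]
    have h1 : ‖mApprox (k + 1) v z - mApprox (l + 1) v' z‖ ≤ 2 * z.im⁻¹ := by
      refine (norm_sub_le _ _).trans ?_
      linarith [mApprox_norm_le (k + 1) v hz, mApprox_norm_le (l + 1) v' hz]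
    have h2 := imLower_le_im k hv hz
    have h3 := imLower_le_im l hv' hz
    have h4 := imLower_pos hz
    have h5 : 1 ≤ ((imLower z)⁻¹) ^ 2 *
        ((mApprox (k + 1) v z).im * (mApprox (l + 1) v' z).im) := by
      have : (1:ℝ) = ((imLower z)⁻¹) ^ 2 * (imLower z * imLower z) := by field_simp
      rw [this]; gcongr
      exact h4.le.trans h2
    calc _ ≤ (2 * z.im⁻¹) ^ 2 * 1 := by rw [mul_one]; gcongr
      _ ≤ (2 * z.im⁻¹) ^ 2 * (((imLower z)⁻¹) ^ 2 *
            ((mApprox (k + 1) v z).im * (mApprox (l + 1) v' z).im)) := by gcongr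
      _ = _ := by unfold initConst; ring
  | succ N ih =>
    have ih' := ih hv.tail hv'.tail (fun i hi => h (i + 1) (by omega))
    have e1 : N + 1 + (k + 1) = (N + (k + 1)) + 1 := by ring
    have e2 : N + 1 + (l + 1) = (N + (l + 1)) + 1 := by ring
    rw [e1, e2]
    set a := mApprox (N + (k + 1)) (tail v) z with ha
    set b := mApprox (N + (l + 1)) (tail v') z with hb
    set A := mApprox (N + (k + 1) + 1) v z with hA
    set B := mApprox (N + (l + 1) + 1) v' z with hB
    have hAi : A.im = (a.im + z.im) * ‖A‖ ^ 2 := mApprox_im_succ _ _ _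
    have hBi : B.im = (b.im + z.im) * ‖B‖ ^ 2 := mApprox_im_succ _ _ _
    have hd1 : a + z - v 0 ≠ 0 := mApprox_denom_ne _ _ _ hz
    have hd2 : b + z - v' 0 ≠ 0 := mApprox_denom_ne _ _ _ hz
    have hAB : A - B = A * B * (a - b) := by
      have : A = -(a + z - v 0)⁻¹ := rfl
      rw [this]
      have : B = -(b + z - v' 0)⁻¹ := rfl
      rw [this, h 0 (by omega)]
      rw [h 0 (by omega)] at hd1
      field_simp
      ring
    have ha0 : 0 ≤ a.im := mApprox_im_nonneg _ _ hz
    have hb0 : 0 ≤ b.im := mApprox_im_nonneg _ _ hz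
    have key : ∀ x : ℂ, ‖x‖ ≤ z.im⁻¹ → 0 ≤ x.im → x.im ≤ rate z * (x.im + z.im) := by
      intro x hx hx0
      have h1 : x.im ≤ z.im⁻¹ := (Complex.im_le_norm x).trans hx
      have h2 : x.im * z.im ≤ 1 := by
        calc x.im * z.im ≤ z.im⁻¹ * z.im := by gcongr
          _ = 1 := by field_simp
      unfold rate
      rw [inv_mul_eq_div, le_div_iff₀ (by positivity)]
      nlinarith
    have ka := key a (mApprox_norm_le _ _ hz) ha0
    have kb := key b (mApprox_norm_le _ _ hz) hb0
    have hc : 0 ≤ initConst z := by unfold initConst; positivity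
    have hr := rate_pos z
    rw [hAB, norm_mul, norm_mul, mul_pow, mul_pow, hAi, hBi]
    calc ‖A‖ ^ 2 * ‖B‖ ^ 2 * ‖a - b‖ ^ 2
        ≤ ‖A‖ ^ 2 * ‖B‖ ^ 2 * (initConst z * (rate z ^ 2) ^ N * (a.im * b.im)) := by gcongr
      _ ≤ ‖A‖ ^ 2 * ‖B‖ ^ 2 * (initConst z * (rate z ^ 2) ^ N *
            ((rate z * (a.im + z.im)) * (rate z * (b.im + z.im)))) := by gcongr
      _ = _ := by ring

/-- The size of the difference of two truncated `m`-functions of potentials agreeing up to `N`. -/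
noncomputable def errConst (z : ℂ) : ℝ := Real.sqrt (initConst z * (z.im⁻¹ * z.im⁻¹))

theorem mApprox_dist_le (k l N : ℕ) {v v' : ℕ → ℝ} (hv : UnitSeq v) (hv' : UnitSeq v')
    {z : ℂ} (hz : 0 < z.im) (h : ∀ i < N, v i = v' i) :
    ‖mApprox (N + (k + 1)) v z - mApprox (N + (l + 1)) v' z‖ ≤ errConst z * rate z ^ N := by
  have h1 := mApprox_contraction k l N hv hv' hz h
  have hc : 0 ≤ initConst z := by unfold initConst; positivity
  have hr := rate_pos z
  have i1 := (Complex.im_le_norm _).trans (mApprox_norm_le (N + (k + 1)) v hz)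
  have i2 := (Complex.im_le_norm _).trans (mApprox_norm_le (N + (l + 1)) v' hz)
  have j1 := mApprox_im_nonneg (N + (k + 1)) v hz
  have j2 := mApprox_im_nonneg (N + (l + 1)) v' hz
  refine le_of_sq_le_sq ?_ (by unfold errConst; positivity)
  rw [mul_pow, errConst, Real.sq_sqrt (by positivity)]
  calc _ ≤ _ := h1
    _ ≤ initConst z * (rate z ^ 2) ^ N * (z.im⁻¹ * z.im⁻¹) := by gcongr
    _ = _ := by ring

/-- The `m`-function of a half-line operator. -/
noncomputable def mFun (v : ℕ → ℝ) (z : ℂ) : ℂ := limUnder atTop fun N => mApprox N v z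

theorem tendsto_mFun {v : ℕ → ℝ} (hv : UnitSeq v) {z : ℂ} (hz : 0 < z.im) :
    Tendsto (fun N => mApprox N v z) atTop (𝓝 (mFun v z)) := by
  refine tendsto_nhds_limUnder (cauchySeq_tendsto_of_complete ?_)
  refine (cauchySeq_shift 1).1 ?_
  refine cauchySeq_of_le_tendsto_0' (fun N => errConst z * rate z ^ N) ?_ ?_
  · intro n m hnm
    obtain ⟨k, rfl⟩ := Nat.exists_eq_add_of_le hnm
    rw [dist_eq_norm]
    have := mApprox_dist_le 0 k n hv hv hz (fun _ _ => rfl)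
    simpa [add_assoc] using this
  · have := (tendsto_pow_atTop_nhds_zero_of_lt_one (rate_pos z).le (rate_lt_one hz)).const_mul
      (errConst z)
    simpa using this

theorem mFun_dist_mApprox_le (N : ℕ) {v v' : ℕ → ℝ} (hv : UnitSeq v) (hv' : UnitSeq v')
    {z : ℂ} (hz : 0 < z.im) (h : ∀ i < N, v i = v' i) :
    ‖mFun v z - mApprox (N + 1) v' z‖ ≤ errConst z * rate z ^ N := by
  have h1 : Tendsto (fun k => mApprox (N + (k + 1)) v z) atTop (𝓝 (mFun v z)) := by
    have := (tendsto_add_atTop_iff_nat (f := fun N => mApprox N v z) (N + 1)).2 (tendsto_mFun hv hz)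
    refine this.congr fun k => ?_
    congr 1; ring
  refine le_of_tendsto ((h1.sub_const _).norm) (Eventually.of_forall fun k => ?_)
  exact mApprox_dist_le k 0 N hv hv' hz h

theorem mFun_dist_le (N : ℕ) {v v' : ℕ → ℝ} (hv : UnitSeq v) (hv' : UnitSeq v')
    {z : ℂ} (hz : 0 < z.im) (h : ∀ i < N, v i = v' i) :
    ‖mFun v z - mFun v' z‖ ≤ 2 * (errConst z * rate z ^ N) := by
  have h1 := mFun_dist_mApprox_le N hv hv' hz h
  have h2 := mFun_dist_mApprox_le N hv' hv' hz (fun _ _ => rfl)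
  calc ‖mFun v z - mFun v' z‖ = ‖(mFun v z - mApprox (N + 1) v' z)
        - (mFun v' z - mApprox (N + 1) v' z)‖ := by congr 1; ring
    _ ≤ _ := (norm_sub_le _ _).trans (by linarith)

theorem mFun_im_pos {v : ℕ → ℝ} (hv : UnitSeq v) {z : ℂ} (hz : 0 < z.im) :
    0 < (mFun v z).im := by
  have h1 := (Complex.continuous_im.tendsto _).comp (tendsto_mFun hv hz)
  refine (imLower_pos hz).trans_le (ge_of_tendsto h1 ?_)
  filter_upwards [eventually_ge_atTop 1] with N hN
  obtain ⟨k, rfl⟩ := Nat.exists_eq_add_of_le' hN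
  exact imLower_le_im k hv hz

theorem imLower_le_mFun_im {v : ℕ → ℝ} (hv : UnitSeq v) {z : ℂ} (hz : 0 < z.im) :
    imLower z ≤ (mFun v z).im := by
  have h1 := (Complex.continuous_im.tendsto _).comp (tendsto_mFun hv hz)
  refine (ge_of_tendsto h1 ?_)
  filter_upwards [eventually_ge_atTop 1] with N hN
  obtain ⟨k, rfl⟩ := Nat.exists_eq_add_of_le' hN
  exact imLower_le_im k hv hz

theorem mFun_norm_le {v : ℕ → ℝ} (hv : UnitSeq v) {z : ℂ} (hz : 0 < z.im) :
    ‖mFun v z‖ ≤ z.im⁻¹ :=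
  le_of_tendsto (tendsto_mFun hv hz).norm
    (Eventually.of_forall fun N => mApprox_norm_le N v hz)

theorem mFun_denom_ne {v : ℕ → ℝ} (hv : UnitSeq v) {z : ℂ} (hz : 0 < z.im) (a : ℝ) :
    mFun v z + z - a ≠ 0 := by
  intro h
  have h2 := congrArg Complex.im h
  have := mFun_im_pos hv hz
  simp at h2
  linarith

theorem mFun_eq {v : ℕ → ℝ} (hv : UnitSeq v) {z : ℂ} (hz : 0 < z.im) :
    mFun v z = -(mFun (tail v) z + z - v 0)⁻¹ := by
  have h1 := (tendsto_add_atTop_iff_nat (f := fun N => mApprox N v z) 1).2 (tendsto_mFun hv hz)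
  have h2 := ((((tendsto_mFun hv.tail hz).add_const z).sub_const (v 0 : ℂ)).inv₀
    (mFun_denom_ne hv.tail hz _)).neg
  exact tendsto_nhds_unique h1 h2

theorem mApprox_norm_le_one (N : ℕ) {v : ℕ → ℝ} (hv : UnitSeq v) {z : ℂ} (hz : 4 ≤ |z.re|) :
    ‖mApprox N v z‖ ≤ 1 := by
  induction N generalizing v with
  | zero => simp [mApprox]
  | succ N ih =>
    rw [mApprox, norm_neg, norm_inv]
    refine inv_le_one_of_one_le₀ ?_
    have h1 := ih hv.tail
    have h2 : ‖(v 0 : ℂ)‖ ≤ 1 := by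
      rw [Complex.norm_real, Real.norm_eq_abs, abs_of_nonneg (hv 0).1]; exact (hv 0).2
    have h3 : 4 ≤ ‖z‖ := hz.trans (Complex.abs_re_le_norm z)
    have h4 : ‖z‖ ≤ ‖mApprox N (CircleMapSpectrum.tail v) z + z - v 0‖
        + ‖mApprox N (CircleMapSpectrum.tail v) z‖ + ‖(v 0 : ℂ)‖ := by
      calc ‖z‖ = ‖(mApprox N (CircleMapSpectrum.tail v) z + z - v 0)
          - mApprox N (CircleMapSpectrum.tail v) z + v 0‖ := by congr 1; ring
        _ ≤ _ := (norm_add_le _ _).trans (by gcongr; exact norm_sub_le _ _)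
    linarith

theorem mFun_norm_le_one {v : ℕ → ℝ} (hv : UnitSeq v) {z : ℂ} (hz : 0 < z.im)
    (h4 : 4 ≤ |z.re|) : ‖mFun v z‖ ≤ 1 :=
  le_of_tendsto (tendsto_mFun hv hz).norm
    (Eventually.of_forall fun N => mApprox_norm_le_one N hv h4)

theorem mApprox_differentiableAt (N : ℕ) (v : ℕ → ℝ) {z : ℂ} (hz : 0 < z.im) :
    DifferentiableAt ℂ (mApprox N v) z := by
  induction N generalizing v with
  | zero => simp only [mApprox]; exact differentiableAt_const _
  | succ N ih =>
    simp only [mApprox]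
    have := ih (CircleMapSpectrum.tail v)
    exact ((((ih (CircleMapSpectrum.tail v)).add differentiableAt_id).sub_const _).inv
      (mApprox_denom_ne _ _ _ hz)).neg

theorem continuousAt_errConst {z : ℂ} (hz : 0 < z.im) : ContinuousAt errConst z := by
  have h1 : ContinuousAt Complex.im z := Complex.continuous_im.continuousAt
  have h2 : ContinuousAt (fun z : ℂ => z.im⁻¹) z := h1.inv₀ hz.ne'
  have h3 : ContinuousAt imLower z := by
    unfold imLower
    have h0 : z.im⁻¹ + ‖z‖ + 1 ≠ 0 := by
      have := inv_pos.2 hz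
      positivity
    have h3 : ContinuousAt (fun z : ℂ => z.im⁻¹ + ‖z‖ + 1) z :=
      (h2.add continuous_norm.continuousAt).add continuousAt_const
    exact h1.mul ((h3.inv₀ h0).pow 2)
  unfold errConst initConst
  refine Real.continuous_sqrt.continuousAt.comp ?_
  exact (((continuousAt_const.mul h2).pow 2).mul ((h3.inv₀ (imLower_pos hz).ne').pow 2)).mul
    (h2.mul h2)

theorem continuous_rate : Continuous rate := by
  unfold rate
  exact ((continuous_const.add (Complex.continuous_im.pow 2))).inv₀ (fun z => by
    exact (add_pos_of_pos_of_nonneg one_pos (sq_nonneg z.im)).ne')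

theorem mFun_differentiableOn {v : ℕ → ℝ} (hv : UnitSeq v) :
    DifferentiableOn ℂ (mFun v) {z | 0 < z.im} := by
  have ho : IsOpen {z : ℂ | 0 < z.im} := isOpen_lt continuous_const Complex.continuous_im
  have key : TendstoLocallyUniformlyOn (fun N => mApprox (N + 1) v) (mFun v) atTop
      {z | 0 < z.im} := by
    rw [Metric.tendstoLocallyUniformlyOn_iff]
    intro ε hε z hz
    obtain ⟨r, hr1, hr2⟩ := exists_between (rate_lt_one hz)
    have hr0 : 0 < r := (rate_pos z).trans hr1
    set C := errConst z + 1 with hC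
    have hC0 : 0 < C := by
      have : 0 ≤ errConst z := Real.sqrt_nonneg _
      linarith
    have e1 : ∀ᶠ w in 𝓝 z, errConst w < C :=
      (continuousAt_errConst hz).eventually_lt continuousAt_const (by linarith)
    have e2 : ∀ᶠ w in 𝓝 z, rate w < r :=
      continuous_rate.continuousAt.eventually_lt continuousAt_const hr1
    refine ⟨{w | errConst w < C ∧ rate w < r ∧ 0 < w.im}, mem_nhdsWithin_of_mem_nhds ?_, ?_⟩
    · filter_upwards [e1, e2, ho.mem_nhds hz] with w h1 h2 h3 using ⟨h1, h2, h3⟩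
    · have ht : Tendsto (fun N : ℕ => C * r ^ N) atTop (𝓝 0) := by
        simpa using (tendsto_pow_atTop_nhds_zero_of_lt_one hr0.le hr2).const_mul C
      filter_upwards [ht.eventually_lt_const hε] with N hN w hw
      rw [dist_eq_norm]
      refine lt_of_le_of_lt (mFun_dist_mApprox_le N hv hv hw.2.2 (fun _ _ => rfl)) ?_
      refine lt_of_le_of_lt ?_ hN
      have := rate_pos w
      gcongr
      · exact hw.1.le
      · exact hw.2.1.le
  refine key.differentiableOn (Eventually.of_forall fun N z hz => ?_) ho
  exact (mApprox_differentiableAt _ v hz).differentiableWithinAt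

theorem tendsto_mFun_of_eventually_eq {ι : Type*} {l : Filter ι} {v : ι → ℕ → ℝ} {v' : ℕ → ℝ}
    (hv : ∀ i, UnitSeq (v i)) (hv' : UnitSeq v') {z : ℂ} (hz : 0 < z.im)
    (h : ∀ n, ∀ᶠ i in l, v i n = v' n) :
    Tendsto (fun i => mFun (v i) z) l (𝓝 (mFun v' z)) := by
  rw [Metric.tendsto_nhds]
  intro ε hε
  have ht : Tendsto (fun N : ℕ => 2 * (errConst z * rate z ^ N)) atTop (𝓝 0) := by
    simpa using ((tendsto_pow_atTop_nhds_zero_of_lt_one (rate_pos z).le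
      (rate_lt_one hz)).const_mul (errConst z)).const_mul 2
  obtain ⟨N, hN⟩ := (ht.eventually_lt_const hε).exists
  have : ∀ᶠ i in l, ∀ n ∈ Finset.range N, v i n = v' n :=
    (Finset.eventually_all _).2 fun n _ => h n
  filter_upwards [this] with i hi
  rw [dist_eq_norm]
  exact (mFun_dist_le N (hv i) hv' hz fun n hn => hi n (Finset.mem_range.2 hn)).trans_lt hN

theorem measurable_mApprox {X : Type*} [MeasurableSpace X] (N : ℕ) {V : ℕ → X → ℝ} {Z : X → ℂ}
    (hV : ∀ n, Measurable (V n)) (hZ : Measurable Z) :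
    Measurable fun x => mApprox N (fun n => V n x) (Z x) := by
  induction N generalizing V with
  | zero => simp only [mApprox]; exact measurable_const
  | succ N ih =>
    simp only [mApprox]
    have := ih (V := fun n => V (n + 1)) (fun n => hV (n + 1))
    exact (((this.add hZ).sub (Complex.measurable_ofReal.comp (hV 0))).inv).neg

theorem measurable_mFun {X : Type*} [MeasurableSpace X] {V : ℕ → X → ℝ} {Z : X → ℂ}
    (hV : ∀ n, Measurable (V n)) (hZ : Measurable Z) (hu : ∀ x, UnitSeq fun n => V n x)
    (hz : ∀ x, 0 < (Z x).im) :
    Measurable fun x => mFun (fun n => V n x) (Z x) :=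
  measurable_of_tendsto_metrizable (fun N => measurable_mApprox N hV hZ)
    (tendsto_pi_nhds.2 fun x => tendsto_mFun (hu x) (hz x))

/-! ### The circle map potential -/

theorem circleV_mem (α β θ : ℝ) (n : ℤ) : circleV α β θ n ∈ Icc (0 : ℝ) 1 := by
  unfold circleV
  by_cases h : Int.fract (n * α + θ) ∈ Set.Ico (1 - β) 1
  · rw [indicator_of_mem h]; simp
  · rw [indicator_of_notMem h]; simp

theorem circleV_eq_floor (α : ℝ) {β : ℝ} (hβ : β ∈ Ioo (0 : ℝ) 1) (θ : ℝ) (n : ℤ) :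
    circleV α β θ n = ((⌊n * α + θ + β⌋ - ⌊n * α + θ⌋ : ℤ) : ℝ) := by
  set x := n * α + θ with hx
  have h0 := Int.fract_nonneg x
  have h1 := Int.fract_lt_one x
  have h2 := Int.floor_add_fract x
  unfold circleV
  rw [← hx]
  by_cases h : Int.fract x ∈ Set.Ico (1 - β) 1
  · rw [indicator_of_mem h]
    have : ⌊x + β⌋ = ⌊x⌋ + 1 := by
      rw [Int.floor_eq_iff]; push_cast
      constructor <;> linarith [h.1, hβ.2]
    rw [this]; simp
  · rw [indicator_of_notMem h]
    have h3 : Int.fract x < 1 - β := by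
      by_contra h3; exact h ⟨not_lt.1 h3, h1⟩
    have : ⌊x + β⌋ = ⌊x⌋ := by
      rw [Int.floor_eq_iff]
      constructor <;> linarith [hβ.1]
    rw [this]; simp

theorem circleV_shift (α β θ : ℝ) (n m : ℤ) :
    circleV α β θ (n + m) = circleV α β (θ + m * α) n := by
  unfold circleV
  congr 2
  push_cast; ring

theorem circleV_add_int (α β θ : ℝ) (n m : ℤ) :
    circleV α β (θ + m) n = circleV α β θ n := by
  unfold circleV
  congr 1
  rw [← add_assoc, Int.fract_add_intCast]

theorem measurable_circleV (α β : ℝ) (n : ℤ) : Measurable fun θ => circleV α β θ n := by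
  unfold circleV
  exact (measurable_const.indicator measurableSet_Ico).comp
    (measurable_fract.comp (measurable_const.add measurable_id))

/-- If `V` differs at two phases, an endpoint of the coding interval separates them. -/
theorem exists_between_of_circleV_ne (α : ℝ) {β : ℝ} (hβ : β ∈ Ioo (0 : ℝ) 1) {θ φ : ℝ}
    (hle : θ ≤ φ) {n : ℤ} (h : circleV α β θ n ≠ circleV α β φ n) :
    ∃ m : ℤ, ∃ b : ℝ, (b = 0 ∨ b = β) ∧ n * α + θ + b < m ∧ m ≤ n * α + φ + b := by
  by_contra! hcon
  apply h
  have key : ∀ b : ℝ, (b = 0 ∨ b = β) → ⌊n * α + θ + b⌋ = ⌊n * α + φ + b⌋ := by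
    intro b hb
    by_contra hne
    have h1 : ⌊n * α + θ + b⌋ ≤ ⌊n * α + φ + b⌋ := Int.floor_le_floor (by linarith)
    have h2 : ⌊n * α + θ + b⌋ < ⌊n * α + φ + b⌋ := lt_of_le_of_ne h1 hne
    have h3 := hcon ⌊n * α + φ + b⌋ b hb (Int.floor_lt.1 h2)
    exact absurd (Int.floor_le _) (not_le.2 h3)
  have k0 := key 0 (Or.inl rfl)
  have k1 := key β (Or.inr rfl)
  simp only [add_zero] at k0
  rw [circleV_eq_floor α hβ, circleV_eq_floor α hβ, k0, k1]

/-! ### Diophantine input -/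

/-- `p / q` is a reduced Dirichlet approximation of `α`. -/
structure DirichletApprox (α : ℝ) (p : ℤ) (q : ℕ) : Prop where
  pos : 0 < q
  coprime : IsCoprime p (q : ℤ)
  lt : |α - p / q| < 1 / (q : ℝ) ^ 2

theorem exists_dirichletApprox {α : ℝ} (hα : Irrational α) (n₀ : ℕ) :
    ∃ p : ℤ, ∃ q : ℕ, n₀ ≤ q ∧ DirichletApprox α p q := by
  by_contra! hcon
  refine Real.infinite_rat_abs_sub_lt_one_div_den_sq_of_irrational hα ?_
  obtain ⟨B, hB⟩ := exists_nat_gt ((|α| + 1) * n₀)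
  refine Set.Finite.of_finite_image (f := fun r : ℚ => (r.num, r.den)) ?_ ?_
  · refine Set.Finite.subset ((Set.finite_Icc (-(B : ℤ)) B).prod (Set.finite_Icc 0 n₀)) ?_
    rintro _ ⟨r, hr, rfl⟩
    have hr' : |α - r| < 1 / (r.den : ℝ) ^ 2 := hr
    have hden : (0 : ℝ) < r.den := by exact_mod_cast r.den_pos
    have hden1 : (1 : ℝ) ≤ r.den := by exact_mod_cast r.den_pos
    have hq : r.den < n₀ := by
      by_contra hle
      refine hcon r.num r.den (not_lt.1 hle) ⟨r.den_pos, ?_, ?_⟩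
      · exact Rat.isCoprime_num_den r
      · rw [Rat.cast_def] at hr'; exact hr'
    have h1 : |(r : ℝ)| ≤ |α| + 1 := by
      have : 1 / (r.den : ℝ) ^ 2 ≤ 1 := by
        rw [div_le_one (by positivity)]; nlinarith
      have h3 := abs_sub_abs_le_abs_sub (r : ℝ) α
      rw [abs_sub_comm] at h3
      linarith
    have h2 : |(r.num : ℝ)| ≤ B := by
      have : (r.num : ℝ) = r * r.den := by
        have := Rat.mul_den_eq_num r
        exact_mod_cast this.symm
      rw [this, abs_mul, abs_of_pos hden]
      refine le_trans ?_ hB.le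
      have : (r.den : ℝ) ≤ n₀ := by exact_mod_cast hq.le
      gcongr
    have h3 : |r.num| ≤ (B : ℤ) := by exact_mod_cast h2
    exact ⟨⟨(abs_le.1 h3).1, (abs_le.1 h3).2⟩, ⟨Nat.zero_le _, hq.le⟩⟩
  · intro r _ s _ h
    simp only [Prod.mk.injEq] at h
    exact Rat.ext h.1 h.2

theorem DirichletApprox.dist_int {α : ℝ} {p : ℤ} {q : ℕ} (h : DirichletApprox α p q)
    {j : ℤ} (hj : j ≠ 0) (hjq : 2 * |j| ≤ q) (m : ℤ) : 1 / (2 * q : ℝ) ≤ |j * α - m| := by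
  have hq : (0 : ℝ) < q := by exact_mod_cast h.pos
  have h1 : (1 : ℝ) ≤ |((j * p - m * q : ℤ) : ℝ)| := by
    have : (1 : ℤ) ≤ |j * p - m * q| := by
      apply Int.one_le_abs
      intro h0
      have h2 : (q : ℤ) ∣ j * p := ⟨m, by linarith⟩
      have h3 : (q : ℤ) ∣ j := h.coprime.symm.dvd_of_dvd_mul_right h2
      have h4 := Int.le_of_dvd (abs_pos.2 hj) ((dvd_abs _ _).2 h3)
      have := abs_pos.2 hj
      omega
    exact_mod_cast this
  have h2 : |(j : ℝ) * (α - p / q)| ≤ 1 / (2 * q) := by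
    rw [abs_mul]
    have hj2 : 2 * |(j : ℝ)| ≤ q := by exact_mod_cast hjq
    calc |(j : ℝ)| * |α - p / q| ≤ (q / 2) * (1 / (q : ℝ) ^ 2) := by
          have := h.lt.le
          gcongr; linarith
      _ = 1 / (2 * q) := by field_simp
  have h3 : |(j : ℝ) * p / q - m| = |((j * p - m * q : ℤ) : ℝ)| / q := by
    rw [eq_div_iff hq.ne', ← abs_of_pos hq, ← abs_mul, abs_of_pos hq]
    congr 1
    push_cast
    field_simp
  have h4 : 1 / (q : ℝ) ≤ |(j : ℝ) * p / q - m| := by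
    rw [h3]; gcongr
  have h5 : |(j : ℝ) * p / q - m| ≤ |j * α - m| + |(j : ℝ) * (α - p / q)| := by
    calc |(j : ℝ) * p / q - m| = |(j * α - m) - (j : ℝ) * (α - p / q)| := by congr 1; ring
      _ ≤ _ := abs_sub _ _
  have h6 : 1 / (q : ℝ) = 1 / (2 * q) + 1 / (2 * q) := by field_simp; norm_num
  linarith

open Classical in
/-- Visits of the first `q` points of a rotation orbit to an open arc. -/
theorem DirichletApprox.card_visits {α : ℝ} {p : ℤ} {q : ℕ} (h : DirichletApprox α p q)
    (θ b : ℝ) {κ : ℝ} (hκ1 : κ ≤ 1) :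
    κ * q - 3 ≤ ((Finset.range q).filter
      (fun j : ℕ => ∃ m : ℤ, θ + j * α + m ∈ Ioo b (b + κ))).card := by
  have hq : (0 : ℝ) < q := by exact_mod_cast h.pos
  obtain ⟨u, w, huw⟩ := h.coprime
  set A : ℤ := ⌈(b - θ) * q + 1⌉ with hA
  set B : ℤ := ⌊(b + κ - θ) * q - 1⌋ with hB
  have hA1 : (A : ℝ) < (b - θ) * q + 2 := by
    have := Int.ceil_lt_add_one ((b - θ) * q + 1); linarith
  have hA0 := Int.le_ceil ((b - θ) * q + 1)
  have hB1 : (b + κ - θ) * q - 2 < (B : ℝ) := by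
    have := Int.lt_floor_add_one ((b + κ - θ) * q - 1); linarith
  have hB0 := Int.floor_le ((b + κ - θ) * q - 1)
  have hcard : κ * q - 3 ≤ ((Finset.Icc A B).card : ℝ) := by
    rw [Int.card_Icc]
    have : (B + 1 - A : ℝ) ≤ ((B + 1 - A).toNat : ℝ) := by
      exact_mod_cast Int.self_le_toNat (B + 1 - A)
    nlinarith
  refine hcard.trans ?_
  norm_cast
  have hqz : (0 : ℤ) < q := by exact_mod_cast h.pos
  refine Finset.card_le_card_of_injOn (fun i => ((i * u) % q).toNat) ?_ ?_
  · intro i hi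
    have hi' := Finset.mem_Icc.1 (Finset.mem_coe.1 hi)
    have e0 := Int.emod_nonneg (i * u) hqz.ne'
    have e1 := Int.emod_lt_of_pos (i * u) hqz
    have e2 : ((((i * u) % q).toNat : ℕ) : ℤ) = (i * u) % q := Int.toNat_of_nonneg e0
    rw [Finset.mem_coe, Finset.mem_filter, Finset.mem_range]
    beta_reduce
    refine ⟨by omega, ?_⟩
    set j : ℕ := ((i * u) % q).toNat with hj
    have e3 : (j : ℤ) = i * u - q * ((i * u) / q) := by
      rw [e2]; have := Int.emod_add_mul_ediv (i * u) q; linarith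
    have e4 : (j : ℤ) * p = i - q * (i * w + p * ((i * u) / q)) := by
      rw [e3]; linear_combination i * huw
    refine ⟨i * w + p * ((i * u) / q), ?_⟩
    set m : ℤ := i * w + p * ((i * u) / q) with hm
    have e5 : (j : ℝ) * p = i - q * m := by exact_mod_cast e4
    have e6 : |(j : ℝ) * (α - p / q)| < 1 / q := by
      rw [abs_mul, Nat.abs_cast]
      have hjq : (j : ℝ) < q := by
        have : (j : ℤ) < q := by omega
        exact_mod_cast this
      calc (j : ℝ) * |α - p / q| ≤ j * (1 / (q : ℝ) ^ 2) := by
            have := h.lt.le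
            gcongr
        _ < q * (1 / (q : ℝ) ^ 2) := by gcongr
        _ = 1 / q := by field_simp
    have e7 : θ + j * α + m = θ + i / q + j * (α - p / q) := by
      have : (m : ℝ) = (i - j * p) / q := by rw [e5]; field_simp; ring
      rw [this]; field_simp; ring
    have e8 := abs_lt.1 e6
    have i1 : (A : ℝ) ≤ i := by exact_mod_cast hi'.1
    have i2 : (i : ℝ) ≤ B := by exact_mod_cast hi'.2
    have i3 : b - θ + 1 / q ≤ i / q := by
      rw [le_div_iff₀ hq, add_mul, one_div, inv_mul_cancel₀ hq.ne']; linarith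
    have i4 : (i : ℝ) / q ≤ b + κ - θ - 1 / q := by
      rw [div_le_iff₀ hq, sub_mul _ (1 / (q : ℝ)), one_div, inv_mul_cancel₀ hq.ne']; linarith
    rw [e7]
    constructor <;> linarith
  · intro i hi i' hi' hii
    have hi1 := Finset.mem_Icc.1 (Finset.mem_coe.1 hi)
    have hi2 := Finset.mem_Icc.1 (Finset.mem_coe.1 hi')
    have e0 := Int.emod_nonneg (i * u) hqz.ne'
    have e0' := Int.emod_nonneg (i' * u) hqz.ne'
    have hii' : (i * u) % q = (i' * u) % q := by
      simp only at hii; omega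
    have d1 : (q : ℤ) ∣ (i' - i) * u := by
      rw [sub_mul]; exact (Int.ModEq.dvd hii')
    have d2 : (q : ℤ) ∣ i' - i := by
      have : IsCoprime (q : ℤ) u := ⟨w, p, by linarith⟩
      exact this.dvd_of_dvd_mul_right d1
    have hlt : |i' - i| < q := by
      have hBA : (B : ℝ) - A < q := by nlinarith
      have hBA' : B - A < q := by exact_mod_cast hBA
      rw [abs_lt]; constructor <;> omega
    have := Int.eq_zero_of_abs_lt_dvd d2 hlt
    omega

/-- The arithmetic condition on `β` used below; it holds almost everywhere. -/
def GoodBeta (α β : ℝ) : Prop :=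
  (∀ j m : ℤ, j * α + m ≠ β) ∧ ∃ c : ℝ, 0 < c ∧ c ≤ 1 / 2 ∧ ∀ n₀ : ℕ, ∃ p : ℤ, ∃ q : ℕ, n₀ ≤ q ∧
    DirichletApprox α p q ∧ ∀ j m : ℤ, |j| < q → c / q ≤ |j * α - m + β|

/-- The phases `β` which are `c / q`-close to a short orbit. -/
def badSet (α c : ℝ) (q : ℕ) : Set ℝ :=
  {β | ∃ j m : ℤ, |j| < q ∧ |j * α - m + β| < c / q}

theorem volume_badSet_le (α : ℝ) {c : ℝ} (hc : c ≤ 1 / 2) (hc0 : 0 < c) {q : ℕ} (hq : 0 < q) :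
    volume (badSet α c q ∩ Ioo 0 1) ≤ ENNReal.ofReal (16 * c) := by
  have hq' : (0 : ℝ) < q := by exact_mod_cast hq
  have hq1 : (1 : ℝ) ≤ q := by exact_mod_cast hq
  have hcq : c / q ≤ 1 / 2 := (div_le_self hc0.le hq1).trans hc
  set J : Finset (ℤ × ℤ) := (Finset.Ioo (-(q : ℤ)) q) ×ˢ (Finset.Icc (-1 : ℤ) 2)
  have hsub : badSet α c q ∩ Ioo 0 1 ⊆ ⋃ x ∈ J,
      Metric.ball (((x.2 + ⌊x.1 * α⌋ : ℤ) : ℝ) - x.1 * α) (c / q) := by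
    rintro β ⟨⟨j, m, hj, hm⟩, hβ⟩
    rw [mem_iUnion₂]
    refine ⟨(j, m - ⌊j * α⌋), ?_, ?_⟩
    · rw [Finset.mem_product, Finset.mem_Ioo, Finset.mem_Icc]
      have := abs_lt.1 hj
      refine ⟨this, ?_⟩
      have h1 := Int.floor_le (j * α)
      have h2 := Int.lt_floor_add_one (j * α)
      have h3 := abs_lt.1 (hm.trans_le hcq)
      have h4 : ((m - ⌊(j : ℝ) * α⌋ : ℤ) : ℝ) < ((3 : ℤ) : ℝ) := by
        push_cast; linarith [hβ.2]
      have h5 : ((-2 : ℤ) : ℝ) < ((m - ⌊(j : ℝ) * α⌋ : ℤ) : ℝ) := by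
        push_cast; linarith [hβ.1]
      rw [Int.cast_lt] at h4 h5
      simp only
      omega
    · rw [Metric.mem_ball, Real.dist_eq]
      convert hm using 2
      push_cast; ring
  refine (measure_mono hsub).trans ((measure_biUnion_finset_le _ _).trans ?_)
  simp only [Real.volume_ball, Finset.sum_const, nsmul_eq_mul]
  rw [← ENNReal.ofReal_natCast, ← ENNReal.ofReal_mul (by positivity)]
  refine ENNReal.ofReal_le_ofReal ?_
  have hJ : (J.card : ℝ) ≤ 8 * q := by
    rw [Finset.card_product, Int.card_Ioo, Int.card_Icc]
    have : (((q : ℤ) - -(q : ℤ) - 1).toNat : ℕ) ≤ 2 * q := by omega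
    have h2 : ((2 + 1 - -1 : ℤ).toNat) = 4 := rfl
    rw [h2]
    have : ((((q : ℤ) - -(q : ℤ) - 1).toNat : ℕ) : ℝ) ≤ 2 * q := by exact_mod_cast this
    push_cast
    linarith
  calc (J.card : ℝ) * (2 * (c / q)) ≤ (8 * q) * (2 * (c / q)) := by gcongr
    _ = 16 * c := by field_simp; norm_num

theorem ae_goodBeta {α : ℝ} (hα : Irrational α) :
    ∀ᵐ β ∂(volume : Measure ℝ), β ∈ Ioo (0 : ℝ) 1 → GoodBeta α β := by
  choose P Q hQ hPQ using exists_dirichletApprox hα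
  set B : ℝ → ℕ → Set ℝ := fun c N => ⋂ k ≥ N, (badSet α c (Q k) ∩ Ioo 0 1)
  have hB : ∀ c : ℝ, 0 < c → c ≤ 1 / 2 → volume (⋃ N, B c N) ≤ ENNReal.ofReal (16 * c) := by
    intro c hc hc2
    have hmono : Monotone (B c) := by
      intro N N' h
      refine iInter_mono fun k => ?_
      intro x hx
      rw [mem_iInter] at hx ⊢
      exact fun hk => hx (ge_trans hk h)
    rw [hmono.measure_iUnion]
    refine iSup_le fun N => ?_
    refine (measure_mono ?_).trans (volume_badSet_le α hc2 hc (hPQ N).pos)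
    exact iInter₂_subset (s := fun k (_ : k ≥ N) => badSet α c (Q k) ∩ Ioo 0 1) N le_rfl
  have h0 : volume (⋂ n : ℕ, ⋃ N, B (1 / (n + 2)) N) = 0 := by
    refine le_antisymm ?_ bot_le
    have hlim : Tendsto (fun n : ℕ => ENNReal.ofReal (16 * (1 / ((n : ℝ) + 2)))) atTop (𝓝 0) := by
      rw [← ENNReal.ofReal_zero]
      refine ENNReal.tendsto_ofReal ?_
      have h1 : Tendsto (fun n : ℕ => 1 / ((n : ℝ) + 2)) atTop (𝓝 0) := by
        have := (tendsto_add_atTop_iff_nat (f := fun n : ℕ => 1 / (n : ℝ)) 2).2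
          tendsto_one_div_atTop_nhds_zero_nat
        simpa using this
      simpa using h1.const_mul 16
    refine ge_of_tendsto' hlim fun n => ?_
    refine (measure_mono (iInter_subset _ n)).trans (hB _ (by positivity) ?_)
    rw [div_le_div_iff₀ (by positivity) (by norm_num)]
    have : (0 : ℝ) ≤ n := by positivity
    linarith
  have h1 : volume (range fun x : ℤ × ℤ => (x.1 : ℝ) * α + x.2) = 0 :=
    (countable_range _).measure_zero _
  filter_upwards [compl_mem_ae_iff.2 h0, compl_mem_ae_iff.2 h1] with β hβ0 hβ1 hβ
  refine ⟨fun j m h => hβ1 ⟨(j, m), h⟩, ?_⟩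
  simp only [mem_compl_iff, mem_iInter, not_forall, mem_iUnion, not_exists] at hβ0
  obtain ⟨n, hn⟩ := hβ0
  refine ⟨1 / (n + 2), by positivity, ?_, fun n₀ => ?_⟩
  · rw [div_le_div_iff₀ (by positivity) (by norm_num)]
    have : (0 : ℝ) ≤ n := by positivity
    linarith
  · have := hn n₀
    simp only [B, mem_iInter, not_forall] at this
    obtain ⟨k, hk, hbad⟩ := this
    refine ⟨P k, Q k, hk.trans (hQ k), hPQ k, fun j m hj => ?_⟩
    by_contra hlt
    exact hbad ⟨⟨j, m, hj, not_le.1 hlt⟩, hβ⟩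

/-! ### Transfer matrices -/

/-- The square summable real sequences. -/
abbrev L2Z : Type := lp (fun _ : ℤ => ℝ) 2

theorem summable_sq (u : L2Z) : Summable fun n => (u n) ^ 2 := by
  have := lp.summable_inner (𝕜 := ℝ) u u
  refine this.congr fun n => ?_
  simp [pow_two]

theorem norm_sq_eq_tsum (u : L2Z) : ‖u‖ ^ 2 = ∑' n, (u n) ^ 2 := by
  rw [← real_inner_self_eq_norm_sq, lp.inner_eq_tsum]
  refine tsum_congr fun n => ?_
  simp [pow_two]

theorem summable_sq_shift (u : L2Z) (k : ℤ) : Summable fun n => (u (n + k)) ^ 2 :=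
  (Equiv.addRight k).summable_iff.2 (summable_sq u)

theorem tsum_sq_shift (u : L2Z) (k : ℤ) : ∑' n, (u (n + k)) ^ 2 = ‖u‖ ^ 2 := by
  rw [norm_sq_eq_tsum]
  exact (Equiv.addRight k).tsum_eq (fun n => (u n) ^ 2)

section Matrices

attribute [local instance] Matrix.linftyOpNormedAddCommGroup Matrix.linftyOpNormedSpace
  Matrix.linftyOpNormedRing Matrix.linftyOpNormedAlgebra

/-- The one-step transfer matrix. -/
def stepMat (a : ℝ) (z : ℂ) : Matrix (Fin 2) (Fin 2) ℂ := !![z - a, -1; 1, 0]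

/-- The `n`-step transfer matrix. -/
def transMat : ℕ → (ℕ → ℝ) → ℂ → Matrix (Fin 2) (Fin 2) ℂ
  | 0, _, _ => 1
  | n + 1, v, z => stepMat (v n) z * transMat n v z

theorem transMat_add (n m : ℕ) (v : ℕ → ℝ) (z : ℂ) :
    transMat (n + m) v z = transMat n (fun i => v (i + m)) z * transMat m v z := by
  induction n with
  | zero => simp [transMat]
  | succ n ih => rw [show n + 1 + m = (n + m) + 1 by ring, transMat, ih, transMat, mul_assoc]

theorem transMat_congr {n : ℕ} {v w : ℕ → ℝ} (z : ℂ) (h : ∀ i < n, v i = w i) :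
    transMat n v z = transMat n w z := by
  induction n with
  | zero => rfl
  | succ n ih => rw [transMat, transMat, ih fun i hi => h i (by omega), h n (by omega)]

theorem det_transMat (n : ℕ) (v : ℕ → ℝ) (z : ℂ) : (transMat n v z).det = 1 := by
  induction n with
  | zero => simp [transMat]
  | succ n ih => rw [transMat, Matrix.det_mul, ih, stepMat, Matrix.det_fin_two_of]; simp

theorem norm_mat (M : Matrix (Fin 2) (Fin 2) ℂ) :
    ‖M‖ = max (‖M 0 0‖ + ‖M 0 1‖) (‖M 1 0‖ + ‖M 1 1‖) := by
  rw [Matrix.linfty_opNorm_def]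
  have : (Finset.univ : Finset (Fin 2)) = {0, 1} := rfl
  simp [this, Finset.sup_insert]

theorem one_le_norm_of_det {M : Matrix (Fin 2) (Fin 2) ℂ} (h : M.det = 1) : 1 ≤ ‖M‖ := by
  have h0 := (norm_mat M).ge
  have h1 := (le_max_left _ _).trans h0
  have h2 := (le_max_right _ _).trans h0
  have h3 : (1 : ℝ) ≤ ‖M 0 0‖ * ‖M 1 1‖ + ‖M 0 1‖ * ‖M 1 0‖ := by
    calc (1 : ℝ) = ‖M.det‖ := by rw [h]; simp
      _ ≤ _ := by
        rw [Matrix.det_fin_two, ← norm_mul, ← norm_mul]; exact norm_sub_le _ _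
  have p1 := norm_nonneg (M 0 0)
  have p2 := norm_nonneg (M 0 1)
  have p3 := norm_nonneg (M 1 0)
  have p4 := norm_nonneg (M 1 1)
  by_contra! hlt
  nlinarith

theorem norm_stepMat_le {a : ℝ} (ha : a ∈ Icc (0 : ℝ) 1) (z : ℂ) : ‖stepMat a z‖ ≤ ‖z‖ + 2 := by
  rw [norm_mat]
  have h1 : ‖(a : ℂ)‖ ≤ 1 := by
    rw [Complex.norm_real, Real.norm_eq_abs, abs_of_nonneg ha.1]; exact ha.2
  have h2 := norm_sub_le z (a : ℂ)
  have h3 := norm_nonneg z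
  refine max_le ?_ ?_ <;> simp [stepMat] <;> linarith

theorem norm_transMat_le (n : ℕ) {v : ℕ → ℝ} (hv : UnitSeq v) (z : ℂ) :
    ‖transMat n v z‖ ≤ (‖z‖ + 2) ^ n := by
  induction n with
  | zero => simp [transMat]
  | succ n ih =>
    rw [transMat, pow_succ']
    refine (norm_mul_le _ _).trans ?_
    have := norm_stepMat_le (hv n) z
    gcongr

theorem norm_stepMat_sub (a : ℝ) (z w : ℂ) : ‖stepMat a z - stepMat a w‖ = ‖z - w‖ := by
  rw [norm_mat]
  simp [stepMat]

theorem norm_transMat_sub_le (n : ℕ) {v : ℕ → ℝ} (hv : UnitSeq v) {z w : ℂ} {r : ℝ}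
    (hz : ‖z‖ ≤ r) (hw : ‖w‖ ≤ r) :
    ‖transMat n v z - transMat n v w‖ ≤ n * (r + 2) ^ n * ‖z - w‖ := by
  have hr : 0 ≤ r := (norm_nonneg z).trans hz
  induction n with
  | zero => simp [transMat]
  | succ n ih =>
    have e : transMat (n + 1) v z - transMat (n + 1) v w =
        stepMat (v n) z * (transMat n v z - transMat n v w)
          + (stepMat (v n) z - stepMat (v n) w) * transMat n v w := by
      rw [transMat, transMat, mul_sub, sub_mul]; abel
    rw [e]
    have h1 := (norm_stepMat_le (hv n) z).trans (by linarith : ‖z‖ + 2 ≤ r + 2)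
    have h2 : ‖transMat n v w‖ ≤ (r + 2) ^ n :=
      (norm_transMat_le n hv w).trans (by gcongr)
    calc _ ≤ ‖stepMat (v n) z‖ * ‖transMat n v z - transMat n v w‖
          + ‖stepMat (v n) z - stepMat (v n) w‖ * ‖transMat n v w‖ :=
          (norm_add_le _ _).trans (add_le_add (norm_mul_le _ _) (norm_mul_le _ _))
      _ ≤ (r + 2) * (n * (r + 2) ^ n * ‖z - w‖) + ‖z - w‖ * (r + 2) ^ n := by
          rw [norm_stepMat_sub]
          gcongr
      _ ≤ (r + 2) * (n * (r + 2) ^ n * ‖z - w‖) + ‖z - w‖ * (r + 2) ^ (n + 1) := by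
          have : (r + 2) ^ n ≤ (r + 2) ^ (n + 1) :=
            pow_le_pow_right₀ (by linarith) (by omega)
          gcongr
      _ = _ := by push_cast; ring

/-- If a vector is neither expanded by `Q` nor contracted strongly by `P⁻¹`, then `‖Q * P‖` is
comparable with the larger of `‖Q‖` and `‖P‖`. -/
theorem norm_mul_le_of_vector {P Q : Matrix (Fin 2) (Fin 2) ℂ} (hP : P.det = 1) {R K : ℝ}
    (hPR : ‖P‖ ≤ R) (hQR : ‖Q‖ ≤ R) {y : Fin 2 → ℂ}
    (h1 : ‖y‖ ≤ K * ‖P.mulVec y‖) (h2 : ‖Q.mulVec (P.mulVec y)‖ ≤ K * ‖P.mulVec y‖)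
    (hx : 0 < ‖P.mulVec y‖) : ‖Q * P‖ ≤ 4 * K * R := by
  set x := P.mulVec y with hxdef
  have hR : 0 ≤ R := (norm_nonneg _).trans hPR
  have hK : 0 ≤ K := by
    by_contra! hK
    nlinarith [norm_nonneg y]
  rw [Matrix.linfty_opNorm_eq_opNorm]
  refine ContinuousLinearMap.opNorm_le_bound _ (by positivity) fun e => ?_
  change ‖(Q * P).mulVec e‖ ≤ _
  have hxi : ∀ i, ‖x i‖ ≤ ‖x‖ := norm_le_pi_norm x
  have hyi : ∀ i, ‖y i‖ ≤ K * ‖x‖ := fun i => (norm_le_pi_norm y i).trans h1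
  have hei : ∀ i, ‖e i‖ ≤ ‖e‖ := norm_le_pi_norm e
  have hPe : ∀ i, ‖P.mulVec e i‖ ≤ R * ‖e‖ := fun i =>
    (norm_le_pi_norm _ i).trans ((Matrix.linfty_opNorm_mulVec P e).trans (by gcongr))
  set t : Fin 2 → ℂ := ![-star (x 1), star (x 0)] with ht
  have htn : ‖t‖ ≤ ‖x‖ := by
    rw [pi_norm_le_iff_of_nonneg (norm_nonneg _)]
    intro i
    fin_cases i
    · simpa [ht] using hxi 1
    · simpa [ht] using hxi 0
  set s : ℝ := ‖x 0‖ ^ 2 + ‖x 1‖ ^ 2 with hs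
  have hsx : ‖x‖ ^ 2 ≤ s := by
    have : ‖x‖ ≤ max ‖x 0‖ ‖x 1‖ := by
      rw [pi_norm_le_iff_of_nonneg (by positivity)]
      intro i
      fin_cases i
      · exact le_max_left _ _
      · exact le_max_right _ _
    rcases max_choice ‖x 0‖ ‖x 1‖ with h | h <;> rw [h] at this <;>
      nlinarith [norm_nonneg (x 0), norm_nonneg (x 1), norm_nonneg x]
  have hsC : (s : ℂ) = x 0 * star (x 0) + x 1 * star (x 1) := by
    rw [hs]; push_cast
    simp [Complex.mul_conj, Complex.normSq_eq_norm_sq]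
  set c : ℂ := star (x 0) * P.mulVec e 0 + star (x 1) * P.mulVec e 1 with hc
  set d : ℂ := y 0 * e 1 - y 1 * e 0 with hd
  have hdP : x 0 * P.mulVec e 1 - x 1 * P.mulVec e 0 = d := by
    have : x 0 * P.mulVec e 1 - x 1 * P.mulVec e 0 = P.det * d := by
      rw [hd, Matrix.det_fin_two, hxdef]
      simp only [Matrix.mulVec, dotProduct, Fin.sum_univ_two]
      ring
    rw [this, hP, one_mul]
  have key : (s : ℂ) • P.mulVec e = c • x + d • t := by
    ext i
    rw [hsC, ← hdP, hc, ht]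
    fin_cases i
    · simp; ring
    · simp; ring
  have hcn : ‖c‖ ≤ 2 * (‖x‖ * (R * ‖e‖)) := by
    calc ‖c‖ ≤ ‖x 0‖ * ‖P.mulVec e 0‖ + ‖x 1‖ * ‖P.mulVec e 1‖ := by
          refine (norm_add_le _ _).trans (le_of_eq ?_)
          rw [norm_mul, norm_mul, norm_star, norm_star]
      _ ≤ ‖x‖ * (R * ‖e‖) + ‖x‖ * (R * ‖e‖) := by
          gcongr
          · exact hxi 0
          · exact hPe 0
          · exact hxi 1
          · exact hPe 1
      _ = _ := by ring
  have hdn : ‖d‖ ≤ 2 * (K * ‖x‖ * ‖e‖) := by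
    calc ‖d‖ ≤ ‖y 0‖ * ‖e 1‖ + ‖y 1‖ * ‖e 0‖ := by
          refine (norm_sub_le _ _).trans (le_of_eq ?_)
          rw [norm_mul, norm_mul]
      _ ≤ K * ‖x‖ * ‖e‖ + K * ‖x‖ * ‖e‖ := by
          gcongr
          · exact hyi 0
          · exact hei 1
          · exact hyi 1
          · exact hei 0
      _ = _ := by ring
  have hQt : ‖Q.mulVec t‖ ≤ R * ‖x‖ :=
    (Matrix.linfty_opNorm_mulVec Q t).trans (by gcongr)
  have hfin : s * ‖(Q * P).mulVec e‖ ≤ ‖x‖ ^ 2 * (4 * K * R * ‖e‖) := by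
    have hs0 : 0 ≤ s := (sq_nonneg _).trans hsx
    calc s * ‖(Q * P).mulVec e‖ = ‖Q.mulVec ((s : ℂ) • P.mulVec e)‖ := by
          rw [Matrix.mulVec_smul, norm_smul, Matrix.mulVec_mulVec, Complex.norm_real,
            Real.norm_of_nonneg hs0]
      _ = ‖c • Q.mulVec x + d • Q.mulVec t‖ := by
          rw [key, Matrix.mulVec_add, Matrix.mulVec_smul, Matrix.mulVec_smul]
      _ ≤ ‖c‖ * ‖Q.mulVec x‖ + ‖d‖ * ‖Q.mulVec t‖ := by
          refine (norm_add_le _ _).trans ?_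
          rw [norm_smul, norm_smul]
      _ ≤ (2 * (‖x‖ * (R * ‖e‖))) * (K * ‖x‖) + (2 * (K * ‖x‖ * ‖e‖)) * (R * ‖x‖) := by
          gcongr
      _ = _ := by ring
  have h5 : ‖x‖ ^ 2 * ‖(Q * P).mulVec e‖ ≤ ‖x‖ ^ 2 * (4 * K * R * ‖e‖) :=
    le_trans (by gcongr) hfin
  exact le_of_mul_le_mul_left h5 (by positivity)

/-- The logarithm of the norm of the transfer matrix. -/
noncomputable def logNorm (n : ℕ) (v : ℕ → ℝ) (z : ℂ) : ℝ := Real.log ‖transMat n v z‖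

theorem norm_transMat_pos (n : ℕ) (v : ℕ → ℝ) (z : ℂ) : 0 < ‖transMat n v z‖ :=
  one_pos.trans_le (one_le_norm_of_det (det_transMat n v z))

theorem logNorm_nonneg (n : ℕ) (v : ℕ → ℝ) (z : ℂ) : 0 ≤ logNorm n v z :=
  Real.log_nonneg (one_le_norm_of_det (det_transMat n v z))

theorem logNorm_le (n : ℕ) {v : ℕ → ℝ} (hv : UnitSeq v) (z : ℂ) :
    logNorm n v z ≤ n * Real.log (‖z‖ + 2) := by
  rw [← Real.log_pow]
  exact Real.log_le_log (norm_transMat_pos _ _ _) (norm_transMat_le n hv z)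

theorem logNorm_add_le (n m : ℕ) (v : ℕ → ℝ) (z : ℂ) :
    logNorm (n + m) v z ≤ logNorm m v z + logNorm n (fun i => v (i + m)) z := by
  unfold logNorm
  rw [← Real.log_mul (norm_transMat_pos _ _ _).ne' (norm_transMat_pos _ _ _).ne', mul_comm,
    transMat_add]
  refine Real.log_le_log ?_ (norm_mul_le _ _)
  rw [← transMat_add]
  exact norm_transMat_pos _ _ _

theorem logNorm_congr {n : ℕ} {v w : ℕ → ℝ} (z : ℂ) (h : ∀ i < n, v i = w i) :
    logNorm n v z = logNorm n w z := by
  rw [logNorm, logNorm, transMat_congr z h]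

/-- The right half-line of a two-sided sequence. -/
def fwd (ω : ℤ → ℝ) : ℕ → ℝ := fun j => ω j

/-- Dichotomy: either `H - E` is bounded below or some transfer matrix of length `h + k` is not
much larger than its two factors. -/
theorem exists_logNorm_le {V : ℤ → ℝ} (hV : ∀ n, V n ∈ Icc (0 : ℝ) 1) {H : L2Z →L[ℝ] L2Z}
    (hH : IsSchrodingerOp V H) {E : ℝ} (hE : ∀ C : ℝ, ∃ u : L2Z, C * ‖H u - E • u‖ < ‖u‖)
    (h k : ℕ) : ∃ n : ℤ, ∀ R, logNorm h (fwd fun i => V (n + i)) E ≤ R →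
      logNorm k (fwd fun i => V (n + h + i)) E ≤ R →
      logNorm (h + k) (fwd fun i => V (n + i)) E ≤ Real.log 40 + R := by
  by_contra! hcon
  have hexp : ∀ n : ℤ, ∀ y : Fin 2 → ℂ,
      10 * ‖(transMat h (fwd fun i => V (n + i)) E).mulVec y‖ ≤
        ‖y‖ + ‖(transMat (h + k) (fwd fun i => V (n + i)) E).mulVec y‖ := by
    intro n y
    obtain ⟨R, hR1, hR2, hR3⟩ := hcon n
    by_contra! hlt
    set P := transMat h (fwd fun i => V (n + i)) E with hP
    set Q := transMat k (fwd fun i => V (n + h + i)) E with hQ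
    have hQP : transMat (h + k) (fwd fun i => V (n + i)) E = Q * P := by
      rw [add_comm, transMat_add, hQ]
      congr 2
      ext i
      simp only [fwd]; push_cast; congr 1; ring
    have hy := norm_nonneg y
    have hq := norm_nonneg ((Q * P).mulVec y)
    rw [hQP] at hlt
    have e1 : ‖P‖ ≤ Real.exp R := (Real.log_le_iff_le_exp (norm_transMat_pos _ _ _)).1 hR1
    have e2 : ‖Q‖ ≤ Real.exp R := (Real.log_le_iff_le_exp (norm_transMat_pos _ _ _)).1 hR2
    have := norm_mul_le_of_vector (det_transMat h _ _) e1 e2 (K := 10) (y := y)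
      (by linarith) (by rw [Matrix.mulVec_mulVec]; linarith) (by linarith)
    have h3 : logNorm (h + k) (fwd fun i => V (n + i)) E ≤ Real.log 40 + R := by
      rw [logNorm, hQP, ← Real.log_exp R, ← Real.log_mul (by norm_num) (Real.exp_pos _).ne']
      refine Real.log_le_log ?_ (by linarith)
      rw [← hQP]; exact norm_transMat_pos _ _ _
    linarith
  set B : ℝ := |E| + 2 with hB
  have hB1 : 1 ≤ B := by have := abs_nonneg E; linarith
  have hmain : ∀ u : L2Z, ‖u‖ ≤ (11 * B ^ (h + k) * (h + k : ℕ)) * ‖H u - E • u‖ := by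
    intro u
    set f : L2Z := H u - E • u with hf
    have hfn : ∀ n, u (n + 1) = (E - V n) * u n - u (n - 1) + f n := by
      intro n
      have : f n = (H u) n - E * u n := rfl
      rw [this, hH u n]; ring
    set U : ℤ → Fin 2 → ℂ := fun n => ![(u n : ℂ), (u (n - 1) : ℂ)] with hU
    have hstep : ∀ n, U (n + 1) = (stepMat (V n) E).mulVec (U n) + ![(f n : ℂ), 0] := by
      intro n
      ext i
      fin_cases i
      · simp [hU, stepMat, hfn n]; ring
      · simp [hU, stepMat]
    set S : ℤ → ℕ → ℝ := fun n L => ∑ i ∈ Finset.range L, |f (n + i)| with hS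
    have hS0 : ∀ n L, 0 ≤ S n L := fun n L => Finset.sum_nonneg fun _ _ => abs_nonneg _
    have herr : ∀ n : ℤ, ∀ j : ℕ,
        ‖U (n + j) - (transMat j (fwd fun i => V (n + i)) E).mulVec (U n)‖ ≤ B ^ j * S n j := by
      intro n j
      induction j with
      | zero => simp [transMat, hS]
      | succ j ih =>
        have e : U (n + (j + 1 : ℕ)) - (transMat (j + 1) (fwd fun i => V (n + i)) E).mulVec (U n)
            = (stepMat (V (n + j)) E).mulVec
              (U (n + j) - (transMat j (fwd fun i => V (n + i)) E).mulVec (U n))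
              + ![(f (n + j) : ℂ), 0] := by
          push_cast
          rw [← add_assoc, hstep, transMat, Matrix.mulVec_sub, Matrix.mulVec_mulVec]
          simp only [fwd]
          abel
        rw [e]
        have h1 : ‖(![(f (n + j) : ℂ), 0] : Fin 2 → ℂ)‖ ≤ |f (n + j)| := by
          rw [pi_norm_le_iff_of_nonneg (abs_nonneg _)]
          intro i
          fin_cases i <;> simp
        have h2 : ‖stepMat (V (n + j)) E‖ ≤ B := by
          have := norm_stepMat_le (hV (n + j)) (E : ℂ)
          rwa [Complex.norm_real, Real.norm_eq_abs] at this
        refine (norm_add_le _ _).trans ?_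
        have h3 := Matrix.linfty_opNorm_mulVec (stepMat (V (n + j)) E)
          (U (n + j) - (transMat j (fwd fun i => V (n + i)) E).mulVec (U n))
        have h4 : S n (j + 1) = S n j + |f (n + j)| := Finset.sum_range_succ _ _
        rw [h4]
        have h5 : 1 ≤ B ^ (j + 1) := one_le_pow₀ hB1
        calc _ ≤ B * (B ^ j * S n j) + |f (n + j)| := by
              refine add_le_add (h3.trans ?_) h1
              gcongr
          _ ≤ B * (B ^ j * S n j) + B ^ (j + 1) * |f (n + j)| := by
              have := le_mul_of_one_le_left (abs_nonneg (f (n + j))) h5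
              linarith
          _ = _ := by ring
    set D : ℝ := 11 * B ^ (h + k) with hD
    have hD0 : 0 ≤ D := by positivity
    have hpt : ∀ n : ℤ, 10 * |u (n + h)| ≤ |u n| + |u (n + (-1))| + |u (n + (h + k : ℕ))|
        + |u (n + ((h + k : ℕ) - 1))| + D * S n (h + k) := by
      intro n
      have h1 := hexp n (U n)
      have h2 := herr n h
      have h3 := herr n (h + k)
      have h4 : S n h ≤ S n (h + k) :=
        Finset.sum_le_sum_of_subset_of_nonneg (Finset.range_mono (by omega))
          fun _ _ _ => abs_nonneg _
      have h5 : B ^ h ≤ B ^ (h + k) := pow_le_pow_right₀ hB1 (by omega)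
      have h6 : B ^ h * S n h ≤ B ^ (h + k) * S n (h + k) := by
        have := hS0 n h
        gcongr
      have h7 : |u (n + h)| ≤ ‖U (n + h)‖ := by
        have := norm_le_pi_norm (U (n + h)) 0
        simpa [hU] using this
      have h8 : ∀ m, ‖U m‖ ≤ |u m| + |u (m - 1)| := by
        intro m
        rw [pi_norm_le_iff_of_nonneg (by positivity)]
        intro i
        fin_cases i <;> simp [hU]
      have h9 := norm_sub_norm_le (U (n + h))
        ((transMat h (fwd fun i => V (n + i)) E).mulVec (U n))
      have h10 := norm_sub_norm_le
        ((transMat (h + k) (fwd fun i => V (n + i)) E).mulVec (U n)) (U (n + (h + k : ℕ)))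
      rw [norm_sub_rev] at h10
      have h11 := h8 n
      have h12 := h8 (n + (h + k : ℕ))
      rw [sub_eq_add_neg n 1] at h11
      rw [add_sub_assoc] at h12
      rw [hD]
      linarith
    have hsq : ∀ n : ℤ, 100 * (u (n + h)) ^ 2 ≤ 5 * ((u n) ^ 2 + (u (n + (-1))) ^ 2
        + (u (n + (h + k : ℕ))) ^ 2 + (u (n + ((h + k : ℕ) - 1))) ^ 2
        + D ^ 2 * ((h + k : ℕ) * ∑ i ∈ Finset.range (h + k), (f (n + i)) ^ 2)) := by
      intro n
      have h1 := hpt n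
      have h2 : (S n (h + k)) ^ 2 ≤ (h + k : ℕ) * ∑ i ∈ Finset.range (h + k), (f (n + i)) ^ 2 := by
        have := sq_sum_le_card_mul_sum_sq (s := Finset.range (h + k)) (f := fun i => |f (n + i)|)
        simpa using this
      have h3 : D ^ 2 * (S n (h + k)) ^ 2 ≤
          D ^ 2 * ((h + k : ℕ) * ∑ i ∈ Finset.range (h + k), (f (n + i)) ^ 2) := by gcongr
      rw [← sq_abs (u (n + h)), ← sq_abs (u n), ← sq_abs (u (n + (-1))),
        ← sq_abs (u (n + (h + k : ℕ))), ← sq_abs (u (n + ((h + k : ℕ) - 1)))]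
      set a0 := |u (n + h)|
      set a1 := |u n|
      set a2 := |u (n + (-1))|
      set a3 := |u (n + (h + k : ℕ))|
      set a4 := |u (n + ((h + k : ℕ) - 1))|
      set a5 := D * S n (h + k)
      have ha : (10 * a0) ^ 2 ≤ (a1 + a2 + a3 + a4 + a5) ^ 2 :=
        pow_le_pow_left₀ (by positivity) h1 2
      have hb : a5 ^ 2 = D ^ 2 * (S n (h + k)) ^ 2 := by ring
      nlinarith [sq_nonneg (a1 - a2), sq_nonneg (a1 - a3), sq_nonneg (a1 - a4), sq_nonneg (a1 - a5),
        sq_nonneg (a2 - a3), sq_nonneg (a2 - a4), sq_nonneg (a2 - a5), sq_nonneg (a3 - a4),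
        sq_nonneg (a3 - a5), sq_nonneg (a4 - a5)]
    have hfs : HasSum (fun n : ℤ => ∑ i ∈ Finset.range (h + k), (f (n + i)) ^ 2)
        (∑ _i ∈ Finset.range (h + k), ‖f‖ ^ 2) :=
      hasSum_sum fun i _ => by
        rw [← tsum_sq_shift f i]; exact (summable_sq_shift f i).hasSum
    have hs : ∀ m : ℤ, HasSum (fun n => (u (n + m)) ^ 2) (‖u‖ ^ 2) := fun m => by
      rw [← tsum_sq_shift u m]; exact (summable_sq_shift u m).hasSum
    have hs0 : HasSum (fun n => (u n) ^ 2) (‖u‖ ^ 2) := by simpa using hs 0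
    have hsum := hasSum_le hsq ((hs h).mul_left 100)
      (((((hs0.add (hs (-1))).add (hs (h + k : ℕ))).add (hs ((h + k : ℕ) - 1))).add
        ((hfs.mul_left ((h + k : ℕ) : ℝ)).mul_left (D ^ 2))).mul_left 5)
    simp only [Finset.sum_const, Finset.card_range, nsmul_eq_mul] at hsum
    have h80 : ‖u‖ ^ 2 ≤ (D * (h + k : ℕ) * ‖f‖) ^ 2 := by
      have e : (D * (h + k : ℕ) * ‖f‖) ^ 2 = D ^ 2 * ((h + k : ℕ) * ((h + k : ℕ) * ‖f‖ ^ 2)) := by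
        ring
      rw [e]
      have : 0 ≤ D ^ 2 * ((h + k : ℕ) * ((h + k : ℕ) * ‖f‖ ^ 2)) := by positivity
      linarith
    exact le_of_sq_le_sq h80 (by positivity)
  obtain ⟨u, hu⟩ := hE (11 * B ^ (h + k) * (h + k : ℕ))
  exact absurd (hmain u) (not_le.2 hu)

end Matrices

/-! ### Vanishing of the uniform Lyapunov exponent on the spectrum -/

open Classical in
/-- A subadditive process which is small along separated visits of positive density grows slowly. -/
theorem subadditive_le_sub_count {f : ℕ → ℕ → ℝ}
    (hsub : ∀ i n m, f i (n + m) ≤ f i n + f (i + n) m) {a C s : ℝ} {l : ℕ} (hl : 0 < l)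
    (hub : ∀ i n : ℕ, f i n ≤ a * n + C) {p : ℕ → Prop} (hp : ∀ i, p i → f i l ≤ s)
    (hsep : ∀ i j, p i → p j → i < j → i + l ≤ j) (hD : 0 ≤ a * l - s - C) (M i : ℕ) :
    f i M ≤ a * M + C - (a * l - s - C) * Nat.count (fun k => p (i + k)) (M + 1 - l) := by
  induction M using Nat.strong_induction_on generalizing i with
  | _ M ih =>
    by_cases hex : ∃ j, j < M + 1 - l ∧ p (i + j)
    · obtain ⟨j, hj1, hj2, hmin⟩ : ∃ j, j < M + 1 - l ∧ p (i + j) ∧ ∀ k < j, ¬ p (i + k) :=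
        ⟨Nat.find hex, (Nat.find_spec hex).1, (Nat.find_spec hex).2, fun k hk hpk =>
          Nat.find_min hex hk ⟨lt_trans hk (Nat.find_spec hex).1, hpk⟩⟩
      obtain ⟨M', rfl⟩ : ∃ M', M = j + (l + M') := ⟨M - j - l, by omega⟩
      have h1 := hsub i j (l + M')
      have h2 := hsub (i + j) l M'
      have h3 := hub i j
      have h4 := hp _ hj2
      have h5 := ih M' (by omega) (i + j + l)
      have hc : Nat.count (fun k => p (i + k)) (j + (l + M') + 1 - l)
          ≤ 1 + Nat.count (fun k => p (i + j + l + k)) (M' + 1 - l) := by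
        refine (Nat.count_monotone _ (show _ ≤ j + (l + (M' + 1 - l)) by omega)).trans ?_
        rw [Nat.count_add, Nat.count_add, Nat.count_of_forall_not hmin, zero_add]
        refine add_le_add ?_ (le_of_eq ?_)
        · obtain ⟨l', rfl⟩ := Nat.exists_eq_succ_of_ne_zero hl.ne'
          rw [Nat.count_succ', Nat.count_of_forall_not]
          · split_ifs <;> simp
          · intro k hk hpk
            have := hsep _ _ hj2 hpk (by omega)
            omega
        · congr 1
          ext k
          rw [show i + (j + (l + k)) = i + j + l + k by ring]
      have hc' : (Nat.count (fun k => p (i + k)) (j + (l + M') + 1 - l) : ℝ)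
          ≤ 1 + Nat.count (fun k => p (i + j + l + k)) (M' + 1 - l) := by exact_mod_cast hc
      have h6 := mul_le_mul_of_nonneg_left hc' hD
      push_cast
      nlinarith
    · push Not at hex
      rw [Nat.count_of_forall_not hex]
      simpa using hub i M

/-- Words of length at most `q / 2` are constant on one-sided neighbourhoods of each phase. -/
theorem exists_arc {α β c : ℝ} (hβ : β ∈ Ioo (0 : ℝ) 1) {p : ℤ} {q : ℕ}
    (hpq : DirichletApprox α p q) (hc1 : c ≤ 1 / 2)
    (hgood : ∀ j m : ℤ, |j| < q → c / q ≤ |j * α - m + β|) {l : ℕ} (hl : 2 * l ≤ q) (θ : ℝ) :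
    ∃ b : ℝ, ∀ φ ∈ Ioo b (b + c / (2 * q)), ∀ i < l, fwd (circleV α β φ) i =
      fwd (circleV α β θ) i := by
  by_contra! hcon
  have hq : (0 : ℝ) < q := by exact_mod_cast hpq.pos
  have hq1 : (1 : ℝ) ≤ q := by exact_mod_cast hpq.pos
  obtain ⟨φ₁, h1, i₁, hi₁, hne₁⟩ := hcon θ
  obtain ⟨φ₂, h2, i₂, hi₂, hne₂⟩ := hcon (θ - c / (2 * q))
  rw [sub_add_cancel] at h2
  obtain ⟨m₁, b₁, hb₁, hl₁, hr₁⟩ := exists_between_of_circleV_ne α hβ h1.1.le hne₁.symm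
  obtain ⟨m₂, b₂, hb₂, hl₂, hr₂⟩ := exists_between_of_circleV_ne α hβ h2.2.le hne₂
  push_cast at hl₁ hr₁ hl₂ hr₂
  have hcq : c / (2 * q) + c / (2 * q) = c / q := by field_simp; norm_num
  have hx0 : 0 < (m₁ - m₂) - ((i₁ : ℝ) - i₂) * α - (b₁ - b₂) := by nlinarith
  have hx1 : (m₁ - m₂) - ((i₁ : ℝ) - i₂) * α - (b₁ - b₂) < c / q := by
    nlinarith [h1.2, h2.1]
  have hcq2 : c / q ≤ 1 / (2 * q) := by
    rw [div_le_div_iff₀ hq (by positivity)]; nlinarith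
  have hjabs : 2 * |(i₁ : ℤ) - i₂| ≤ q ∧ |(i₁ : ℤ) - i₂| < q := by
    have := abs_lt.2 (⟨by omega, by omega⟩ : -(l : ℤ) < (i₁ : ℤ) - i₂ ∧ (i₁ : ℤ) - i₂ < l)
    constructor <;> omega
  have same : b₁ = b₂ → False := by
    intro hb
    rw [hb, sub_self, sub_zero] at hx0 hx1
    by_cases hj : (i₁ : ℤ) - i₂ = 0
    · have hj' : (i₁ : ℝ) - i₂ = 0 := by exact_mod_cast hj
      rw [hj', zero_mul, sub_zero] at hx0 hx1
      have h3 : 1 / (2 * q : ℝ) < 1 := by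
        rw [div_lt_one (by positivity)]; linarith
      have h4 : ((0 : ℤ) : ℝ) < ((m₁ - m₂ : ℤ) : ℝ) := by push_cast; linarith
      have h5 : ((m₁ - m₂ : ℤ) : ℝ) < ((1 : ℤ) : ℝ) := by push_cast; linarith
      rw [Int.cast_lt] at h4 h5
      omega
    · have := hpq.dist_int hj hjabs.1 (m₁ - m₂)
      push_cast at this
      rw [abs_sub_comm, abs_of_pos hx0] at this
      linarith
  rcases hb₁ with rfl | rfl <;> rcases hb₂ with rfl | rfl
  · exact same rfl
  · have := hgood (-((i₁ : ℤ) - i₂)) (-(m₁ - m₂)) (by rw [abs_neg]; exact hjabs.2)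
    push_cast at this
    rw [show -((i₁ : ℝ) - i₂) * α - -(m₁ - m₂) + b₂
      = (m₁ - m₂) - ((i₁ : ℝ) - i₂) * α - (0 - b₂) by ring, abs_of_pos hx0] at this
    linarith
  · have := hgood ((i₁ : ℤ) - i₂) (m₁ - m₂) hjabs.2
    push_cast at this
    rw [← abs_neg, show -(((i₁ : ℝ) - i₂) * α - (m₁ - m₂) + b₁)
      = (m₁ - m₂) - ((i₁ : ℝ) - i₂) * α - (b₁ - 0) by ring, abs_of_pos hx0] at this
    linarith
  · exact same rfl

theorem unitSeq_fwd {V : ℤ → ℝ} (hV : ∀ n, V n ∈ Icc (0 : ℝ) 1) : UnitSeq (fwd V) :=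
  fun n => hV n

theorem fwd_shift (α β θ : ℝ) (m : ℕ) :
    (fun i => fwd (circleV α β θ) (i + m)) = fwd (circleV α β (θ + m * α)) := by
  ext i
  simp only [fwd]
  push_cast
  rw [circleV_shift]; simp

theorem fwd_shift_int (α β θ : ℝ) (m : ℤ) :
    (fwd fun i => circleV α β θ (m + i)) = fwd (circleV α β (θ + m * α)) := by
  ext i
  simp only [fwd]
  rw [add_comm m, circleV_shift]

/-- The supremum over all phases of the logarithm of the norm of the transfer matrices. -/
noncomputable def supLogNorm (α β : ℝ) (z : ℂ) (n : ℕ) : ℝ :=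
  ⨆ θ : ℝ, logNorm n (fwd (circleV α β θ)) z

theorem bddAbove_logNorm (α β : ℝ) (z : ℂ) (n : ℕ) :
    BddAbove (range fun θ : ℝ => logNorm n (fwd (circleV α β θ)) z) := by
  refine ⟨n * Real.log (‖z‖ + 2), ?_⟩
  rintro _ ⟨θ, rfl⟩
  exact logNorm_le n (unitSeq_fwd (circleV_mem α β θ)) z

theorem logNorm_le_sup (α β : ℝ) (z : ℂ) (n : ℕ) (θ : ℝ) :
    logNorm n (fwd (circleV α β θ)) z ≤ supLogNorm α β z n :=
  le_ciSup (bddAbove_logNorm α β z n) θ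

theorem logNorm_add_circle (α β θ : ℝ) (z : ℂ) (n m : ℕ) :
    logNorm (n + m) (fwd (circleV α β θ)) z ≤ logNorm n (fwd (circleV α β θ)) z
      + logNorm m (fwd (circleV α β (θ + n * α))) z := by
  rw [← fwd_shift, add_comm n m]
  exact logNorm_add_le m n _ z

theorem subadditive_supLogNorm (α β : ℝ) (z : ℂ) : Subadditive (supLogNorm α β z) := by
  intro n m
  refine ciSup_le fun θ => ?_
  exact (logNorm_add_circle α β θ z n m).trans
    (add_le_add (logNorm_le_sup _ _ _ _ _) (logNorm_le_sup _ _ _ _ _))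

theorem supLogNorm_nonneg (α β : ℝ) (z : ℂ) (n : ℕ) : 0 ≤ supLogNorm α β z n :=
  (logNorm_nonneg n _ z).trans (logNorm_le_sup α β z n 0)

theorem bddBelow_supLogNorm (α β : ℝ) (z : ℂ) :
    BddBelow (range fun n : ℕ => supLogNorm α β z n / n) := by
  refine ⟨0, ?_⟩
  rintro _ ⟨n, rfl⟩
  exact div_nonneg (supLogNorm_nonneg _ _ _ _) (Nat.cast_nonneg n)

set_option maxHeartbeats 1000000 in
/-- Approximate eigenvectors force the uniform Lyapunov exponent to vanish. -/
theorem exists_logNorm_le_mul {α β : ℝ} (hα : Irrational α) (hβ : β ∈ Ioo (0 : ℝ) 1)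
    (hgood : GoodBeta α β) {θ : ℝ} {H : L2Z →L[ℝ] L2Z} (hH : IsSchrodingerOp (circleV α β θ) H)
    {E : ℝ} (hE : ∀ C : ℝ, ∃ u : L2Z, C * ‖H u - E • u‖ < ‖u‖) {δ' : ℝ} (hδ' : 0 < δ') :
    ∃ n : ℕ, 0 < n ∧ ∀ φ, logNorm n (fwd (circleV α β φ)) E ≤ δ' * n := by
  classical
  obtain ⟨-, c, hc0, hc1, hq⟩ := hgood
  have hsubadd := subadditive_supLogNorm α β E
  have hlim := hsubadd.tendsto_lim (bddBelow_supLogNorm α β E)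
  set Λ := hsubadd.lim with hΛ
  rcases le_or_gt Λ 0 with hneg | hpos
  · have h1 := hlim.eventually_lt_const (lt_of_le_of_lt hneg hδ')
    obtain ⟨n, hn1, hn2⟩ := (h1.and (eventually_gt_atTop 0)).exists
    have hn : (0 : ℝ) < n := by exact_mod_cast hn2
    refine ⟨n, hn2, fun φ => (logNorm_le_sup _ _ _ _ _).trans ?_⟩
    rw [div_lt_iff₀ hn] at hn1
    exact hn1.le
  exfalso
  set δ : ℝ := Λ * c / 384 with hδ
  have hδ0 : 0 < δ := by positivity
  have hδ1 : δ ≤ Λ / 100 := by rw [hδ]; nlinarith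
  obtain ⟨C, hC0, hC⟩ : ∃ C : ℝ, 0 ≤ C ∧ ∀ n φ, logNorm n (fwd (circleV α β φ)) E
      ≤ (Λ + δ) * n + C := by
    have h1 := hlim.eventually_lt_const (show Λ < Λ + δ by linarith)
    obtain ⟨n₀, hn₀⟩ := eventually_atTop.1 h1
    have hlog : 0 ≤ Real.log (‖(E : ℂ)‖ + 2) :=
      Real.log_nonneg (by linarith [norm_nonneg (E : ℂ)])
    refine ⟨n₀ * Real.log (‖(E : ℂ)‖ + 2), by positivity, fun n φ => ?_⟩
    rcases lt_or_ge n n₀ with h | h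
    · have h2 := logNorm_le n (unitSeq_fwd (circleV_mem α β φ)) (E : ℂ)
      have h3 : (n : ℝ) ≤ n₀ := by exact_mod_cast h.le
      have h4 : (n : ℝ) * Real.log (‖(E : ℂ)‖ + 2) ≤ n₀ * Real.log (‖(E : ℂ)‖ + 2) := by gcongr
      have : 0 ≤ (Λ + δ) * n := by positivity
      linarith
    · have h2 : supLogNorm α β E n ≤ (Λ + δ) * n := by
        rcases Nat.eq_zero_or_pos n with rfl | hn
        · refine ciSup_le fun θ => ?_
          refine (logNorm_le 0 (unitSeq_fwd (circleV_mem α β θ)) (E : ℂ)).trans ?_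
          simp
        · have := hn₀ n h
          rw [div_lt_iff₀ (by exact_mod_cast hn)] at this
          exact this.le
      have := logNorm_le_sup α β E n φ
      have : 0 ≤ n₀ * Real.log (‖(E : ℂ)‖ + 2) := by positivity
      linarith
  have hlow : ∀ n : ℕ, Λ * n ≤ supLogNorm α β E n := by
    intro n
    rcases Nat.eq_zero_or_pos n with rfl | hn
    · simpa using supLogNorm_nonneg α β E 0
    · have := hsubadd.lim_le_div (bddBelow_supLogNorm α β E) hn.ne'
      rwa [le_div_iff₀ (by exact_mod_cast hn)] at this
  have hlog40 : 0 ≤ Real.log 40 := Real.log_nonneg (by norm_num)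
  obtain ⟨L, hL⟩ := exists_nat_gt (10 * (1 + (C + Real.log 40) / Λ))
  obtain ⟨p, q, hqL, hpq, hgap⟩ := hq (2 * L + 8)
  have hq0 : (0 : ℝ) < q := by exact_mod_cast hpq.pos
  set l : ℕ := q / 2 with hl
  have hlL : (L : ℝ) ≤ l := by
    have : L ≤ l := by omega
    exact_mod_cast this
  have hl0 : 0 < l := by omega
  have hlq : 2 * l ≤ q := by omega
  have hl3 : (q : ℝ) ≤ 3 * l := by
    have : q ≤ 3 * l := by omega
    exact_mod_cast this
  have hbig : 10 * (Λ + C + Real.log 40) ≤ Λ * l := by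
    have h1 : 10 * (1 + (C + Real.log 40) / Λ) ≤ l := hL.le.trans hlL
    have h2 : 10 * (Λ + C + Real.log 40) = Λ * (10 * (1 + (C + Real.log 40) / Λ)) := by
      field_simp
      ring
    rw [h2]; gcongr
  obtain ⟨n, hn⟩ := exists_logNorm_le (circleV_mem α β θ) hH hE (l / 2) (l - l / 2)
  have hdiv : l / 2 + (l - l / 2) = l := by omega
  have hhalf : ∀ k : ℕ, 2 * k ≤ l + 1 → ∀ φ, logNorm k (fwd (circleV α β φ)) E ≤
      (Λ + δ) * ((l + 1) / 2) + C := by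
    intro k hk φ
    refine (hC k φ).trans ?_
    have : (k : ℝ) ≤ (l + 1) / 2 := by
      rw [le_div_iff₀ (by norm_num)]
      have : k * 2 ≤ l + 1 := by omega
      exact_mod_cast this
    gcongr
  have hsmall := hn ((Λ + δ) * ((l + 1) / 2) + C)
    (by rw [fwd_shift_int]; exact hhalf _ (by omega) _)
    (by
      have := fwd_shift_int α β θ (n + (l / 2 : ℕ))
      rw [this]; exact hhalf _ (by omega) _)
  rw [hdiv, fwd_shift_int] at hsmall
  set θ' := θ + n * α with hθ'
  have hlr : (0 : ℝ) < l := by exact_mod_cast hl0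
  have hs : logNorm l (fwd (circleV α β θ')) E ≤ 3 / 4 * Λ * l := by
    have : δ * l ≤ Λ / 100 * l := by gcongr
    nlinarith
  obtain ⟨b, hb⟩ := exists_arc hβ hpq hc1 hgap hlq θ'
  set κ : ℝ := c / (2 * q) with hκ
  have hκ0 : 0 < κ := by positivity
  set D : ℝ := (Λ + δ) * l - 3 / 4 * Λ * l - C with hD
  have hD1 : Λ * l / 8 ≤ D := by rw [hD]; nlinarith
  have hD0 : 0 ≤ D := le_trans (by positivity) hD1
  have hcount : ∀ (M : ℕ) (φ : ℝ), logNorm M (fwd (circleV α β φ)) E ≤ (Λ + δ) * M + C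
      - D * Nat.count (fun k : ℕ => ∃ m : ℤ, φ + k * α + m ∈ Ioo b (b + κ)) (M + 1 - l) := by
    intro M φ
    have := subadditive_le_sub_count
      (f := fun i n => logNorm n (fwd (circleV α β (φ + i * α))) E)
      (p := fun k : ℕ => ∃ m : ℤ, φ + k * α + m ∈ Ioo b (b + κ))
      (a := Λ + δ) (C := C) (s := 3 / 4 * Λ * l) (l := l) ?_ hl0 ?_ ?_ ?_ hD0 M 0
    · simpa using this
    · intro i n m
      refine (logNorm_add_circle α β _ E n m).trans (le_of_eq ?_)
      push_cast
      rw [add_mul, add_assoc]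
    · intro i n
      exact hC n _
    · rintro i ⟨m, hm⟩
      refine le_trans (le_of_eq ?_) hs
      refine logNorm_congr _ fun k hk => ?_
      rw [← hb _ hm k hk]
      simp only [fwd]
      rw [circleV_add_int]
    · rintro i j ⟨m, hm⟩ ⟨m', hm'⟩ hij
      by_contra! hlt
      have hne : ((j : ℤ) - i) ≠ 0 := by omega
      have h2 : 2 * |(j : ℤ) - i| ≤ q := by
        rw [abs_of_pos (by omega)]; omega
      have h3 := hpq.dist_int hne h2 (m - m')
      push_cast at h3
      have h4 : |((j : ℝ) - i) * α - (m - m')| < κ := by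
        rw [abs_lt]
        constructor <;> nlinarith [hm.1, hm.2, hm'.1, hm'.2]
      have h5 : κ ≤ 1 / (2 * q) := by
        rw [hκ]; gcongr; linarith
      linarith
  obtain ⟨Q₀, hQ₀⟩ := exists_nat_gt ((3 * D + δ * l + C) / δ)
  obtain ⟨P, Q, hQ, hPQ⟩ := exists_dirichletApprox hα Q₀
  have hQ1 : (Q₀ : ℝ) ≤ Q := by exact_mod_cast hQ
  have hκ1 : κ ≤ 1 := by
    rw [hκ, div_le_one (by positivity)]
    have : (1 : ℝ) ≤ q := by exact_mod_cast hpq.pos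
    linarith
  have hDκ : 8 * δ ≤ D * κ := by
    calc 8 * δ = Λ * l / 8 * (c / (2 * (3 * l))) := by rw [hδ]; field_simp; norm_num
      _ ≤ D * κ := by rw [hκ]; gcongr
  have hfin : supLogNorm α β E (Q - 1 + l) ≤ (Λ + δ) * (Q - 1 + l : ℕ) + C - D * (κ * Q - 3) := by
    refine ciSup_le fun φ => (hcount (Q - 1 + l) φ).trans ?_
    have hPos := hPQ.pos
    rw [show Q - 1 + l + 1 - l = Q by omega]
    have h1 := hPQ.card_visits φ b hκ1
    rw [← Nat.count_eq_card_filter_range] at h1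
    have := mul_le_mul_of_nonneg_left h1 hD0
    linarith
  have h2 := (hlow (Q - 1 + l)).trans hfin
  have h3 : ((Q - 1 + l : ℕ) : ℝ) ≤ Q + l := by
    have : Q - 1 + l ≤ Q + l := by omega
    exact_mod_cast this
  have h4 : (3 * D + δ * l + C) < δ * Q := by
    have := hQ₀.trans_le hQ1
    rw [div_lt_iff₀ hδ0] at this
    linarith
  have h5 : δ * ((Q - 1 + l : ℕ) : ℝ) ≤ δ * (Q + l) := by gcongr
  have h6 : 8 * δ * Q ≤ D * κ * Q := by gcongr
  have h7 : 0 < δ * Q := by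
    have := hPQ.pos
    positivity
  nlinarith

/-! ### Self-adjoint operators and isolated spectral points -/

section SelfAdjoint

variable {F : Type*} [NormedAddCommGroup F] [InnerProductSpace ℝ F]

theorem isUnit_of_inner_ge [CompleteSpace F] {A : F →L[ℝ] F} {c : ℝ} (hc : 0 < c)
    (h : ∀ x, c * ‖x‖ ^ 2 ≤ inner ℝ (A x) x) : IsUnit A := by
  refine ContinuousLinearMap.isUnit_of_forall_le_norm_inner_map A (c := ⟨c, hc.le⟩) hc fun x => ?_
  change ‖x‖ ^ 2 * c ≤ _
  exact (le_of_eq (mul_comm _ _)).trans ((h x).trans (le_abs_self _))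

theorem inner_sq_apply {T : F →L[ℝ] F} (hT : (T : F →ₗ[ℝ] F).IsSymmetric) (x : F) :
    inner ℝ ((T * T) x) x = ‖T x‖ ^ 2 := by
  rw [mul_apply_eq_comp, ← real_inner_self_eq_norm_sq]
  exact hT (T x) x

theorem isUnit_of_bounded_below [CompleteSpace F] {T : F →L[ℝ] F} (hT : (T : F →ₗ[ℝ] F).IsSymmetric) {C : ℝ}
    (h : ∀ x, ‖x‖ ≤ C * ‖T x‖) : IsUnit T := by
  have hTT : IsUnit (T * T) := by
    refine isUnit_of_inner_ge (c := ((|C| + 1) ^ 2)⁻¹) (by positivity) fun x => ?_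
    rw [inner_sq_apply hT, inv_mul_le_iff₀ (by positivity), ← mul_pow]
    refine pow_le_pow_left₀ (norm_nonneg _) ((h x).trans ?_) 2
    have : C ≤ |C| + 1 := by linarith [le_abs_self C]
    gcongr
  exact ((Commute.refl T).isUnit_mul_iff.1 hTT).1

theorem exists_bound_of_isUnit {T : F →L[ℝ] F} (h : IsUnit T) :
    ∃ C, 0 < C ∧ ∀ x, ‖x‖ ≤ C * ‖T x‖ := by
  obtain ⟨u, rfl⟩ := h
  refine ⟨‖((u⁻¹ : (F →L[ℝ] F)ˣ) : F →L[ℝ] F)‖ + 1, by positivity, fun x => ?_⟩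
  have h1 : ((u⁻¹ : (F →L[ℝ] F)ˣ) : F →L[ℝ] F) ((u : F →L[ℝ] F) x) = x := by
    rw [← mul_apply_eq_comp, Units.inv_mul]; rfl
  have h2 := ((u⁻¹ : (F →L[ℝ] F)ˣ) : F →L[ℝ] F).le_opNorm ((u : F →L[ℝ] F) x)
  rw [h1] at h2
  refine h2.trans ?_
  gcongr
  linarith

theorem norm_sq_le_inner {A : F →L[ℝ] F} (hA : (A : F →ₗ[ℝ] F).IsSymmetric)
    (hpos : ∀ x, 0 ≤ inner ℝ (A x) x) (x : F) :
    ‖A x‖ ^ 2 ≤ (‖A‖ + 1) * inner ℝ (A x) x := by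
  set s : ℝ := (‖A‖ + 1)⁻¹ with hs
  have hs0 : 0 < s := by positivity
  have h1 := hpos (x - s • A x)
  have h2 : inner ℝ (A (A x)) x = ‖A x‖ ^ 2 := by
    rw [← real_inner_self_eq_norm_sq]; exact hA (A x) x
  have h3 : inner ℝ (A (A x)) (A x) ≤ ‖A‖ * ‖A x‖ ^ 2 := by
    refine (real_inner_le_norm _ _).trans ?_
    have := A.le_opNorm (A x)
    nlinarith [norm_nonneg (A x)]
  rw [map_sub, map_smul, inner_sub_left, inner_sub_right, inner_sub_right, inner_smul_left,
    inner_smul_right, inner_smul_left, inner_smul_right, h2, real_inner_self_eq_norm_sq] at h1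
  simp only [RCLike.conj_to_real] at h1
  have h4 : s * (‖A‖ + 1) = 1 := by rw [hs]; exact inv_mul_cancel₀ (by positivity)
  have h5 : s * (s * inner ℝ (A (A x)) (A x)) ≤ s * ‖A x‖ ^ 2 := by
    have : s * ‖A‖ ≤ 1 := by nlinarith
    have : s * inner ℝ (A (A x)) (A x) ≤ 1 * ‖A x‖ ^ 2 := by
      calc s * inner ℝ (A (A x)) (A x) ≤ s * (‖A‖ * ‖A x‖ ^ 2) := by gcongr
        _ = (s * ‖A‖) * ‖A x‖ ^ 2 := by ring
        _ ≤ _ := by gcongr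
    rw [one_mul] at this
    gcongr
  have h6 : s * ‖A x‖ ^ 2 ≤ inner ℝ (A x) x := by linarith
  rw [hs, inv_mul_le_iff₀ (by positivity)] at h6
  exact h6

theorem inner_nonneg_of_isUnit [CompleteSpace F] {B : F →L[ℝ] F} (hB : (B : F →ₗ[ℝ] F).IsSymmetric)
    (h : ∀ d : ℝ, 0 < d → IsUnit (B + d • (1 : F →L[ℝ] F))) (x : F) :
    0 ≤ inner ℝ (B x) x := by
  by_contra! hx
  set S : Set ℝ := {t | ∀ y, 0 ≤ inner ℝ (B y) y + t * ‖y‖ ^ 2} with hS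
  have hne : ‖B‖ ∈ S := by
    intro y
    have h1 := (abs_le.1 (abs_real_inner_le_norm (B y) y)).1
    have h2 := B.le_opNorm y
    nlinarith [norm_nonneg y]
  have hx0 : 0 < ‖x‖ ^ 2 := by
    have : x ≠ 0 := by rintro rfl; simp at hx
    positivity
  have hlow : ∀ t ∈ S, -inner ℝ (B x) x / ‖x‖ ^ 2 ≤ t := by
    intro t ht
    rw [div_le_iff₀ hx0]
    linarith [ht x]
  have hbdd : BddBelow S := ⟨_, hlow⟩
  have hclosed : IsClosed S := by
    rw [hS, ofPred_forall]
    exact isClosed_iInter fun y => isClosed_le continuous_const (by fun_prop)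
  have hmem : sInf S ∈ S := hclosed.csInf_mem ⟨_, hne⟩ hbdd
  set t := sInf S with ht
  have ht0 : 0 < t := lt_of_lt_of_le (div_pos (by linarith) hx0) (hlow t hmem)
  set A := B + t • (1 : F →L[ℝ] F) with hAdef
  have hAx : ∀ y, inner ℝ (A y) y = inner ℝ (B y) y + t * ‖y‖ ^ 2 := by
    intro y
    simp [hAdef, inner_add_left, inner_smul_left]
  have hAsym : (A : F →ₗ[ℝ] F).IsSymmetric := by
    intro y w
    have := hB y w
    simp only [ContinuousLinearMap.coe_coe] at this
    simp [hAdef, inner_add_left, inner_smul_left, inner_add_right, inner_smul_right, this]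
  obtain ⟨C, hC0, hC⟩ := exists_bound_of_isUnit (h t ht0)
  set ε : ℝ := (C ^ 2 * (‖A‖ + 1))⁻¹ with hε
  have hε0 : 0 < ε := by positivity
  have : t - ε ∈ S := by
    intro y
    have h1 := norm_sq_le_inner hAsym (fun y => by rw [hAx]; exact hmem y) y
    have h2 : ‖y‖ ^ 2 ≤ C ^ 2 * ‖A y‖ ^ 2 := by
      rw [← mul_pow]; exact pow_le_pow_left₀ (norm_nonneg _) (hC y) 2
    have h3 : ε * ‖y‖ ^ 2 ≤ inner ℝ (A y) y := by
      rw [hε, inv_mul_le_iff₀ (by positivity), mul_assoc]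
      refine h2.trans ?_
      gcongr
    rw [hAx] at h3
    linarith
  linarith [csInf_le hbdd this]

theorem norm_ge_of_gap [CompleteSpace F] {T : F →L[ℝ] F} (hT : (T : F →ₗ[ℝ] F).IsSymmetric) {r : ℝ} (hr : 0 < r)
    (h : ∀ t : ℝ, t ≠ 0 → |t| < r → IsUnit (T - t • (1 : F →L[ℝ] F))) (x : F) :
    r * ‖T x‖ ≤ ‖T (T x)‖ := by
  have hTT : ((T * T : F →L[ℝ] F) : F →ₗ[ℝ] F).IsSymmetric := fun y w =>
    (hT (T y) w).trans (hT y (T w))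
  set A := T * T with hA
  have hApp : ∀ y, A y = T (T y) := fun y => rfl
  set B := A * A - (r ^ 2) • A with hB
  have hBsym : (B : F →ₗ[ℝ] F).IsSymmetric := by
    intro y w
    have h1 := hTT (A y) w
    have h2 := hTT y (A w)
    have h3 := hTT y w
    simp only [ContinuousLinearMap.coe_coe] at h1 h2 h3
    simp [hB, inner_sub_left, inner_smul_left, inner_sub_right, inner_smul_right, h1, h2, h3]
  have key := inner_nonneg_of_isUnit hBsym (fun d hd => ?_) x
  · have h1 : inner ℝ (B x) x = ‖T (T x)‖ ^ 2 - r ^ 2 * ‖T x‖ ^ 2 := by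
      rw [hB, sub_apply, inner_sub_left, inner_sq_apply hTT,
        smul_apply, inner_smul_left, hA, inner_sq_apply hT]
      simp
    rw [h1, ← mul_pow] at key
    exact le_of_sq_le_sq (by linarith) (norm_nonneg _)
  · rcases le_or_gt d (r ^ 4 / 4) with hle | hgt
    · set w := Real.sqrt (r ^ 4 - 4 * d) with hw
      have hw2 : w ^ 2 = r ^ 4 - 4 * d := Real.sq_sqrt (by linarith)
      have hw0 : 0 ≤ w := Real.sqrt_nonneg _
      have hwr : w < r ^ 2 := by
        rw [hw, Real.sqrt_lt' (by positivity)]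
        nlinarith
      have hr2 : 0 < r ^ 2 := by positivity
      have hfac : ∀ s : ℝ, 0 < s → s < r ^ 2 → IsUnit (A - s • (1 : F →L[ℝ] F)) := by
        intro s hs0 hs1
        have hss : Real.sqrt s ^ 2 = s := Real.sq_sqrt hs0.le
        have hpos : 0 < Real.sqrt s := Real.sqrt_pos.2 hs0
        have hlt : Real.sqrt s < r := by
          rw [Real.sqrt_lt' hr]; exact hs1
        have e : A - s • (1 : F →L[ℝ] F) = (T - (Real.sqrt s) • (1 : F →L[ℝ] F)) *
            (T - (-Real.sqrt s) • (1 : F →L[ℝ] F)) := by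
          ext y
          simp only [hA, sub_apply, mul_apply_eq_comp,
            smul_apply, one_apply_eq_self, map_sub, map_smul]
          nth_rewrite 1 [← hss]
          module
        rw [e]
        refine (h _ hpos.ne' (by rwa [abs_of_pos hpos])).mul
          (h _ (neg_ne_zero.2 hpos.ne') (by rwa [abs_neg, abs_of_pos hpos]))
      have e : B + d • (1 : F →L[ℝ] F) = (A - ((r ^ 2 + w) / 2) • (1 : F →L[ℝ] F)) *
            (A - ((r ^ 2 - w) / 2) • (1 : F →L[ℝ] F)) := by
        have hd' : d = (r ^ 2 + w) / 2 * ((r ^ 2 - w) / 2) := by nlinarith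
        ext y
        simp only [hB, sub_apply, mul_apply_eq_comp,
          add_apply,
          smul_apply, one_apply_eq_self, map_sub, map_smul]
        nth_rewrite 1 [hd']
        module
      rw [e]
      exact (hfac _ (by linarith) (by linarith)).mul (hfac _ (by linarith) (by linarith))
    · refine isUnit_of_inner_ge (c := d - r ^ 4 / 4) (by linarith) fun y => ?_
      have h1 : inner ℝ ((B + d • (1 : F →L[ℝ] F)) y) y =
          ‖A y‖ ^ 2 - r ^ 2 * inner ℝ (A y) y + d * ‖y‖ ^ 2 := by
        rw [add_apply, inner_add_left, hB, sub_apply,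
          inner_sub_left, inner_sq_apply hTT]
        simp [inner_smul_left]
      have h2 : 0 ≤ ‖A y - (r ^ 2 / 2) • y‖ ^ 2 := sq_nonneg _
      rw [norm_sub_sq_real, inner_smul_right, norm_smul, mul_pow, Real.norm_eq_abs, sq_abs] at h2
      rw [h1]
      nlinarith

theorem exists_ker_approx [CompleteSpace F] {T : F →L[ℝ] F} (hT : (T : F →ₗ[ℝ] F).IsSymmetric) {r : ℝ} (hr : 0 < r)
    (h : ∀ t : ℝ, t ≠ 0 → |t| < r → IsUnit (T - t • (1 : F →L[ℝ] F))) (u : F) :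
    ∃ k, T k = 0 ∧ r * ‖u - k‖ ≤ ‖T u‖ := by
  have : CompleteSpace (T : F →ₗ[ℝ] F).ker := T.isClosed_ker.completeSpace_coe
  obtain ⟨k, hk, y, hy, rfl⟩ := Submodule.exists_add_mem_mem_orthogonal
    (K := (T : F →ₗ[ℝ] F).ker) u
  refine ⟨k, hk, ?_⟩
  have hsa : ContinuousLinearMap.adjoint T = T :=
    (ContinuousLinearMap.isSelfAdjoint_iff_isSymmetric.2 hT)
  have hker : (T : F →ₗ[ℝ] F).ker = (T : F →ₗ[ℝ] F).rangeᗮ := by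
    have := ContinuousLinearMap.orthogonal_range T
    rw [hsa] at this
    exact this.symm
  have hy2 : y ∈ closure (range T) := by
    rw [hker, Submodule.orthogonal_orthogonal_eq_closure] at hy
    exact hy
  have hclosed : IsClosed {y : F | r * ‖y‖ ≤ ‖T y‖} :=
    isClosed_le (by fun_prop) (by fun_prop)
  have hmem : y ∈ {y : F | r * ‖y‖ ≤ ‖T y‖} := by
    refine closure_minimal ?_ hclosed hy2
    rintro _ ⟨x, rfl⟩
    exact norm_ge_of_gap hT hr h x
  have hTk : T k = 0 := hk
  rw [map_add, hTk, zero_add, add_sub_cancel_left]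
  exact hmem

end SelfAdjoint

/-! ### The Schrödinger operator: symmetry and absence of isolated spectral points -/

theorem isSymmetric_of_isSchrodingerOp {V : ℤ → ℝ} {H : L2Z →L[ℝ] L2Z} (hH : IsSchrodingerOp V H) :
    (H : L2Z →ₗ[ℝ] L2Z).IsSymmetric := by
  intro u w
  have hsum : ∀ (u w : L2Z) (k : ℤ), Summable fun n => u n * w (n + k) := by
    intro u w k
    refine Summable.of_norm_bounded ((summable_sq u).add (summable_sq_shift w k)) fun n => ?_
    rw [Real.norm_eq_abs, abs_mul]
    nlinarith [sq_nonneg (|u n| - |w (n + k)|), sq_abs (u n), sq_abs (w (n + k)),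
      abs_nonneg (u n), abs_nonneg (w (n + k))]
  set g : ℤ → ℝ := fun n => w n * u (n + 1) - u n * w (n + 1) with hg
  have hgs : Summable g := (hsum w u 1).sub (hsum u w 1)
  have h1 := lp.hasSum_inner (𝕜 := ℝ) (H u) w
  have h2 := lp.hasSum_inner (𝕜 := ℝ) u (H w)
  have h3 := hgs.hasSum
  have h4 : HasSum (fun n => g (n - 1)) (∑' n, g n) :=
    (Equiv.subRight (1 : ℤ)).hasSum_iff.2 h3
  have h5 := (h1.sub h2).sub (h3.sub h4)
  have h6 : (fun n : ℤ => inner ℝ ((H u) n) (w n) - inner ℝ (u n) ((H w) n) - (g n - g (n - 1)))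
      = fun _ => 0 := by
    ext n
    simp only [RCLike.inner_apply, conj_trivial, hH u n, hH w n, hg, sub_add_cancel]
    ring
  rw [h6] at h5
  have := h5.unique hasSum_zero
  change inner ℝ (H u) w = inner ℝ u (H w)
  linarith

theorem isSymmetric_sub_smul {V : ℤ → ℝ} {H : L2Z →L[ℝ] L2Z} (hH : IsSchrodingerOp V H) (E : ℝ) :
    ((H - E • (1 : L2Z →L[ℝ] L2Z) : L2Z →L[ℝ] L2Z) : L2Z →ₗ[ℝ] L2Z).IsSymmetric := by
  intro y w
  have := isSymmetric_of_isSchrodingerOp hH y w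
  simp only [ContinuousLinearMap.coe_coe] at this
  simp [inner_sub_left, inner_smul_left, inner_sub_right, inner_smul_right, this]

theorem mem_spectrum_iff_not_isUnit {H : L2Z →L[ℝ] L2Z} {E : ℝ} :
    E ∈ spectrum ℝ H ↔ ¬ IsUnit (H - E • (1 : L2Z →L[ℝ] L2Z)) := by
  rw [spectrum.mem_iff, Algebra.algebraMap_eq_smul_one, ← IsUnit.neg_iff, neg_sub]

theorem exists_norm_gt_of_mem_spectrum {V : ℤ → ℝ} {H : L2Z →L[ℝ] L2Z} (hH : IsSchrodingerOp V H)
    {E : ℝ} (hE : E ∈ spectrum ℝ H) (C : ℝ) : ∃ u : L2Z, C * ‖H u - E • u‖ < ‖u‖ := by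
  by_contra! hcon
  exact mem_spectrum_iff_not_isUnit.1 hE
    (isUnit_of_bounded_below (isSymmetric_sub_smul hH E) hcon)

theorem circleV_right_const (α : ℝ) {β : ℝ} (hβ : β ∈ Ioo (0 : ℝ) 1) (θ : ℝ) (n : ℤ) :
    ∃ ε > 0, ∀ φ, θ ≤ φ → φ < θ + ε → circleV α β φ n = circleV α β θ n := by
  have key : ∀ x : ℝ, ∃ ε > 0, ∀ y, x ≤ y → y < x + ε → ⌊y⌋ = ⌊x⌋ := by
    intro x
    refine ⟨⌊x⌋ + 1 - x, by linarith [Int.lt_floor_add_one x], fun y h1 h2 => ?_⟩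
    rw [Int.floor_eq_iff]
    exact ⟨(Int.floor_le x).trans h1, by linarith⟩
  obtain ⟨ε₁, h1, h1'⟩ := key (n * α + θ + β)
  obtain ⟨ε₂, h2, h2'⟩ := key (n * α + θ)
  refine ⟨min ε₁ ε₂, lt_min h1 h2, fun φ hφ hφ' => ?_⟩
  have h3 := min_le_left ε₁ ε₂
  have h4 := min_le_right ε₁ ε₂
  rw [circleV_eq_floor α hβ, circleV_eq_floor α hβ,
    h1' (n * α + φ + β) (by linarith) (by linarith),
    h2' (n * α + φ) (by linarith) (by linarith)]

/-- Arbitrarily long return times which approach the starting phase from the right. -/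
theorem exists_right_return {α : ℝ} (hα : Irrational α) (N : ℕ) :
    ∃ m k : ℤ, (N : ℤ) ≤ |m| ∧ 0 ≤ (m : ℝ) * α + k ∧ (m : ℝ) * α + k < 1 / (N + 1) := by
  obtain ⟨p, q, hq, hpq⟩ := exists_dirichletApprox hα (N + 1)
  have hq0 : (0 : ℝ) < q := by exact_mod_cast hpq.pos
  have hqN : ((N : ℝ) + 1) ≤ q := by exact_mod_cast hq
  have h1 : |q * α - p| < 1 / (N + 1) := by
    have h2 : (q : ℝ) * α - p = q * (α - p / q) := by field_simp
    rw [h2, abs_mul, abs_of_pos hq0]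
    calc (q : ℝ) * |α - p / q| < q * (1 / q ^ 2) := by gcongr; exact hpq.lt
      _ = 1 / q := by field_simp
      _ ≤ 1 / (N + 1) := by gcongr
  have h3 := abs_lt.1 h1
  rcases le_or_gt 0 ((q : ℝ) * α - p) with h | h
  · exact ⟨q, -p, by rw [abs_of_nonneg] <;> omega, by push_cast; linarith, by push_cast; linarith⟩
  · exact ⟨-q, p, by rw [abs_neg, abs_of_nonneg] <;> omega, by push_cast; linarith,
      by push_cast; linarith⟩

/-- Translation on `ℓ²(ℤ)`. -/
def translate (m : ℤ) (u : L2Z) : L2Z :=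
  ⟨fun n => u (n + m), by
    refine memℓp_gen ?_
    simpa using summable_sq_shift u m⟩

theorem translate_apply (m : ℤ) (u : L2Z) (n : ℤ) : translate m u n = u (n + m) := rfl

theorem norm_translate (m : ℤ) (u : L2Z) : ‖translate m u‖ = ‖u‖ := by
  have h := norm_sq_eq_tsum (translate m u)
  simp only [translate_apply] at h
  rw [tsum_sq_shift] at h
  exact (pow_left_inj₀ (norm_nonneg _) (norm_nonneg _) two_ne_zero).1 h

theorem tendsto_translate_apply {m : ℕ → ℤ} (hm : ∀ k : ℕ, (k : ℤ) ≤ |m k|) (u : L2Z) (n : ℤ) :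
    Tendsto (fun k => translate (m k) u n) atTop (𝓝 0) := by
  have h1 := (summable_sq u).tendsto_cofinite_zero
  have h2 : Tendsto (fun k => n + m k) atTop cofinite := by
    rw [← cocompact_eq_cofinite ℤ, ← Metric.cobounded_eq_cocompact, ← tendsto_norm_atTop_iff_cobounded]
    refine tendsto_atTop_mono (f := fun k : ℕ => (k : ℝ) - |(n : ℝ)|) (fun k => ?_) ?_
    · have : ((k : ℤ) : ℝ) ≤ |(m k : ℝ)| := by exact_mod_cast hm k
      rw [Int.norm_eq_abs]
      push_cast at this ⊢
      have h3 := abs_sub_abs_le_abs_sub (m k : ℝ) (-n)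
      rw [sub_neg_eq_add, add_comm (m k : ℝ), abs_neg] at h3
      linarith
    · exact tendsto_atTop_add_const_right _ _ tendsto_natCast_atTop_atTop
  have h3 := (h1.comp h2).sqrt
  simp only [Function.comp_def, Real.sqrt_sq_eq_abs, Real.sqrt_zero] at h3
  exact tendsto_zero_iff_abs_tendsto_zero _ |>.2 h3

theorem norm_sub_translate {V : ℤ → ℝ} {H : L2Z →L[ℝ] L2Z} (hH : IsSchrodingerOp V H) {E : ℝ}
    {e : L2Z} (he : H e = E • e) (m : ℤ) :
    ‖H (translate m e) - E • translate m e‖ ^ 2 = ∑' n, ((V (n - m) - V n) * e n) ^ 2 := by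
  have h2 := fun n => congrArg (fun u : L2Z => u n) he
  simp only [hH e, lp.coeFn_smul, Pi.smul_apply, smul_eq_mul] at h2
  have h3 : ∀ n, (H (translate m e) - E • translate m e) n = (V n - V (n + m)) * e (n + m) := by
    intro n
    have := h2 (n + m)
    simp only [lp.coeFn_sub, Pi.sub_apply, lp.coeFn_smul, Pi.smul_apply, smul_eq_mul,
      hH (translate m e) n, translate_apply]
    rw [show n + 1 + m = n + m + 1 by ring, show n - 1 + m = n + m - 1 by ring]
    linarith
  rw [norm_sq_eq_tsum]
  simp only [h3]
  rw [← (Equiv.addRight m).tsum_eq fun n => ((V (n - m) - V n) * e n) ^ 2]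
  simp

theorem exists_ne_mem_spectrum {α β θ : ℝ} (hα : Irrational α) (hβ : β ∈ Ioo (0 : ℝ) 1)
    {H : L2Z →L[ℝ] L2Z} (hH : IsSchrodingerOp (circleV α β θ) H) {E : ℝ} (hE : E ∈ spectrum ℝ H)
    {r : ℝ} (hr : 0 < r) : ∃ t ∈ spectrum ℝ H, t ≠ E ∧ |t - E| < r := by
  by_contra! hcon
  set T := H - E • (1 : L2Z →L[ℝ] L2Z) with hT
  have hTapp : ∀ u, T u = H u - E • u := fun u => rfl
  have hsym := isSymmetric_sub_smul hH E
  rw [← hT] at hsym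
  have hgap : ∀ t : ℝ, t ≠ 0 → |t| < r → IsUnit (T - t • (1 : L2Z →L[ℝ] L2Z)) := by
    intro t ht htr
    by_contra hu
    have e : T - t • (1 : L2Z →L[ℝ] L2Z) = H - (E + t) • (1 : L2Z →L[ℝ] L2Z) := by
      rw [hT]; module
    rw [e, ← mem_spectrum_iff_not_isUnit] at hu
    have := hcon _ hu (by simpa using ht)
    rw [add_sub_cancel_left] at this
    linarith
  have happrox := exists_ker_approx hsym hr hgap
  obtain ⟨e, heT, he0⟩ : ∃ e, T e = 0 ∧ e ≠ 0 := by
    by_contra! h0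
    refine mem_spectrum_iff_not_isUnit.1 hE (isUnit_of_bounded_below hsym (C := r⁻¹) fun u => ?_)
    obtain ⟨k, hk, hle⟩ := happrox u
    rw [h0 k hk, sub_zero] at hle
    rwa [inv_mul_eq_div, le_div_iff₀' hr]
  have heE : H e = E • e := by rwa [hTapp, sub_eq_zero] at heT
  choose m k hm hk0 hk1 using fun N => exists_right_return hα N
  have hconv : Tendsto (fun N => ‖T (translate (-m N) e)‖ ^ 2) atTop (𝓝 0) := by
    simp only [hTapp, norm_sub_translate hH heE, sub_neg_eq_add]
    have : (0 : ℝ) = ∑' _ : ℤ, (0 : ℝ) := by simp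
    rw [this]
    refine tendsto_tsum_of_dominated_convergence (summable_sq e) (fun n => ?_)
      (Eventually.of_forall fun N n => ?_)
    · obtain ⟨ε, hε, hc⟩ := circleV_right_const α hβ θ n
      refine tendsto_const_nhds.congr' ?_
      have h1 := (tendsto_one_div_add_atTop_nhds_zero_nat (𝕜 := ℝ)).eventually_lt_const hε
      filter_upwards [h1] with N hN
      rw [circleV_shift, ← circleV_add_int α β (θ + m N * α) n (k N),
        hc _ (by linarith [hk0 N]) (by linarith [hk1 N])]
      simp
    · rw [Real.norm_eq_abs, abs_of_nonneg (sq_nonneg _), mul_pow]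
      have h1 := circleV_mem α β θ (n + m N)
      have h2 := circleV_mem α β θ n
      have : (circleV α β θ (n + m N) - circleV α β θ n) ^ 2 ≤ 1 := by
        rw [sq_le_one_iff_abs_le_one, abs_le]
        constructor <;> linarith [h1.1, h1.2, h2.1, h2.2]
      nlinarith [sq_nonneg (e n)]
  have hconv' : Tendsto (fun N => ‖T (translate (-m N) e)‖) atTop (𝓝 0) := by
    have := hconv.sqrt
    simpa [Real.sqrt_sq (norm_nonneg _)] using this
  choose κ hκ hκr using fun N => happrox (translate (-m N) e)
  have hy : Tendsto (fun N => translate (-m N) e - κ N) atTop (𝓝 0) := by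
    rw [tendsto_zero_iff_norm_tendsto_zero]
    refine squeeze_zero (fun N => norm_nonneg _) (g := fun N => r⁻¹ * ‖T (translate (-m N) e)‖)
      (fun N => ?_) (by simpa using hconv'.const_mul r⁻¹)
    rw [inv_mul_eq_div, le_div_iff₀' hr]
    exact hκr N
  have hcoord : ∀ n, Tendsto (fun N => κ N n) atTop (𝓝 0) := by
    intro n
    have h1 := tendsto_translate_apply (m := fun N => -m N) (fun N => by rw [abs_neg]; exact hm N)
      e n
    have h2 : Tendsto (fun N => (translate (-m N) e - κ N : L2Z) n) atTop (𝓝 0) := by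
      rw [tendsto_zero_iff_norm_tendsto_zero] at hy ⊢
      exact squeeze_zero (fun N => norm_nonneg _)
        (fun N => lp.norm_apply_le_norm two_ne_zero _ n) hy
    simpa using h1.sub h2
  set K := (T : L2Z →ₗ[ℝ] L2Z).ker with hK
  let ev : K →ₗ[ℝ] ℝ × ℝ :=
    { toFun := fun u => ((u : L2Z) 0, (u : L2Z) 1)
      map_add' := fun u w => rfl
      map_smul' := fun c u => rfl }
  have hinj : Function.Injective ev := by
    rw [injective_iff_map_eq_zero]
    rintro ⟨u, hu⟩ huev
    have hu0 : u 0 = 0 := congrArg Prod.fst huev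
    have hu1 : u 1 = 0 := congrArg Prod.snd huev
    have hu' : H u = E • u := by
      have : T u = 0 := hu
      rwa [hTapp, sub_eq_zero] at this
    have hrec := fun n => congrArg (fun u : L2Z => u n) hu'
    simp only [hH u, lp.coeFn_smul, Pi.smul_apply, smul_eq_mul] at hrec
    have hall : ∀ n : ℕ, u n = 0 ∧ u (n + 1) = 0 ∧ u (-n) = 0 ∧ u (-n + 1) = 0 := by
      intro n
      induction n with
      | zero => simp [hu0, hu1]
      | succ n ih =>
        obtain ⟨a, b, c, d⟩ := ih
        have r1 := hrec (n + 1)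
        have r2 := hrec (-n)
        rw [add_sub_cancel_right, a, b] at r1
        rw [c, d] at r2
        push_cast
        refine ⟨b, by linarith, ?_, ?_⟩
        · rw [show -((n : ℤ) + 1) = -n - 1 by ring]; linarith
        · rw [show -((n : ℤ) + 1) + 1 = -n by ring]; exact c
    apply Subtype.ext
    ext n
    rcases Int.eq_nat_or_neg n with ⟨j, rfl | rfl⟩
    · exact (hall j).1
    · exact (hall j).2.2.1
  have : FiniteDimensional ℝ K := FiniteDimensional.of_injective ev hinj
  obtain ⟨L, hL0, hL⟩ := ev.exists_antilipschitzWith (LinearMap.ker_eq_bot.2 hinj)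
  have hevlim : Tendsto (fun N => ev ⟨κ N, hκ N⟩) atTop (𝓝 0) :=
    (hcoord 0).prodMk_nhds (hcoord 1)
  have hκlim : Tendsto (fun N => ‖κ N‖) atTop (𝓝 0) := by
    refine squeeze_zero (fun N => norm_nonneg _) (g := fun N => L * ‖ev ⟨κ N, hκ N⟩‖)
      (fun N => ?_) (by simpa using (tendsto_zero_iff_norm_tendsto_zero.1 hevlim).const_mul (L : ℝ))
    have := hL.le_mul_dist ⟨κ N, hκ N⟩ 0
    rw [map_zero, dist_zero_right, dist_zero_right] at this
    exact this
  have hfinal : Tendsto (fun N => ‖translate (-m N) e‖) atTop (𝓝 0) := by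
    refine squeeze_zero (fun N => norm_nonneg _) (fun N => ?_)
      (by simpa using (tendsto_zero_iff_norm_tendsto_zero.1 hy).add hκlim)
    have := norm_add_le (translate (-m N) e - κ N) (κ N)
    rwa [sub_add_cancel] at this
  simp only [norm_translate] at hfinal
  exact he0 (norm_eq_zero.1 (tendsto_nhds_unique tendsto_const_nhds hfinal))

/-! ### Phase averages and the Lyapunov exponent off the real axis -/

/-- Lebesgue measure on a fundamental domain of the circle of phases. -/
noncomputable def phase : Measure ℝ := volume.restrict (Ioc 0 1)

instance : IsProbabilityMeasure phase := ⟨by simp [phase]⟩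

theorem integral_phase_shift {f : ℝ → ℝ} (hf : Function.Periodic f 1) (α : ℝ) :
    ∫ θ, f (θ + α) ∂phase = ∫ θ, f θ ∂phase := by
  unfold phase
  rw [← intervalIntegral.integral_of_le zero_le_one, ← intervalIntegral.integral_of_le zero_le_one,
    intervalIntegral.integral_comp_add_right, zero_add, add_comm 1 α]
  simpa using hf.intervalIntegral_add_eq α 0

theorem integrable_phase {f : ℝ → ℝ} (hm : Measurable f) {C : ℝ} (hC : ∀ θ, |f θ| ≤ C) :
    Integrable f phase :=
  Integrable.of_bound hm.aestronglyMeasurable C (Eventually.of_forall hC)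

/-- The half-line `m`-function to the right of the phase `θ`. -/
noncomputable def mPlus (α β θ : ℝ) (z : ℂ) : ℂ := mFun (fwd (circleV α β θ)) z

/-- The half-line `m`-function to the left of a two-sided sequence. -/
noncomputable def mLeft (ω : ℤ → ℝ) (z : ℂ) : ℂ := mFun (fun j : ℕ => ω (-1 - j)) z

/-- The negative inverse of the half-line `m`-function to the right of a two-sided sequence. -/
noncomputable def mRight (ω : ℤ → ℝ) (z : ℂ) : ℂ :=
  mFun (fun j : ℕ => ω (j + 1)) z + z - ω 0

theorem unitSeq_left {ω : ℤ → ℝ} (hω : ∀ n, ω n ∈ Icc (0 : ℝ) 1) :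
    UnitSeq fun j : ℕ => ω (-1 - j) := fun _ => hω _

theorem unitSeq_right {ω : ℤ → ℝ} (hω : ∀ n, ω n ∈ Icc (0 : ℝ) 1) :
    UnitSeq fun j : ℕ => ω (j + 1) := fun _ => hω _

theorem mLeft_im_pos {ω : ℤ → ℝ} (hω : ∀ n, ω n ∈ Icc (0 : ℝ) 1) {z : ℂ} (hz : 0 < z.im) :
    0 < (mLeft ω z).im := mFun_im_pos (unitSeq_left hω) hz

theorem le_mRight_im {ω : ℤ → ℝ} (hω : ∀ n, ω n ∈ Icc (0 : ℝ) 1) {z : ℂ} (hz : 0 < z.im) :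
    z.im ≤ (mRight ω z).im := by
  have := mFun_im_pos (unitSeq_right hω) hz
  simp only [mRight, Complex.sub_im, Complex.add_im, Complex.ofReal_im]
  linarith

section Circle

variable (α β : ℝ)

theorem circleV_add_one (θ : ℝ) : circleV α β (θ + 1) = circleV α β θ := by
  ext n
  simpa using circleV_add_int α β θ n 1

theorem mPlus_im_pos (θ : ℝ) {z : ℂ} (hz : 0 < z.im) : 0 < (mPlus α β θ z).im :=
  mFun_im_pos (unitSeq_fwd (circleV_mem α β θ)) hz

theorem mRight_eq (θ : ℝ) (z : ℂ) :
    mRight (circleV α β θ) z = mPlus α β (θ + α) z + z - circleV α β θ 0 := by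
  have h : (fun j : ℕ => circleV α β θ (j + 1)) = fwd (circleV α β (θ + α)) := by
    ext j
    simp only [fwd]
    rw [circleV_shift]; simp
  rw [mRight, mPlus, h]

theorem mPlus_eq (θ : ℝ) {z : ℂ} (hz : 0 < z.im) :
    mPlus α β θ z = -(mRight (circleV α β θ) z)⁻¹ := by
  rw [mPlus, mFun_eq (unitSeq_fwd (circleV_mem α β θ)) hz, mRight]
  rfl

theorem mLeft_shift (θ : ℝ) {z : ℂ} (hz : 0 < z.im) :
    mLeft (circleV α β (θ + α)) z =
      -(mLeft (circleV α β θ) z + z - circleV α β θ 0)⁻¹ := by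
  have h0 : ∀ n : ℤ, circleV α β (θ + α) n = circleV α β θ (n + 1) := by
    intro n
    rw [circleV_shift]; simp
  rw [mLeft, mFun_eq (unitSeq_left (circleV_mem α β (θ + α))) hz, h0]
  have h1 : (tail fun j : ℕ => circleV α β (θ + α) (-1 - j)) =
      fun j : ℕ => circleV α β θ (-1 - j) := by
    ext j
    simp only [tail]
    rw [h0]
    congr 1
    push_cast; ring
  rw [h1, mLeft]
  simp

theorem measurable_mPlus {X : Type*} [MeasurableSpace X] {Θ : X → ℝ} {Z : X → ℂ}
    (hΘ : Measurable Θ) (hZ : Measurable Z) (hz : ∀ x, 0 < (Z x).im) :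
    Measurable fun x => mPlus α β (Θ x) (Z x) :=
  measurable_mFun (V := fun n x => circleV α β (Θ x) n)
    (fun n => (measurable_circleV α β n).comp hΘ) hZ
    (fun x => unitSeq_fwd (circleV_mem α β (Θ x))) hz

theorem measurable_mLeft {X : Type*} [MeasurableSpace X] {Θ : X → ℝ} {Z : X → ℂ}
    (hΘ : Measurable Θ) (hZ : Measurable Z) (hz : ∀ x, 0 < (Z x).im) :
    Measurable fun x => mLeft (circleV α β (Θ x)) (Z x) :=
  measurable_mFun (V := fun n x => circleV α β (Θ x) (-1 - n))
    (fun n => (measurable_circleV α β (-1 - n)).comp hΘ) hZ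
    (fun x => unitSeq_left (circleV_mem α β (Θ x))) hz

theorem measurable_mRight {X : Type*} [MeasurableSpace X] {Θ : X → ℝ} {Z : X → ℂ}
    (hΘ : Measurable Θ) (hZ : Measurable Z) (hz : ∀ x, 0 < (Z x).im) :
    Measurable fun x => mRight (circleV α β (Θ x)) (Z x) := by
  simp only [mRight_eq]
  exact ((measurable_mPlus α β (hΘ.add_const α) hZ hz).add hZ).sub
    (Complex.measurable_ofReal.comp ((measurable_circleV α β 0).comp hΘ))

/-- A bound for the logarithms of all `m`-functions at `z`. -/
noncomputable def logBound (z : ℂ) : ℝ := |Real.log (imLower z)| + |Real.log (z.im⁻¹)|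

theorem abs_log_le_logBound {z : ℂ} (hz : 0 < z.im) {t : ℝ} (h1 : imLower z ≤ t)
    (h2 : t ≤ z.im⁻¹) : |Real.log t| ≤ logBound z := by
  have h0 := imLower_pos hz
  have h3 := Real.log_le_log h0 h1
  have h4 := Real.log_le_log (h0.trans_le h1) h2
  unfold logBound
  rw [abs_le]
  constructor
  · linarith [neg_abs_le (Real.log (imLower z)), abs_nonneg (Real.log z.im⁻¹)]
  · linarith [le_abs_self (Real.log z.im⁻¹), abs_nonneg (Real.log (imLower z))]

theorem abs_log_mFun_le {v : ℕ → ℝ} (hv : UnitSeq v) {z : ℂ} (hz : 0 < z.im) :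
    |Real.log ‖mFun v z‖| ≤ logBound z :=
  abs_log_le_logBound hz ((imLower_le_mFun_im hv hz).trans ((le_abs_self _).trans
    (Complex.abs_im_le_norm _))) (mFun_norm_le hv hz)

theorem abs_log_im_mFun_le {v : ℕ → ℝ} (hv : UnitSeq v) {z : ℂ} (hz : 0 < z.im) :
    |Real.log (mFun v z).im| ≤ logBound z :=
  abs_log_le_logBound hz (imLower_le_mFun_im hv hz) (((le_abs_self _).trans
    (Complex.abs_im_le_norm _)).trans (mFun_norm_le hv hz))

theorem abs_log_im_add_le {v : ℕ → ℝ} (hv : UnitSeq v) {z : ℂ} (hz : 0 < z.im) :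
    |Real.log ((mFun v z).im + z.im)| ≤ logBound z + |Real.log (z.im⁻¹ + z.im)| := by
  have h0 := mFun_im_pos hv hz
  have h1 := abs_log_im_mFun_le hv hz
  have h2 : (mFun v z).im ≤ z.im⁻¹ := ((le_abs_self _).trans
    (Complex.abs_im_le_norm _)).trans (mFun_norm_le hv hz)
  have h3 := Real.log_le_log h0 (show (mFun v z).im ≤ (mFun v z).im + z.im by linarith)
  have h4 := Real.log_le_log (show 0 < (mFun v z).im + z.im by linarith)
    (show (mFun v z).im + z.im ≤ z.im⁻¹ + z.im by linarith)
  rw [abs_le] at h1 ⊢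
  constructor
  · linarith [abs_nonneg (Real.log (z.im⁻¹ + z.im))]
  · linarith [le_abs_self (Real.log (z.im⁻¹ + z.im))]

/-- The Lyapunov exponent off the real axis, as an average of the `m`-functions. -/
noncomputable def lyap (z : ℂ) : ℝ := -∫ θ, Real.log ‖mPlus α β θ z‖ ∂phase

theorem log_im_eq {m w : ℂ} (h : m = -w⁻¹) (hw : 0 < w.im) :
    Real.log m.im = Real.log w.im + 2 * Real.log ‖m‖ := by
  have hw0 : w ≠ 0 := by rintro rfl; simp at hw
  have h1 : m.im = w.im * ‖m‖ ^ 2 := by rw [h, im_neg_inv, norm_neg]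
  have h2 : ‖m‖ ≠ 0 := by rw [h]; simpa using hw0
  rw [h1, Real.log_mul hw.ne' (by positivity), Real.log_pow]
  simp

theorem integrable_log_norm_mPlus {z : ℂ} (hz : 0 < z.im) :
    Integrable (fun θ => Real.log ‖mPlus α β θ z‖) phase :=
  integrable_phase (measurable_mPlus α β measurable_id measurable_const fun _ => hz).norm.log
    fun θ => abs_log_mFun_le (unitSeq_fwd (circleV_mem α β θ)) hz

theorem integrable_log_norm_mLeft {z : ℂ} (hz : 0 < z.im) :
    Integrable (fun θ => Real.log ‖mLeft (circleV α β θ) z‖) phase :=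
  integrable_phase (measurable_mLeft α β measurable_id measurable_const fun _ => hz).norm.log
    fun θ => abs_log_mFun_le (unitSeq_left (circleV_mem α β θ)) hz

theorem integrable_log_im_mPlus {z : ℂ} (hz : 0 < z.im) :
    Integrable (fun θ => Real.log (mPlus α β θ z).im) phase :=
  integrable_phase (Complex.measurable_im.comp
    (measurable_mPlus α β measurable_id measurable_const fun _ => hz)).log
    fun θ => abs_log_im_mFun_le (unitSeq_fwd (circleV_mem α β θ)) hz

theorem integrable_log_im_mLeft {z : ℂ} (hz : 0 < z.im) :
    Integrable (fun θ => Real.log (mLeft (circleV α β θ) z).im) phase :=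
  integrable_phase (Complex.measurable_im.comp
    (measurable_mLeft α β measurable_id measurable_const fun _ => hz)).log
    fun θ => abs_log_im_mFun_le (unitSeq_left (circleV_mem α β θ)) hz

theorem integrable_log_im_add_mPlus {z : ℂ} (hz : 0 < z.im) :
    Integrable (fun θ => Real.log ((mPlus α β θ z).im + z.im)) phase :=
  integrable_phase ((Complex.measurable_im.comp
    (measurable_mPlus α β measurable_id measurable_const fun _ => hz)).add_const _).log
    fun θ => abs_log_im_add_le (unitSeq_fwd (circleV_mem α β θ)) hz

theorem integrable_log_im_add_mLeft {z : ℂ} (hz : 0 < z.im) :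
    Integrable (fun θ => Real.log ((mLeft (circleV α β θ) z).im + z.im)) phase :=
  integrable_phase ((Complex.measurable_im.comp
    (measurable_mLeft α β measurable_id measurable_const fun _ => hz)).add_const _).log
    fun θ => abs_log_im_add_le (unitSeq_left (circleV_mem α β θ)) hz

theorem integrable_shift {f : ℝ → ℝ} (hf : Function.Periodic f 1)
    (hi : Integrable f phase) : Integrable (fun θ => f (θ + α)) phase := by
  unfold phase at hi ⊢
  rw [← IntegrableOn, ← intervalIntegrable_iff_integrableOn_Ioc_of_le zero_le_one] at hi ⊢
  have := (hf.intervalIntegrable one_ne_zero (t := 0) (by simpa using hi) α (α + 1)).comp_add_right α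
  simpa using this

theorem mPlus_periodic (z : ℂ) : Function.Periodic (fun θ => mPlus α β θ z) 1 := fun θ => by
  simp only [mPlus, circleV_add_one]

theorem two_mul_lyap {z : ℂ} (hz : 0 < z.im) :
    2 * lyap α β z = ∫ θ, (Real.log ((mPlus α β θ z).im + z.im)
      - Real.log (mPlus α β θ z).im) ∂phase := by
  have hper : Function.Periodic (fun θ => Real.log ((mPlus α β θ z).im + z.im)) 1 := fun θ => by
    simp only [mPlus_periodic α β z θ]
  have hpt : ∀ θ, Real.log (mPlus α β θ z).im = Real.log ((mPlus α β (θ + α) z).im + z.im)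
      + 2 * Real.log ‖mPlus α β θ z‖ := by
    intro θ
    have := log_im_eq (mPlus_eq α β θ hz) (hz.trans_le (le_mRight_im (circleV_mem α β θ) hz))
    rw [this, mRight_eq]
    simp
  have h1 : ∫ θ, Real.log (mPlus α β θ z).im ∂phase =
      ∫ θ, Real.log ((mPlus α β (θ + α) z).im + z.im) ∂phase
        + 2 * ∫ θ, Real.log ‖mPlus α β θ z‖ ∂phase := by
    rw [← integral_const_mul, ← integral_add
      (integrable_shift α hper (integrable_log_im_add_mPlus α β hz))
      ((integrable_log_norm_mPlus α β hz).const_mul 2)]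
    exact integral_congr_ae (Eventually.of_forall hpt)
  rw [integral_phase_shift hper α] at h1
  rw [integral_sub (integrable_log_im_add_mPlus α β hz) (integrable_log_im_mPlus α β hz), h1, lyap]
  ring

theorem neg_two_mul_integral_mLeft {z : ℂ} (hz : 0 < z.im) :
    -2 * ∫ θ, Real.log ‖mLeft (circleV α β θ) z‖ ∂phase =
      ∫ θ, (Real.log ((mLeft (circleV α β θ) z).im + z.im)
        - Real.log (mLeft (circleV α β θ) z).im) ∂phase := by
  have hpI : Function.Periodic (fun θ => Real.log (mLeft (circleV α β θ) z).im) 1 := fun θ => by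
    simp only [circleV_add_one]
  have hpN : Function.Periodic (fun θ => Real.log ‖mLeft (circleV α β θ) z‖) 1 := fun θ => by
    simp only [circleV_add_one]
  have hpt : ∀ θ, Real.log (mLeft (circleV α β (θ + α)) z).im =
      Real.log ((mLeft (circleV α β θ) z).im + z.im)
      + 2 * Real.log ‖mLeft (circleV α β (θ + α)) z‖ := by
    intro θ
    have h0 := mLeft_im_pos (circleV_mem α β θ) hz
    have := log_im_eq (mLeft_shift α β θ hz) (by simp; linarith)
    rw [this]
    simp
  have h1 : ∫ θ, Real.log (mLeft (circleV α β (θ + α)) z).im ∂phase =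
      ∫ θ, Real.log ((mLeft (circleV α β θ) z).im + z.im) ∂phase
        + 2 * ∫ θ, Real.log ‖mLeft (circleV α β (θ + α)) z‖ ∂phase := by
    rw [← integral_const_mul, ← integral_add (integrable_log_im_add_mLeft α β hz)
      ((integrable_shift α hpN (integrable_log_norm_mLeft α β hz)).const_mul 2)]
    exact integral_congr_ae (Eventually.of_forall hpt)
  rw [integral_phase_shift hpI α, integral_phase_shift hpN α] at h1
  rw [integral_sub (integrable_log_im_add_mLeft α β hz) (integrable_log_im_mLeft α β hz), h1]
  ring

end Circle

/-! ### The two-energy identity and the derivative of the Lyapunov exponent -/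

section Circle

variable (α β : ℝ)

/-- The denominator of the Green function, with the two half lines at different energies. -/
noncomputable def twoDen (θ : ℝ) (z₁ z₂ : ℂ) : ℂ :=
  mLeft (circleV α β θ) z₁ + mRight (circleV α β θ) z₂

theorem measurable_twoDen {X : Type*} [MeasurableSpace X] {Θ : X → ℝ} {Z₁ Z₂ : X → ℂ}
    (hΘ : Measurable Θ) (hZ₁ : Measurable Z₁) (hZ₂ : Measurable Z₂) (h₁ : ∀ x, 0 < (Z₁ x).im)
    (h₂ : ∀ x, 0 < (Z₂ x).im) : Measurable fun x => twoDen α β (Θ x) (Z₁ x) (Z₂ x) :=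
  (measurable_mLeft α β hΘ hZ₁ h₁).add (measurable_mRight α β hΘ hZ₂ h₂)

theorem twoDen_periodic (z₁ z₂ : ℂ) : Function.Periodic (fun θ => twoDen α β θ z₁ z₂) 1 :=
  fun θ => by simp only [twoDen, circleV_add_one]

theorem lt_twoDen_im (θ : ℝ) {z₁ z₂ : ℂ} (h₁ : 0 < z₁.im) (h₂ : 0 < z₂.im) :
    z₂.im < (twoDen α β θ z₁ z₂).im := by
  have := mLeft_im_pos (circleV_mem α β θ) h₁
  have := le_mRight_im (circleV_mem α β θ) h₂
  simp only [twoDen, Complex.add_im]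
  linarith

theorem lt_twoDen_sub_im (θ : ℝ) {z₁ z₂ : ℂ} (h₁ : 0 < z₁.im) (h₂ : 0 < z₂.im) :
    z₁.im < (twoDen α β θ z₁ z₂ - (z₂ - z₁)).im := by
  have := mLeft_im_pos (circleV_mem α β θ) h₁
  have := mPlus_im_pos α β (θ + α) h₂
  simp only [twoDen, mRight_eq, Complex.add_im, Complex.sub_im, Complex.ofReal_im]
  linarith

theorem ne_zero_of_im_pos {w : ℂ} (hw : 0 < w.im) : w ≠ 0 := by rintro rfl; simp at hw

theorem twoDen_ne_zero (θ : ℝ) {z₁ z₂ : ℂ} (h₁ : 0 < z₁.im) (h₂ : 0 < z₂.im) :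
    twoDen α β θ z₁ z₂ ≠ 0 := ne_zero_of_im_pos (h₂.trans (lt_twoDen_im α β θ h₁ h₂))

theorem norm_twoDen_le (θ : ℝ) {z₁ z₂ : ℂ} (h₁ : 0 < z₁.im) (h₂ : 0 < z₂.im) :
    ‖twoDen α β θ z₁ z₂‖ ≤ z₁.im⁻¹ + z₂.im⁻¹ + ‖z₂‖ + 1 := by
  have e1 : ‖mLeft (circleV α β θ) z₁‖ ≤ _ := mFun_norm_le (unitSeq_left (circleV_mem α β θ)) h₁
  have e2 : ‖mPlus α β (θ + α) z₂‖ ≤ _ := mFun_norm_le (unitSeq_fwd (circleV_mem α β _)) h₂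
  have e3 := circleV_mem α β θ 0
  have e4 : ‖(circleV α β θ 0 : ℂ)‖ ≤ 1 := by
    rw [Complex.norm_real, Real.norm_eq_abs, abs_le]; exact ⟨by linarith [e3.1], e3.2⟩
  rw [twoDen, mRight_eq]
  calc _ ≤ ‖mLeft (circleV α β θ) z₁‖ + (‖mPlus α β (θ + α) z₂‖ + ‖z₂‖ + ‖(circleV α β θ 0 : ℂ)‖) :=
        (norm_add_le _ _).trans (add_le_add_right ((norm_sub_le _ _).trans
          (add_le_add_left (norm_add_le _ _) _)) _)
    _ ≤ _ := by linarith

theorem twoDen_shift (θ : ℝ) {z₁ z₂ : ℂ} (h₁ : 0 < z₁.im) (h₂ : 0 < z₂.im) :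
    twoDen α β (θ + α) z₁ z₂ = mLeft (circleV α β (θ + α)) z₁ * (mPlus α β (θ + α) z₂)⁻¹ *
      (twoDen α β θ z₁ z₂ - (z₂ - z₁)) := by
  have e1 := mLeft_shift α β θ h₁
  have e2 := mPlus_eq α β (θ + α) h₂
  have e3 : mRight (circleV α β (θ + α)) z₂ = -(mPlus α β (θ + α) z₂)⁻¹ := by
    rw [e2, inv_neg, inv_inv, neg_neg]
  have p0 : mPlus α β (θ + α) z₂ ≠ 0 := ne_zero_of_im_pos (mPlus_im_pos α β _ h₂)
  have s0 : mLeft (circleV α β θ) z₁ + z₁ - circleV α β θ 0 ≠ 0 := by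
    have := mLeft_im_pos (circleV_mem α β θ) h₁
    exact ne_zero_of_im_pos (by simp; linarith)
  rw [twoDen, e3, e1, twoDen, mRight_eq]
  generalize mPlus α β (θ + α) z₂ = p at *
  generalize mLeft (circleV α β θ) z₁ = s at *
  field_simp
  ring

theorem abs_log_norm_le_of_im {w : ℂ} {a b : ℝ} (ha : 0 < a) (h1 : a ≤ w.im) (h2 : ‖w‖ ≤ b) :
    |Real.log ‖w‖| ≤ |Real.log a| + |Real.log b| := by
  have h3 : a ≤ ‖w‖ := h1.trans ((le_abs_self _).trans (Complex.abs_im_le_norm _))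
  have h4 := Real.log_le_log ha h3
  have h5 := Real.log_le_log (ha.trans_le h3) h2
  rw [abs_le]
  constructor
  · linarith [neg_abs_le (Real.log a), abs_nonneg (Real.log b)]
  · linarith [le_abs_self (Real.log b), abs_nonneg (Real.log a)]

theorem integrable_log_twoDen {z₁ z₂ : ℂ} (h₁ : 0 < z₁.im) (h₂ : 0 < z₂.im) :
    Integrable (fun θ => Real.log ‖twoDen α β θ z₁ z₂‖) phase :=
  integrable_phase (measurable_twoDen α β measurable_id measurable_const measurable_const
    (fun _ => h₁) (fun _ => h₂)).norm.log
    fun θ => abs_log_norm_le_of_im h₂ (lt_twoDen_im α β θ h₁ h₂).le (norm_twoDen_le α β θ h₁ h₂)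

theorem integrable_log_twoDen_sub {z₁ z₂ : ℂ} (h₁ : 0 < z₁.im) (h₂ : 0 < z₂.im) :
    Integrable (fun θ => Real.log ‖twoDen α β θ z₁ z₂ - (z₂ - z₁)‖) phase :=
  integrable_phase ((measurable_twoDen α β measurable_id measurable_const measurable_const
    (fun _ => h₁) (fun _ => h₂)).sub_const _).norm.log
    fun θ => abs_log_norm_le_of_im h₁ (lt_twoDen_sub_im α β θ h₁ h₂).le
      ((norm_sub_le _ _).trans (add_le_add_left (norm_twoDen_le α β θ h₁ h₂) _))

theorem lyap_add_integral_mLeft {z₁ z₂ : ℂ} (h₁ : 0 < z₁.im) (h₂ : 0 < z₂.im) :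
    lyap α β z₂ + ∫ θ, Real.log ‖mLeft (circleV α β θ) z₁‖ ∂phase =
      ∫ θ, (Real.log ‖twoDen α β θ z₁ z₂‖ - Real.log ‖twoDen α β θ z₁ z₂ - (z₂ - z₁)‖) ∂phase := by
  have q1 : Function.Periodic (fun θ => Real.log ‖twoDen α β θ z₁ z₂‖) 1 := fun θ => by
    simp only [twoDen_periodic α β z₁ z₂ θ]
  have q2 : Function.Periodic (fun θ => Real.log ‖mLeft (circleV α β θ) z₁‖) 1 := fun θ => by
    simp only [circleV_add_one]
  have q3 : Function.Periodic (fun θ => Real.log ‖mPlus α β θ z₂‖) 1 := fun θ => by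
    simp only [mPlus_periodic α β z₂ θ]
  have hpt : ∀ θ, Real.log ‖twoDen α β (θ + α) z₁ z₂‖ =
      Real.log ‖mLeft (circleV α β (θ + α)) z₁‖ - Real.log ‖mPlus α β (θ + α) z₂‖ +
        Real.log ‖twoDen α β θ z₁ z₂ - (z₂ - z₁)‖ := by
    intro θ
    have s0 := norm_ne_zero_iff.mpr
      (ne_zero_of_im_pos (mLeft_im_pos (circleV_mem α β (θ + α)) h₁))
    have p0 := norm_ne_zero_iff.mpr (ne_zero_of_im_pos (mPlus_im_pos α β (θ + α) h₂))
    have d0 := norm_ne_zero_iff.mpr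
      (ne_zero_of_im_pos (h₁.trans (lt_twoDen_sub_im α β θ h₁ h₂)))
    rw [twoDen_shift α β θ h₁ h₂, norm_mul, norm_mul, norm_inv,
      Real.log_mul (mul_ne_zero s0 (inv_ne_zero p0)) d0, Real.log_mul s0 (inv_ne_zero p0),
      Real.log_inv]
    ring
  have i1 := integrable_shift α q2 (integrable_log_norm_mLeft α β h₁)
  have i2 := integrable_shift α q3 (integrable_log_norm_mPlus α β h₂)
  have h : ∫ θ, Real.log ‖twoDen α β (θ + α) z₁ z₂‖ ∂phase =
      ∫ θ, Real.log ‖mLeft (circleV α β (θ + α)) z₁‖ ∂phase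
        - ∫ θ, Real.log ‖mPlus α β (θ + α) z₂‖ ∂phase
        + ∫ θ, Real.log ‖twoDen α β θ z₁ z₂ - (z₂ - z₁)‖ ∂phase := by
    rw [← integral_sub i1 i2]
    refine (integral_congr_ae (Eventually.of_forall hpt)).trans ?_
    exact integral_add (i1.sub i2) (integrable_log_twoDen_sub α β h₁ h₂)
  rw [integral_phase_shift q1 α, integral_phase_shift q2 α, integral_phase_shift q3 α] at h
  rw [integral_sub (integrable_log_twoDen α β h₁ h₂) (integrable_log_twoDen_sub α β h₁ h₂), h, lyap]
  ring

theorem lyap_eq_mLeft {z : ℂ} (hz : 0 < z.im) :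
    lyap α β z = -∫ θ, Real.log ‖mLeft (circleV α β θ) z‖ ∂phase := by
  have := lyap_add_integral_mLeft α β hz hz
  simp only [sub_self, sub_zero, integral_zero] at this
  linarith

theorem lyap_sub {z₁ z₂ : ℂ} (h₁ : 0 < z₁.im) (h₂ : 0 < z₂.im) :
    lyap α β z₂ - lyap α β z₁ =
      ∫ θ, -Real.log ‖1 - (z₂ - z₁) * (twoDen α β θ z₁ z₂)⁻¹‖ ∂phase := by
  have h := lyap_add_integral_mLeft α β h₁ h₂
  rw [lyap_eq_mLeft α β h₁, sub_neg_eq_add, h]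
  refine integral_congr_ae (Eventually.of_forall fun θ => ?_)
  have d0 := twoDen_ne_zero α β θ h₁ h₂
  have d1 := ne_zero_of_im_pos (h₁.trans (lt_twoDen_sub_im α β θ h₁ h₂))
  have : twoDen α β θ z₁ z₂ - (z₂ - z₁) =
      twoDen α β θ z₁ z₂ * (1 - (z₂ - z₁) * (twoDen α β θ z₁ z₂)⁻¹) := by
    field_simp
  have d2 : (1 - (z₂ - z₁) * (twoDen α β θ z₁ z₂)⁻¹) ≠ 0 := by
    intro h; rw [h, mul_zero] at this; exact d1 this
  simp only [this, norm_mul]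
  rw [Real.log_mul (by simpa using d0) (by simpa using d2)]
  ring

/-- The imaginary part of the diagonal Green function. -/
noncomputable def greenIm (θ : ℝ) (z : ℂ) : ℝ := (-(twoDen α β θ z z)⁻¹).im

theorem greenIm_eq (θ : ℝ) (z : ℂ) :
    greenIm α β θ z = (twoDen α β θ z z).im / ‖twoDen α β θ z z‖ ^ 2 := by
  rw [greenIm, im_neg_inv, norm_inv, inv_pow, div_eq_mul_inv]

theorem greenIm_pos (θ : ℝ) {z : ℂ} (hz : 0 < z.im) : 0 < greenIm α β θ z := by
  have := hz.trans (lt_twoDen_im α β θ hz hz)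
  have := norm_pos_iff.mpr (twoDen_ne_zero α β θ hz hz)
  rw [greenIm_eq]; positivity

theorem norm_inv_twoDen_le (θ : ℝ) {z₁ z₂ : ℂ} (h₁ : 0 < z₁.im) (h₂ : 0 < z₂.im) :
    ‖(twoDen α β θ z₁ z₂)⁻¹‖ ≤ z₂.im⁻¹ := by
  rw [norm_inv]
  exact inv_anti₀ h₂ ((lt_twoDen_im α β θ h₁ h₂).le.trans
    ((le_abs_self _).trans (Complex.abs_im_le_norm _)))

theorem greenIm_le (θ : ℝ) {z : ℂ} (hz : 0 < z.im) : greenIm α β θ z ≤ z.im⁻¹ := by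
  refine ((le_abs_self _).trans (Complex.abs_im_le_norm _)).trans ?_
  rw [norm_neg]; exact norm_inv_twoDen_le α β θ hz hz

/-- The phase average of the imaginary part of the diagonal Green function. -/
noncomputable def meanGreen (z : ℂ) : ℝ := ∫ θ, greenIm α β θ z ∂phase

theorem measurable_greenIm {X : Type*} [MeasurableSpace X] {Θ : X → ℝ} {Z : X → ℂ}
    (hΘ : Measurable Θ) (hZ : Measurable Z) (h : ∀ x, 0 < (Z x).im) :
    Measurable fun x => greenIm α β (Θ x) (Z x) :=
  Complex.measurable_im.comp (measurable_twoDen α β hΘ hZ hZ h h).inv.neg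

theorem continuousAt_mRight {ω : ℤ → ℝ} (hω : ∀ n, ω n ∈ Icc (0 : ℝ) 1) {z : ℂ} (hz : 0 < z.im) :
    ContinuousAt (mRight ω) z := by
  have : DifferentiableAt ℂ (mFun fun j : ℕ => ω (j + 1)) z :=
    (mFun_differentiableOn (unitSeq_right hω)).differentiableAt
      ((isOpen_lt continuous_const Complex.continuous_im).mem_nhds hz)
  exact (this.continuousAt.add continuousAt_id).sub continuousAt_const

/-- The point `E + iε`. -/
noncomputable def epoint (E ε : ℝ) : ℂ := E + ε * I

@[simp] theorem epoint_im (E ε : ℝ) : (epoint E ε).im = ε := by simp [epoint]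
@[simp] theorem epoint_re (E ε : ℝ) : (epoint E ε).re = E := by simp [epoint]

theorem hasDerivAt_lyap (E : ℝ) {ε : ℝ} (hε : 0 < ε) :
    HasDerivAt (fun e => lyap α β (epoint E e)) (meanGreen α β (epoint E ε)) ε := by
  have hz : 0 < (epoint E ε).im := by simpa
  rw [hasDerivAt_iff_tendsto_slope_zero]
  have hev : ∀ᶠ h in 𝓝[≠] (0 : ℝ), |h| < ε / 4 := by
    refine nhdsWithin_le_nhds ?_
    have := (continuous_abs (G := ℝ)).tendsto 0
    rw [abs_zero] at this
    exact this.eventually_lt_const (by positivity)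
  have hdiff : ∀ h : ℝ, epoint E (ε + h) - epoint E ε = h * I := by
    intro h; simp [epoint]; ring
  have hbd : ∀ θ h : ℝ, |h| < ε / 4 →
      ‖(twoDen α β θ (epoint E ε) (epoint E (ε + h)))⁻¹‖ ≤ 2 / ε := by
    intro θ h hh
    rw [abs_lt] at hh
    have := norm_inv_twoDen_le α β θ hz (z₂ := epoint E (ε + h)) (by simp; linarith)
    refine this.trans ?_
    rw [epoint_im, ← inv_div]
    exact inv_anti₀ (by positivity) (by linarith)
  set w : ℝ → ℝ → ℂ := fun θ h => (twoDen α β θ (epoint E ε) (epoint E (ε + h)))⁻¹ with hw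
  have hsmall : ∀ θ h : ℝ, |h| < ε / 4 → ‖-(h * I * w θ h)‖ ≤ 1 / 2 := by
    intro θ h hh
    rw [norm_neg, norm_mul, norm_mul, Complex.norm_I, mul_one, Complex.norm_real, Real.norm_eq_abs]
    calc |h| * ‖w θ h‖ ≤ ε / 4 * (2 / ε) :=
          mul_le_mul hh.le (hbd θ h hh) (norm_nonneg _) (by positivity)
      _ = 1 / 2 := by field_simp; norm_num
  have key : Tendsto (fun h : ℝ => ∫ θ, h⁻¹ * -Real.log ‖1 - h * I * w θ h‖ ∂phase) (𝓝[≠] 0)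
      (𝓝 (∫ θ, greenIm α β θ (epoint E ε) ∂phase)) := by
    refine tendsto_integral_filter_of_dominated_convergence (fun _ => 3 / 2 * (2 / ε)) ?_ ?_
      (integrable_const _) ?_
    · filter_upwards [hev] with h hh
      rw [abs_lt] at hh
      have hm := (measurable_twoDen α β measurable_id (measurable_const (a := epoint E ε))
        (measurable_const (a := epoint E (ε + h))) (fun _ => hz)
        (fun _ => by simp; linarith)).inv
      exact (((measurable_const.sub (hm.const_mul (h * I))).norm.log).neg.const_mul
        h⁻¹).aestronglyMeasurable
    · filter_upwards [hev, self_mem_nhdsWithin] with h hh h0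
      refine Eventually.of_forall fun θ => ?_
      have h1 := Complex.norm_log_one_add_half_le_self (hsmall θ h hh)
      rw [← sub_eq_add_neg] at h1
      have h2 : |Real.log ‖1 - h * I * w θ h‖| ≤ ‖Complex.log (1 - h * I * w θ h)‖ := by
        rw [← Complex.log_re]; exact Complex.abs_re_le_norm _
      have h0' : 0 < |h| := abs_pos.mpr h0
      rw [norm_neg, norm_mul, norm_mul, Complex.norm_I, mul_one, Complex.norm_real,
        Real.norm_eq_abs] at h1
      rw [Real.norm_eq_abs, abs_mul, abs_neg, abs_inv]
      calc |h|⁻¹ * |Real.log ‖1 - h * I * w θ h‖| ≤ |h|⁻¹ * (3 / 2 * (|h| * ‖w θ h‖)) := by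
            gcongr; exact h2.trans h1
        _ = 3 / 2 * ‖w θ h‖ := by field_simp
        _ ≤ _ := by gcongr; exact hbd θ h hh
    · refine Eventually.of_forall fun θ => ?_
      have hc : Tendsto (w θ) (𝓝 0) (𝓝 (w θ 0)) := by
        have c1 : ContinuousAt (fun h : ℝ => epoint E (ε + h)) 0 := by
          unfold epoint; fun_prop
        have c2 : ContinuousAt (mRight (circleV α β θ)) (epoint E (ε + 0)) :=
          continuousAt_mRight (circleV_mem α β θ) (by simpa)
        exact ((continuousAt_const (y := mLeft (circleV α β θ) (epoint E ε))).add
          (ContinuousAt.comp (f := fun h : ℝ => epoint E (ε + h)) c2 c1)).inv₀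
          (twoDen_ne_zero α β θ hz (by simpa))
      have hd : HasDerivAt (fun h : ℝ => Complex.log (1 - h * I * w θ h)) (-(I * w θ 0)) 0 := by
        have hu : HasDerivAt (fun h : ℝ => (1 : ℂ) - h * I * w θ h) (-(I * w θ 0)) 0 := by
          rw [hasDerivAt_iff_tendsto_slope_zero]
          have : Tendsto (fun h => -(I * w θ h)) (𝓝[≠] 0) (𝓝 (-(I * w θ 0))) :=
            ((hc.const_mul I).neg).mono_left nhdsWithin_le_nhds
          refine this.congr' ?_
          filter_upwards [self_mem_nhdsWithin] with h h0
          have h0' : (h : ℂ) ≠ 0 := by exact_mod_cast h0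
          simp only [zero_add, Complex.real_smul, Complex.ofReal_inv, Complex.ofReal_zero, zero_mul,
            sub_zero]
          field_simp
          ring
        have := hu.clog_real (by simp)
        simpa using this
      have hre : HasDerivAt (fun h : ℝ => Real.log ‖1 - h * I * w θ h‖) ((-(I * w θ 0)).re) 0 := by
        have := (Complex.reCLM.hasFDerivAt.comp_hasDerivAt (0 : ℝ) hd)
        simpa [Function.comp_def, Complex.log_re] using this
      have hs := (hasDerivAt_iff_tendsto_slope_zero.mp hre).neg
      have hlim : -(-(I * w θ 0)).re = greenIm α β θ (epoint E ε) := by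
        simp [hw, greenIm]
      rw [hlim] at hs
      refine hs.congr fun h => ?_
      simp
  refine key.congr' ?_
  filter_upwards [hev] with h hh
  rw [abs_lt] at hh
  rw [lyap_sub α β hz (by simp; linarith), hdiff, smul_eq_mul, ← integral_const_mul]

end Circle

/-! ### Comparison of the Lyapunov exponent with transfer matrices -/

section Matrices

attribute [local instance] Matrix.linftyOpNormedAddCommGroup Matrix.linftyOpNormedSpace
  Matrix.linftyOpNormedRing Matrix.linftyOpNormedAlgebra

theorem max_norm_le_of_det {M : Matrix (Fin 2) (Fin 2) ℂ} (hM : M.det = 1) {x y x' y' : ℂ}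
    (h0 : M 0 0 * x + M 0 1 * y = x') (h1 : M 1 0 * x + M 1 1 * y = y') :
    max ‖x‖ ‖y‖ ≤ 2 * ‖M‖ * max ‖x'‖ ‖y'‖ := by
  have hn := (norm_mat M).ge
  have n0 := (le_max_left _ _).trans hn
  have n1 := (le_max_right _ _).trans hn
  have hx' := le_max_left ‖x'‖ ‖y'‖
  have hy' := le_max_right ‖x'‖ ‖y'‖
  set m := max ‖x'‖ ‖y'‖
  have hm : 0 ≤ m := (norm_nonneg _).trans hx'
  rw [Matrix.det_fin_two] at hM
  have ex : x = M 1 1 * x' - M 0 1 * y' := by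
    rw [← h0, ← h1]; linear_combination (-x) * hM
  have ey : y = M 0 0 * y' - M 1 0 * x' := by
    rw [← h0, ← h1]; linear_combination (-y) * hM
  have p00 := norm_nonneg (M 0 0)
  have p01 := norm_nonneg (M 0 1)
  have p10 := norm_nonneg (M 1 0)
  have p11 := norm_nonneg (M 1 1)
  refine max_le ?_ ?_
  · rw [ex]
    refine (norm_sub_le _ _).trans ?_
    rw [norm_mul, norm_mul]
    nlinarith [mul_le_mul_of_nonneg_left hx' p11, mul_le_mul_of_nonneg_left hy' p01,
      mul_le_mul_of_nonneg_right n0 hm, mul_le_mul_of_nonneg_right n1 hm, mul_nonneg p00 hm,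
      mul_nonneg p10 hm]
  · rw [ey]
    refine (norm_sub_le _ _).trans ?_
    rw [norm_mul, norm_mul]
    nlinarith [mul_le_mul_of_nonneg_left hx' p10, mul_le_mul_of_nonneg_left hy' p00,
      mul_le_mul_of_nonneg_right n0 hm, mul_le_mul_of_nonneg_right n1 hm, mul_nonneg p01 hm,
      mul_nonneg p11 hm]

variable (α β : ℝ)

theorem mPlus_mul (θ : ℝ) {z : ℂ} (hz : 0 < z.im) :
    mPlus α β θ z * (mPlus α β (θ + α) z + z - circleV α β θ 0) = -1 := by
  rw [← mRight_eq, mPlus_eq α β θ hz, neg_mul, inv_mul_cancel₀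
    (ne_zero_of_im_pos (hz.trans_le (le_mRight_im (circleV_mem α β θ) hz)))]

theorem transMat_mul_mPlus (θ : ℝ) {z : ℂ} (hz : 0 < z.im) (n : ℕ) :
    ∃ c : ℂ, c ≠ 0 ∧
      Real.log ‖c‖ = ∑ j ∈ Finset.range n, Real.log ‖mPlus α β (θ + j * α) z‖ ∧
      transMat n (fwd (circleV α β θ)) z 0 0 * (-mPlus α β θ z)
        + transMat n (fwd (circleV α β θ)) z 0 1 * 1 = c * -mPlus α β (θ + n * α) z ∧
      transMat n (fwd (circleV α β θ)) z 1 0 * (-mPlus α β θ z)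
        + transMat n (fwd (circleV α β θ)) z 1 1 * 1 = c := by
  induction n with
  | zero => exact ⟨1, one_ne_zero, by simp, by simp [transMat], by simp [transMat]⟩
  | succ n ih =>
    obtain ⟨c, hc0, hc, h0, h1⟩ := ih
    have p0 := ne_zero_of_im_pos (mPlus_im_pos α β (θ + n * α) hz)
    refine ⟨c * -mPlus α β (θ + n * α) z, by simp [hc0, p0], ?_, ?_, ?_⟩
    · rw [norm_mul, norm_neg, Real.log_mul (by simpa) (by simpa), hc, Finset.sum_range_succ]
    · have hm := mPlus_mul α β (θ + n * α) hz
      have hv : fwd (circleV α β θ) n = circleV α β (θ + n * α) 0 := by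
        have := circleV_shift α β θ 0 n
        simpa [fwd] using this
      have e : θ + ((n + 1 : ℕ) : ℝ) * α = θ + n * α + α := by push_cast; ring
      rw [e]
      simp only [transMat, stepMat, Matrix.mul_apply, Fin.sum_univ_two, Matrix.of_apply,
        Matrix.cons_val', Matrix.cons_val_zero, Matrix.cons_val_one, Matrix.cons_val_fin_one, hv]
      linear_combination (z - circleV α β (θ + n * α) 0) * h0 - h1 - c * hm
    · simp only [transMat, stepMat, Matrix.mul_apply, Fin.sum_univ_two, Matrix.of_apply,
        Matrix.cons_val', Matrix.cons_val_zero, Matrix.cons_val_one, Matrix.cons_val_fin_one]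
      linear_combination h0

theorem mul_lyap_le {z : ℂ} (hz : 0 < z.im) {n : ℕ} {L : ℝ}
    (hL : ∀ θ, logNorm n (fwd (circleV α β θ)) z ≤ L) :
    n * lyap α β z ≤ Real.log 2 + L := by
  set N : ℝ → ℝ := fun θ => Real.log (max ‖mPlus α β θ z‖ 1) with hN
  have hNp : Function.Periodic N 1 := fun θ => by simp only [hN, mPlus_periodic α β z θ]
  have hlp : Function.Periodic (fun θ => Real.log ‖mPlus α β θ z‖) 1 := fun θ => by
    simp only [mPlus_periodic α β z θ]
  have hNi : Integrable N phase := by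
    refine integrable_phase ((measurable_mPlus α β measurable_id measurable_const
      fun _ => hz).norm.max measurable_const).log (C := Real.log (max z.im⁻¹ 1)) fun θ => ?_
    have h1 : (1 : ℝ) ≤ max ‖mPlus α β θ z‖ 1 := le_max_right _ _
    rw [abs_of_nonneg (Real.log_nonneg h1)]
    exact Real.log_le_log (one_pos.trans_le h1)
      (max_le_max (mFun_norm_le (unitSeq_fwd (circleV_mem α β θ)) hz) le_rfl)
  have hpt : ∀ θ, N θ ≤ Real.log 2 + L +
      (∑ j ∈ Finset.range n, Real.log ‖mPlus α β (θ + j * α) z‖) + N (θ + n * α) := by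
    intro θ
    obtain ⟨c, hc0, hc, h0, h1⟩ := transMat_mul_mPlus α β θ hz n
    have h := max_norm_le_of_det (det_transMat n (fwd (circleV α β θ)) z) h0 h1
    have hT := norm_transMat_pos n (fwd (circleV α β θ)) z
    have hc' : 0 < ‖c‖ := norm_pos_iff.mpr hc0
    have hmax : ∀ x : ℝ, 0 < max x 1 := fun x => one_pos.trans_le (le_max_right _ _)
    have h2 : max ‖c * -mPlus α β (θ + n * α) z‖ ‖c‖ =
        ‖c‖ * max ‖mPlus α β (θ + n * α) z‖ 1 := by
      rw [norm_mul, norm_neg, mul_max_of_nonneg _ _ hc'.le, mul_one]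
    rw [h2, norm_neg, norm_one] at h
    have h3 := Real.log_le_log (hmax _) h
    rw [Real.log_mul (by positivity) (mul_ne_zero hc'.ne' (hmax _).ne'),
      Real.log_mul two_ne_zero hT.ne', Real.log_mul hc'.ne' (hmax _).ne', hc] at h3
    have := hL θ
    rw [logNorm] at this
    simp only [hN]
    linarith
  have hi : ∀ j ∈ Finset.range n,
      Integrable (fun θ => Real.log ‖mPlus α β (θ + j * α) z‖) phase := fun j _ =>
    integrable_shift (j * α) hlp (integrable_log_norm_mPlus α β hz)
  have hsum := integrable_finsetSum _ hi
  have h := integral_mono hNi (((integrable_const (Real.log 2 + L)).add hsum).add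
    (integrable_shift (n * α) hNp hNi)) hpt
  have e1 := integral_add ((integrable_const (Real.log 2 + L) (μ := phase)).add hsum)
    (integrable_shift (n * α) hNp hNi)
  have e2 := integral_add (integrable_const (Real.log 2 + L) (μ := phase)) hsum
  have e3 := integral_finsetSum (Finset.range n) hi
  have e4 : ∀ j : ℕ, ∫ θ, Real.log ‖mPlus α β (θ + j * α) z‖ ∂phase = -lyap α β z := by
    intro j
    rw [integral_phase_shift hlp, lyap, neg_neg]
  simp only [e4, Finset.sum_const, Finset.card_range, nsmul_eq_mul] at e3
  have e5 := integral_phase_shift hNp (n * α)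
  have e6 : ∫ _, (Real.log 2 + L) ∂phase = Real.log 2 + L := by simp
  simp only [Pi.add_apply] at h e1
  rw [e1, e2, e3, e5, e6] at h
  linarith

theorem lyap_nonneg {z : ℂ} (hz : 0 < z.im) : 0 ≤ lyap α β z := by
  have h := two_mul_lyap α β hz
  have : 0 ≤ ∫ θ, (Real.log ((mPlus α β θ z).im + z.im)
      - Real.log (mPlus α β θ z).im) ∂phase := by
    refine integral_nonneg fun θ => sub_nonneg.mpr ?_
    exact Real.log_le_log (mPlus_im_pos α β θ hz) (by linarith)
  linarith

theorem lyap_le {z : ℂ} (hz : 0 < z.im) : lyap α β z ≤ Real.log 2 + Real.log (‖z‖ + 2) := by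
  have := mul_lyap_le α β hz (n := 1) fun θ => logNorm_le 1 (unitSeq_fwd (circleV_mem α β θ)) z
  simpa using this

theorem logNorm_mul_le {z : ℂ} {n : ℕ} {L : ℝ}
    (hL : ∀ θ, logNorm n (fwd (circleV α β θ)) z ≤ L) (k : ℕ) (θ : ℝ) :
    logNorm (k * n) (fwd (circleV α β θ)) z ≤ k * L := by
  induction k generalizing θ with
  | zero => simp [logNorm, transMat]
  | succ k ih =>
    rw [Nat.succ_mul]
    refine (logNorm_add_circle α β θ z _ _).trans ?_
    have h1 := ih θ
    have h2 := hL (θ + (k * n : ℕ) * α)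
    push_cast at *
    linarith

theorem lyap_le_of_logNorm_le {z : ℂ} (hz : 0 < z.im) {n : ℕ} (hn : 0 < n) {δ : ℝ}
    (hL : ∀ θ, logNorm n (fwd (circleV α β θ)) z ≤ δ * n) : lyap α β z ≤ δ := by
  have hn' : (0 : ℝ) < n := by exact_mod_cast hn
  have h : ∀ k : ℕ, (k : ℝ) * ((lyap α β z - δ) * n) ≤ Real.log 2 := by
    intro k
    have := mul_lyap_le α β hz (logNorm_mul_le α β hL k)
    push_cast at this
    linarith
  by_contra! hlt
  have hpos : 0 < (lyap α β z - δ) * n := mul_pos (by linarith) hn'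
  obtain ⟨k, hk⟩ := exists_nat_gt (Real.log 2 / ((lyap α β z - δ) * n))
  rw [div_lt_iff₀ hpos] at hk
  linarith [h k]

variable {α β}

theorem tendsto_lyap {E : ℝ} (h : ∀ δ : ℝ, 0 < δ → ∃ n : ℕ, 0 < n ∧
      ∀ φ, logNorm n (fwd (circleV α β φ)) E ≤ δ * n) :
    Tendsto (fun ε => lyap α β (epoint E ε)) (𝓝[>] 0) (𝓝 0) := by
  rw [Metric.tendsto_nhds]
  intro e he
  obtain ⟨n, hn, hE⟩ := h (e / 4) (by positivity)
  have hn' : (0 : ℝ) < n := by exact_mod_cast hn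
  set K : ℝ := n * (|E| + 1 + 2) ^ n
  have hK : 0 < K := by positivity
  have h1 : ∀ᶠ ε in 𝓝[>] (0 : ℝ), ε < min 1 (e / 4 * n / K) :=
    nhdsWithin_le_nhds (eventually_lt_nhds (by positivity))
  filter_upwards [h1, self_mem_nhdsWithin] with ε hε hpos
  have hpos' : 0 < ε := hpos
  have hε1 := hε.le.trans (min_le_left _ _)
  have hε2 := hε.le.trans (min_le_right _ _)
  rw [le_div_iff₀ hK] at hε2
  have hz : 0 < (epoint E ε).im := by simpa
  have hb : lyap α β (epoint E ε) ≤ e / 2 := by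
    refine lyap_le_of_logNorm_le α β hz hn fun θ => ?_
    have hsub : ‖epoint E ε - E‖ = ε := by simp [epoint, abs_of_pos hpos']
    have hr : ‖epoint E ε‖ ≤ |E| + 1 := by
      refine (norm_add_le _ _).trans ?_
      simp [abs_of_pos hpos', hε1]
    have hd := norm_transMat_sub_le n (unitSeq_fwd (circleV_mem α β θ)) hr
      (w := (E : ℂ)) (by simp)
    rw [hsub] at hd
    have hT : ‖transMat n (fwd (circleV α β θ)) E‖ ≤ Real.exp (e / 4 * n) := by
      rw [← Real.log_le_iff_le_exp (norm_transMat_pos _ _ _)]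
      exact hE θ
    have h3 : ‖transMat n (fwd (circleV α β θ)) (epoint E ε)‖ ≤
        Real.exp (e / 4 * n) * (1 + e / 4 * n) := by
      have := norm_le_norm_add_norm_sub' (transMat n (fwd (circleV α β θ)) (epoint E ε))
        (transMat n (fwd (circleV α β θ)) E)
      have h4 : (1 : ℝ) ≤ Real.exp (e / 4 * n) := Real.one_le_exp (by positivity)
      have h5 : 0 ≤ e / 4 * n := by positivity
      nlinarith [mul_le_mul_of_nonneg_right h4 h5]
    rw [logNorm, Real.log_le_iff_le_exp (norm_transMat_pos _ _ _)]
    refine h3.trans ?_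
    calc _ ≤ Real.exp (e / 4 * n) * Real.exp (e / 4 * n) := by
          gcongr; linarith [Real.add_one_le_exp (e / 4 * n)]
      _ = _ := by rw [← Real.exp_add]; ring_nf
  rw [Real.dist_eq, sub_zero, abs_of_nonneg (lyap_nonneg α β hz)]
  linarith

end Matrices

/-! ### Contour bounds for functions analytic in the upper half plane -/

theorem continuous_epoint_left (ε : ℝ) : Continuous fun E : ℝ => epoint E ε := by
  unfold epoint; fun_prop

theorem norm_integral_epoint_sub_le {g : ℂ → ℂ} (hg : DifferentiableOn ℂ g {z | 0 < z.im})
    {a b ε η : ℝ} (hε : 0 < ε) (hεη : ε ≤ η) {φ : ℝ → ℝ}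
    (hφ : IntervalIntegrable φ volume ε η)
    (ha : ∀ y, ε ≤ y → y ≤ η → ‖g (epoint a y)‖ ≤ φ y)
    (hb : ∀ y, ε ≤ y → y ≤ η → ‖g (epoint b y)‖ ≤ φ y) :
    ‖(∫ x in a..b, g (epoint x ε)) - ∫ x in a..b, g (epoint x η)‖ ≤ 2 * ∫ y in ε..η, φ y := by
  have h := Complex.integral_boundary_rect_eq_zero_of_differentiableOn g (epoint a ε) (epoint b η)
    (hg.mono fun z hz => by
      have := hz.2
      simp only [epoint_im, mem_preimage, uIcc_of_le hεη] at this
      exact hε.trans_le this.1)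
  simp only [epoint_im, epoint_re] at h
  have e : (∫ x in a..b, g (epoint x ε)) - ∫ x in a..b, g (epoint x η) =
      I • (∫ y in ε..η, g (epoint a y)) - I • ∫ y in ε..η, g (epoint b y) := by
    simp only [epoint]
    linear_combination h
  have ba : ‖∫ y in ε..η, g (epoint a y)‖ ≤ ∫ y in ε..η, φ y :=
    intervalIntegral.norm_integral_le_of_norm_le hεη
      (Eventually.of_forall fun y hy => ha y hy.1.le hy.2) hφ
  have bb : ‖∫ y in ε..η, g (epoint b y)‖ ≤ ∫ y in ε..η, φ y :=
    intervalIntegral.norm_integral_le_of_norm_le hεη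
      (Eventually.of_forall fun y hy => hb y hy.1.le hy.2) hφ
  rw [e]
  refine (norm_sub_le _ _).trans ?_
  rw [norm_smul, norm_smul, Complex.norm_I, one_mul, one_mul]
  linarith

theorem continuous_comp_epoint {g : ℂ → ℂ} (hg : DifferentiableOn ℂ g {z | 0 < z.im}) {ε : ℝ}
    (hε : 0 < ε) : Continuous fun E : ℝ => g (epoint E ε) :=
  hg.continuousOn.comp_continuous (continuous_epoint_left ε) fun E => by simpa

theorem integral_im_eq {g : ℂ → ℂ} (hg : DifferentiableOn ℂ g {z | 0 < z.im}) {ε : ℝ}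
    (hε : 0 < ε) (a b : ℝ) :
    ∫ x in a..b, (g (epoint x ε)).im = (∫ x in a..b, g (epoint x ε)).im :=
  Complex.imCLM.intervalIntegral_comp_comm ((continuous_comp_epoint hg hε).intervalIntegrable _ _)

theorem integral_im_le_of_norm_le_one {g : ℂ → ℂ} (hg : DifferentiableOn ℂ g {z | 0 < z.im})
    {M : ℝ} (hM : 0 ≤ M) (h1 : ∀ z : ℂ, 0 < z.im → M ≤ |z.re| ∨ 1 ≤ z.im → ‖g z‖ ≤ 1)
    {ε : ℝ} (hε : 0 < ε) (hε1 : ε ≤ 1) :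
    ∫ x in (-M)..M, (g (epoint x ε)).im ≤ 2 * M + 2 := by
  have h := norm_integral_epoint_sub_le hg (a := -M) (b := M) hε hε1
    (φ := fun _ => (1 : ℝ)) (by simp)
    (fun y hy _ => h1 _ (by simpa using hε.trans_le hy) (Or.inl (by simp [abs_of_nonneg hM])))
    (fun y hy _ => h1 _ (by simpa using hε.trans_le hy) (Or.inl (by simp [abs_of_nonneg hM])))
  have h2 : ‖∫ x in (-M)..M, g (epoint x 1)‖ ≤ 1 * |M - -M| :=
    intervalIntegral.norm_integral_le_of_norm_le_const fun x _ =>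
      h1 _ (by simp) (Or.inr (by simp))
  rw [integral_im_eq hg hε]
  refine ((le_abs_self _).trans (Complex.abs_im_le_norm _)).trans ?_
  have h3 := norm_le_norm_add_norm_sub' (∫ x in (-M)..M, g (epoint x ε))
    (∫ x in (-M)..M, g (epoint x 1))
  simp only [intervalIntegral.integral_const, smul_eq_mul, mul_one] at h
  rw [abs_of_nonneg (by linarith)] at h2
  linarith

/-! ### An elementary growth lemma -/

theorem exists_div_sub_deriv_lt {Φ J : ℝ → ℝ} {C : ℝ}
    (hd : ∀ ε, 0 < ε → ε < 1 → HasDerivAt Φ (J ε) ε) (h0 : Tendsto Φ (𝓝[>] 0) (𝓝 0))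
    (hJ : ∀ ε, 0 < ε → ε < 1 → J ε ≤ C) {c η : ℝ} (hc : 0 < c) (hη : 0 < η) :
    ∃ ε, 0 < ε ∧ ε < η ∧ Φ ε / ε - J ε < c := by
  have hlin : ∀ ε, 0 < ε → ε < 1 → Φ ε ≤ C * ε := by
    intro ε hε hε1
    have hm : ∀ t, 0 < t → t < ε → Φ ε ≤ C * (ε - t) + Φ t := by
      intro t ht htε
      have hin : interior (Ioo (0 : ℝ) 1) = Ioo 0 1 := isOpen_Ioo.interior_eq
      have := (convex_Ioo (0 : ℝ) 1).image_sub_le_mul_sub_of_deriv_le (f := Φ) (C := C)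
        (fun x hx => (hd x hx.1 hx.2).continuousAt.continuousWithinAt)
        (fun x hx => (hd x (hin ▸ hx).1 (hin ▸ hx).2).differentiableAt.differentiableWithinAt)
        (fun x hx => by
          rw [hin] at hx
          rw [(hd x hx.1 hx.2).deriv]; exact hJ x hx.1 hx.2)
        t ⟨ht, htε.trans hε1⟩ ε ⟨hε, hε1⟩ htε.le
      linarith
    have hl : Tendsto (fun t => C * (ε - t) + Φ t) (𝓝[>] 0) (𝓝 (C * (ε - 0) + 0)) := by
      refine Tendsto.add (Tendsto.mono_left ?_ nhdsWithin_le_nhds) h0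
      exact (continuous_const.mul (continuous_const.sub continuous_id)).tendsto 0
    have := ge_of_tendsto hl (by
      filter_upwards [self_mem_nhdsWithin, nhdsWithin_le_nhds (eventually_lt_nhds hε)] with t h1 h2
      exact hm t h1 h2)
    simpa using this
  by_contra! hcon
  set b := min η 1 / 2 with hb
  have hb0 : 0 < b := by positivity
  have hb1 : b < 1 := by
    have := min_le_right η 1
    linarith
  have hbη : b < η := by
    have := min_le_left η 1
    have : 0 < min η 1 := by positivity
    linarith
  have hanti : ∀ ε, 0 < ε → ε ≤ b → Φ b / b + c * Real.log b ≤ Φ ε / ε + c * Real.log ε := by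
    intro ε hε hεb
    have hder : ∀ x ∈ Icc ε b, HasDerivAt (fun x => Φ x / x + c * Real.log x)
        ((J x * x - Φ x * 1) / x ^ 2 + c * x⁻¹) x := by
      intro x hx
      have hx0 : 0 < x := hε.trans_le hx.1
      exact ((hd x hx0 (hx.2.trans_lt hb1)).div (hasDerivAt_id x) hx0.ne').add
        ((Real.hasDerivAt_log hx0.ne').const_mul c)
    refine antitoneOn_of_deriv_nonpos (convex_Icc ε b)
      (fun x hx => (hder x hx).continuousAt.continuousWithinAt)
      (fun x hx => (hder x (interior_subset hx)).differentiableAt.differentiableWithinAt)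
      (fun x hx => ?_) (left_mem_Icc.mpr hεb) (right_mem_Icc.mpr hεb) hεb
    have hx' := interior_subset hx
    have hx0 : 0 < x := hε.trans_le hx'.1
    rw [(hder x hx').deriv]
    have h1 := hcon x hx0 (hx'.2.trans_lt hbη)
    have : (J x * x - Φ x * 1) / x ^ 2 + c * x⁻¹ = (c - (Φ x / x - J x)) * x⁻¹ := by
      field_simp; ring
    rw [this]
    exact mul_nonpos_of_nonpos_of_nonneg (by linarith) (by positivity)
  have hbot : Tendsto (fun ε => C + c * Real.log ε) (𝓝[>] 0) atBot :=
    tendsto_atBot_add_const_left _ _ (Real.tendsto_log_nhdsGT_zero.const_mul_atBot hc)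
  obtain ⟨ε, h1, h2, h3⟩ := ((hbot.eventually_lt_atBot (Φ b / b + c * Real.log b)).and
    ((eventually_mem_nhdsWithin (s := Ioi (0 : ℝ)) (a := 0)).and (nhdsWithin_le_nhds (eventually_lt_nhds hb0)))).exists
  have h2' : 0 < ε := h2
  have h4 := hanti ε h2' (le_of_lt h3)
  have h5 : Φ ε / ε ≤ C := by
    rw [div_le_iff₀ h2']; exact hlin ε h2' ((show ε < b from h3).trans hb1)
  linarith

/-! ### The Kotani identity -/

theorem two_mul_div_le_log_one_add {t : ℝ} (ht : 0 ≤ t) : 2 * t / (2 + t) ≤ Real.log (1 + t) := by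
  have := Real.le_log_one_add_of_nonneg ht
  rwa [add_comm t 2] at this

theorem div_le_log_add_sub_log {m ε : ℝ} (hm : 0 < m) (hε : 0 < ε) :
    ε * (m + ε / 2)⁻¹ ≤ Real.log (m + ε) - Real.log m := by
  have h := two_mul_div_le_log_one_add (t := ε / m) (by positivity)
  rw [← Real.log_div (by positivity) hm.ne']
  have e1 : (m + ε) / m = 1 + ε / m := by field_simp
  have e2 : ε * (m + ε / 2)⁻¹ = 2 * (ε / m) / (2 + ε / m) := by field_simp
  rw [e1, e2]; exact h

section Circle

variable (α β : ℝ)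

/-- The symmetrized imaginary part of the right half-line. -/
noncomputable def imRight (θ : ℝ) (z : ℂ) : ℝ := (mRight (circleV α β θ) z).im - z.im / 2

/-- The symmetrized imaginary part of the left half-line. -/
noncomputable def imLeft (θ : ℝ) (z : ℂ) : ℝ := (mLeft (circleV α β θ) z).im + z.im / 2

theorem imRight_add_imLeft (θ : ℝ) (z : ℂ) :
    imRight α β θ z + imLeft α β θ z = (twoDen α β θ z z).im := by
  simp only [imRight, imLeft, twoDen, Complex.add_im]; ring

theorem imRight_eq (θ : ℝ) (z : ℂ) :
    imRight α β θ z = (mPlus α β (θ + α) z).im + z.im / 2 := by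
  simp only [imRight, mRight_eq, Complex.add_im, Complex.sub_im, Complex.ofReal_im]; ring

theorem lt_imRight (θ : ℝ) {z : ℂ} (hz : 0 < z.im) : z.im / 2 < imRight α β θ z := by
  have := mPlus_im_pos α β (θ + α) hz
  rw [imRight_eq]; linarith

theorem lt_imLeft (θ : ℝ) {z : ℂ} (hz : 0 < z.im) : z.im / 2 < imLeft α β θ z := by
  have := mLeft_im_pos (circleV_mem α β θ) hz
  rw [imLeft]; linarith

theorem measurable_imRight {X : Type*} [MeasurableSpace X] {Θ : X → ℝ} {Z : X → ℂ}
    (hΘ : Measurable Θ) (hZ : Measurable Z) (h : ∀ x, 0 < (Z x).im) :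
    Measurable fun x => imRight α β (Θ x) (Z x) :=
  (Complex.measurable_im.comp (measurable_mRight α β hΘ hZ h)).sub
    ((Complex.measurable_im.comp hZ).div_const 2)

theorem measurable_imLeft {X : Type*} [MeasurableSpace X] {Θ : X → ℝ} {Z : X → ℂ}
    (hΘ : Measurable Θ) (hZ : Measurable Z) (h : ∀ x, 0 < (Z x).im) :
    Measurable fun x => imLeft α β (Θ x) (Z x) :=
  (Complex.measurable_im.comp (measurable_mLeft α β hΘ hZ h)).add
    ((Complex.measurable_im.comp hZ).div_const 2)

theorem inv_le_of_half_lt {x e : ℝ} (he : 0 < e) (h : e / 2 < x) : |x⁻¹| ≤ 2 * e⁻¹ := by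
  have hx : 0 < x := by linarith
  rw [abs_of_pos (inv_pos.mpr hx)]
  calc x⁻¹ ≤ (e / 2)⁻¹ := inv_anti₀ (by positivity) h.le
    _ = 2 * e⁻¹ := by rw [inv_div, div_eq_mul_inv]

theorem integrable_inv_imRight {z : ℂ} (hz : 0 < z.im) :
    Integrable (fun θ => (imRight α β θ z)⁻¹) phase :=
  integrable_phase (measurable_imRight α β measurable_id measurable_const fun _ => hz).inv
    fun θ => inv_le_of_half_lt hz (lt_imRight α β θ hz)

theorem integrable_inv_imLeft {z : ℂ} (hz : 0 < z.im) :
    Integrable (fun θ => (imLeft α β θ z)⁻¹) phase :=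
  integrable_phase (measurable_imLeft α β measurable_id measurable_const fun _ => hz).inv
    fun θ => inv_le_of_half_lt hz (lt_imLeft α β θ hz)

theorem integrable_greenIm {z : ℂ} (hz : 0 < z.im) :
    Integrable (fun θ => greenIm α β θ z) phase :=
  integrable_phase (measurable_greenIm α β measurable_id measurable_const fun _ => hz)
    fun θ => by
      rw [abs_of_pos (greenIm_pos α β θ hz)]
      exact greenIm_le α β θ hz

theorem integral_inv_imRight_le {z : ℂ} (hz : 0 < z.im) :
    z.im * ∫ θ, (imRight α β θ z)⁻¹ ∂phase ≤ 2 * lyap α β z := by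
  have hp : Function.Periodic (fun θ => ((mPlus α β θ z).im + z.im / 2)⁻¹) 1 := fun θ => by
    simp only [mPlus_periodic α β z θ]
  have hi : Integrable (fun θ => ((mPlus α β θ z).im + z.im / 2)⁻¹) phase := by
    refine integrable_phase ((Complex.measurable_im.comp
      (measurable_mPlus α β measurable_id measurable_const fun _ => hz)).add_const _).inv
      (C := 2 * z.im⁻¹) fun θ => inv_le_of_half_lt hz ?_
    have := mPlus_im_pos α β θ hz
    change z.im / 2 < (mPlus α β θ z).im + z.im / 2
    linarith
  simp only [imRight_eq]
  rw [integral_phase_shift hp, two_mul_lyap α β hz, ← integral_const_mul]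
  refine integral_mono (hi.const_mul _) ((integrable_log_im_add_mPlus α β hz).sub
    (integrable_log_im_mPlus α β hz)) fun θ => ?_
  exact div_le_log_add_sub_log (mPlus_im_pos α β θ hz) hz

theorem integral_inv_imLeft_le {z : ℂ} (hz : 0 < z.im) :
    z.im * ∫ θ, (imLeft α β θ z)⁻¹ ∂phase ≤ 2 * lyap α β z := by
  have h := neg_two_mul_integral_mLeft α β hz
  rw [neg_mul, ← mul_neg, ← lyap_eq_mLeft α β hz] at h
  rw [h, ← integral_const_mul]
  refine integral_mono ((integrable_inv_imLeft α β hz).const_mul _)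
    ((integrable_log_im_add_mLeft α β hz).sub (integrable_log_im_mLeft α β hz)) fun θ => ?_
  exact div_le_log_add_sub_log (mLeft_im_pos (circleV_mem α β θ) hz) hz

/-- The square of the hyperbolic defect of reflectionlessness. -/
noncomputable def defectSq (θ : ℝ) (z : ℂ) : ℝ :=
  1 - 4 * (imRight α β θ z * imLeft α β θ z) / ‖twoDen α β θ z z‖ ^ 2

theorem measurable_defectSq {X : Type*} [MeasurableSpace X] {Θ : X → ℝ} {Z : X → ℂ}
    (hΘ : Measurable Θ) (hZ : Measurable Z) (h : ∀ x, 0 < (Z x).im) :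
    Measurable fun x => defectSq α β (Θ x) (Z x) :=
  measurable_const.sub (((measurable_const.mul ((measurable_imRight α β hΘ hZ h).mul
    (measurable_imLeft α β hΘ hZ h)))).div
    ((measurable_twoDen α β hΘ hZ hZ h h).norm.pow_const 2))

theorem defectSq_mem (θ : ℝ) {z : ℂ} (hz : 0 < z.im) : defectSq α β θ z ∈ Icc (0 : ℝ) 1 := by
  have hx := lt_imRight α β θ hz
  have hy := lt_imLeft α β θ hz
  have hx0 : 0 < imRight α β θ z := by linarith
  have hy0 : 0 < imLeft α β θ z := by linarith
  have hD := norm_pos_iff.mpr (twoDen_ne_zero α β θ hz hz)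
  have h2 : (twoDen α β θ z z).im ≤ ‖twoDen α β θ z z‖ :=
    (le_abs_self _).trans (Complex.abs_im_le_norm _)
  rw [← imRight_add_imLeft] at h2
  rw [defectSq]
  constructor
  · rw [sub_nonneg, div_le_one (by positivity)]
    nlinarith [sq_nonneg (imRight α β θ z - imLeft α β θ z)]
  · have : 0 ≤ 4 * (imRight α β θ z * imLeft α β θ z) / ‖twoDen α β θ z z‖ ^ 2 := by positivity
    linarith

theorem defectSq_div_le (θ : ℝ) {z : ℂ} (hz : 0 < z.im) :
    defectSq α β θ z * (imLeft α β θ z)⁻¹ ≤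
      (imRight α β θ z)⁻¹ + (imLeft α β θ z)⁻¹ - 4 * greenIm α β θ z := by
  have hx := lt_imRight α β θ hz
  have hy := lt_imLeft α β θ hz
  have hx0 : 0 < imRight α β θ z := by linarith
  have hy0 : 0 < imLeft α β θ z := by linarith
  have hD := norm_pos_iff.mpr (twoDen_ne_zero α β θ hz hz)
  have h := (defectSq_mem α β θ hz).1
  have e : (imRight α β θ z)⁻¹ + (imLeft α β θ z)⁻¹ - 4 * greenIm α β θ z =
      defectSq α β θ z * (imLeft α β θ z)⁻¹ + defectSq α β θ z * (imRight α β θ z)⁻¹ := by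
    rw [greenIm_eq, ← imRight_add_imLeft, defectSq]
    field_simp
    ring
  rw [e]
  have : 0 ≤ defectSq α β θ z * (imRight α β θ z)⁻¹ := by positivity
  linarith

theorem integral_defectSq_div_le {z : ℂ} (hz : 0 < z.im) :
    ∫ θ, defectSq α β θ z * (imLeft α β θ z)⁻¹ ∂phase ≤
      4 * (lyap α β z / z.im - meanGreen α β z) := by
  have i1 := integrable_inv_imRight α β hz
  have i2 := integrable_inv_imLeft α β hz
  have i3 := (integrable_greenIm α β hz).const_mul 4
  have i0 : Integrable (fun θ => defectSq α β θ z * (imLeft α β θ z)⁻¹) phase := by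
    refine integrable_phase ((measurable_defectSq α β measurable_id measurable_const
      fun _ => hz).mul (measurable_imLeft α β measurable_id measurable_const fun _ => hz).inv)
      (C := 1 * (2 * z.im⁻¹)) fun θ => ?_
    rw [abs_mul, abs_of_nonneg (defectSq_mem α β θ hz).1]
    exact mul_le_mul (defectSq_mem α β θ hz).2 (inv_le_of_half_lt hz (lt_imLeft α β θ hz))
      (abs_nonneg _) zero_le_one
  have h := integral_mono i0 ((i1.add i2).sub i3) (defectSq_div_le α β · hz)
  have e : ∫ θ, ((imRight α β θ z)⁻¹ + (imLeft α β θ z)⁻¹ - 4 * greenIm α β θ z) ∂phase =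
      ∫ θ, (imRight α β θ z)⁻¹ ∂phase + ∫ θ, (imLeft α β θ z)⁻¹ ∂phase
        - 4 * meanGreen α β z := by
    rw [meanGreen, ← integral_const_mul, ← integral_add i1 i2]
    exact integral_sub (i1.add i2) i3
  refine (h.trans_eq e).trans ?_
  have h1 := integral_inv_imRight_le α β hz
  have h2 := integral_inv_imLeft_le α β hz
  rw [mul_comm, ← le_div_iff₀ hz] at h1 h2
  have : 2 * lyap α β z / z.im = 2 * (lyap α β z / z.im) := by ring
  linarith

end Circle

/-! ### Arguments of points of the upper half plane -/

theorem abs_arg_sub_arg_mul_le {w₁ w₂ : ℂ} (h₁ : 0 < w₁.im) (h₂ : 0 < w₂.im) :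
    |w₁.arg - w₂.arg| * (‖w₁‖ + ‖w₂‖) ≤ Real.pi * ‖w₁ - w₂‖ := by
  set t := |w₁.arg - w₂.arg| with ht
  have a1 : 0 ≤ w₁.arg := Complex.arg_nonneg_iff.mpr h₁.le
  have a2 : 0 ≤ w₂.arg := Complex.arg_nonneg_iff.mpr h₂.le
  have b1 := Complex.arg_le_pi w₁
  have b2 := Complex.arg_le_pi w₂
  have t0 : 0 ≤ t := abs_nonneg _
  have tpi : t ≤ Real.pi := by rw [ht, abs_le]; constructor <;> linarith
  have hpi := Real.pi_pos
  have n1 : 0 < ‖w₁‖ := norm_pos_iff.mpr (ne_zero_of_im_pos h₁)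
  have n2 : 0 < ‖w₂‖ := norm_pos_iff.mpr (ne_zero_of_im_pos h₂)
  have hs : t / Real.pi ≤ Real.sin (t / 2) := by
    have := Real.mul_le_sin (x := t / 2) (by positivity) (by linarith)
    have e : 2 / Real.pi * (t / 2) = t / Real.pi := by ring
    rwa [e] at this
  have hcos : Real.cos t = 1 - 2 * Real.sin (t / 2) ^ 2 := by
    have := Real.cos_sq' (t / 2)
    have h2 := Real.cos_two_mul (t / 2)
    rw [show 2 * (t / 2) = t by ring] at h2
    linarith
  have hre : w₁.re * w₂.re + w₁.im * w₂.im = ‖w₁‖ * ‖w₂‖ * Real.cos t := by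
    rw [ht, Real.cos_abs, Real.cos_sub, ← Complex.norm_mul_cos_arg w₁,
      ← Complex.norm_mul_cos_arg w₂, ← Complex.norm_mul_sin_arg w₁, ← Complex.norm_mul_sin_arg w₂]
    ring
  have hsq : ‖w₁ - w₂‖ ^ 2 = ‖w₁‖ ^ 2 + ‖w₂‖ ^ 2 - 2 * (‖w₁‖ * ‖w₂‖ * Real.cos t) := by
    rw [← hre, Complex.sq_norm, Complex.sq_norm, Complex.sq_norm]
    simp only [Complex.normSq_apply, Complex.sub_re, Complex.sub_im]
    ring
  have hs0 : 0 ≤ t / Real.pi := by positivity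
  have hmain : (t / Real.pi * (‖w₁‖ + ‖w₂‖)) ^ 2 ≤ ‖w₁ - w₂‖ ^ 2 := by
    have h3 : (t / Real.pi) ^ 2 ≤ Real.sin (t / 2) ^ 2 := by gcongr
    have h4 := Real.sin_sq_le_one (t / 2)
    rw [hsq, hcos, mul_pow]
    nlinarith [mul_le_mul_of_nonneg_right h3 (sq_nonneg (‖w₁‖ + ‖w₂‖)),
      mul_nonneg (sub_nonneg.mpr h4) (sq_nonneg (‖w₁‖ - ‖w₂‖))]
  have h5 := (abs_le_of_sq_le_sq' hmain (norm_nonneg _)).2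
  have e : t * (‖w₁‖ + ‖w₂‖) = Real.pi * (t / Real.pi * (‖w₁‖ + ‖w₂‖)) := by field_simp
  rw [e]
  exact mul_le_mul_of_nonneg_left h5 hpi.le

theorem arg_neg_conj {w : ℂ} (hw : 0 < w.im) :
    (-(starRingEnd ℂ) w).arg = Real.pi - w.arg := by
  have h1 : (-w).arg = w.arg - Real.pi := Complex.arg_neg_eq_arg_sub_pi_of_im_pos hw
  have h2 : -(starRingEnd ℂ) w = (starRingEnd ℂ) (-w) := by simp
  have h3 := Complex.arg_le_pi w
  rw [h2, Complex.arg_conj, if_neg (by rw [h1]; linarith [Real.pi_pos]), h1]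
  ring

/-- The mismatch between the two half lines, measured by arguments. -/
noncomputable def argDefect (ω : ℤ → ℝ) (z : ℂ) : ℝ :=
  (mRight ω z + I).arg - (Real.pi - (mLeft ω z + I).arg)

theorem abs_argDefect_le (α β θ : ℝ) {z : ℂ} (hz : 0 < z.im) (hz1 : z.im ≤ 1) :
    |argDefect (circleV α β θ) z| ≤ Real.pi * √(defectSq α β θ z) + Real.pi / 2 * z.im := by
  have hs := mLeft_im_pos (circleV_mem α β θ) hz
  have ha := le_mRight_im (circleV_mem α β θ) hz
  have hx := lt_imRight α β θ hz
  have hy := lt_imLeft α β θ hz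
  have hD0 := norm_pos_iff.mpr (twoDen_ne_zero α β θ hz hz)
  have hq := defectSq_mem α β θ hz
  have hDdef : twoDen α β θ z z = mLeft (circleV α β θ) z + mRight (circleV α β θ) z := rfl
  have hxdef : imRight α β θ z = (mRight (circleV α β θ) z).im - z.im / 2 := rfl
  have hydef : imLeft α β θ z = (mLeft (circleV α β θ) z).im + z.im / 2 := rfl
  have hqdef : defectSq α β θ z = 1 - 4 * (imRight α β θ z * imLeft α β θ z) /
    ‖twoDen α β θ z z‖ ^ 2 := rfl
  rw [argDefect]
  generalize mLeft (circleV α β θ) z = s at *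
  generalize mRight (circleV α β θ) z = a at *
  generalize twoDen α β θ z z = D at *
  generalize imRight α β θ z = x at *
  generalize imLeft α β θ z = y at *
  generalize defectSq α β θ z = q at *
  generalize z.im = ε at *
  set b : ℂ := -(starRingEnd ℂ) s with hb
  have hbim : b.im = s.im := by simp [hb]
  have hbre : b.re = -s.re := by simp [hb]
  have e1 : (b + I).arg = Real.pi - (s + I).arg := by
    have : b + I = -(starRingEnd ℂ) (s + I) := by simp [hb]; ring
    rw [this, arg_neg_conj (by simp; linarith)]
  have him1 : 0 < (a + I).im := by simp; linarith
  have him2 : 0 < (b + I).im := by simp [hbim]; linarith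
  have harg := abs_arg_sub_arg_mul_le him1 him2
  set a' : ℂ := a - (ε / 2 : ℝ) * I with ha'
  set b' : ℂ := b + (ε / 2 : ℝ) * I with hb'
  have ha're : a'.re = a.re := by simp [ha']
  have ha'im : a'.im = x := by simp [ha', hxdef]
  have hb're : b'.re = -s.re := by simp [hb', hbre]
  have hb'im : b'.im = y := by simp [hb', hbim, hydef]
  have hnorm : ‖a' - b'‖ = √q * ‖D‖ := by
    rw [← sq_eq_sq₀ (norm_nonneg _) (by positivity), mul_pow, Real.sq_sqrt hq.1]
    have h1 : q * ‖D‖ ^ 2 = ‖D‖ ^ 2 - 4 * (x * y) := by rw [hqdef]; field_simp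
    rw [h1, Complex.sq_norm, Complex.sq_norm, Complex.normSq_apply, Complex.normSq_apply, hDdef]
    simp only [Complex.sub_re, Complex.sub_im, Complex.add_re, Complex.add_im, ha're, ha'im,
      hb're, hb'im]
    rw [hxdef, hydef]
    ring
  have hna : ‖a'‖ ≤ ‖a + I‖ := by
    refine (sq_le_sq₀ (norm_nonneg _) (norm_nonneg _)).mp ?_
    rw [Complex.sq_norm, Complex.sq_norm, Complex.normSq_apply, Complex.normSq_apply, ha're, ha'im]
    simp only [Complex.add_re, Complex.add_im, Complex.I_re, Complex.I_im]
    nlinarith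
  have hnb : ‖b'‖ ≤ ‖b + I‖ := by
    refine (sq_le_sq₀ (norm_nonneg _) (norm_nonneg _)).mp ?_
    rw [Complex.sq_norm, Complex.sq_norm, Complex.normSq_apply, Complex.normSq_apply, hb're, hb'im]
    simp only [Complex.add_re, Complex.add_im, Complex.I_re, Complex.I_im, hbre, hbim]
    nlinarith
  have hD : ‖D‖ ≤ ‖a'‖ + ‖b'‖ := by
    have : D = a' + -(starRingEnd ℂ) b' := by
      apply Complex.ext
      · simp only [hDdef, Complex.add_re, Complex.neg_re, Complex.conj_re, ha're, hb're]; ring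
      · simp only [hDdef, Complex.add_im, Complex.neg_im, Complex.conj_im, ha'im, hb'im]
        rw [hxdef, hydef]; ring
    rw [this]
    refine (norm_add_le _ _).trans ?_
    rw [norm_neg, Complex.norm_conj]
  have hdiff : ‖a + I - (b + I)‖ ≤ √q * ‖D‖ + ε := by
    have : a + I - (b + I) = (a' - b') + (ε : ℝ) * I := by
      rw [ha', hb']; push_cast; ring
    rw [this]
    refine (norm_add_le _ _).trans ?_
    rw [hnorm, norm_mul, Complex.norm_I, mul_one, Complex.norm_real, Real.norm_eq_abs,
      abs_of_pos hz]
  have n1 : 1 ≤ ‖a + I‖ := le_trans (by simp; linarith)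
    ((le_abs_self _).trans (Complex.abs_im_le_norm (a + I)))
  have n2 : 1 ≤ ‖b + I‖ := le_trans (by simp [hbim]; linarith)
    ((le_abs_self _).trans (Complex.abs_im_le_norm (b + I)))
  rw [← e1]
  set N := ‖a + I‖ + ‖b + I‖ with hN
  have hN2 : 2 ≤ N := by linarith
  have hpi := Real.pi_pos
  have hsq : 0 ≤ √q := Real.sqrt_nonneg _
  refine le_of_mul_le_mul_right ?_ (show 0 < N by linarith)
  calc _ ≤ Real.pi * ‖a + I - (b + I)‖ := harg
    _ ≤ Real.pi * (√q * N + ε / 2 * N) := by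
        refine mul_le_mul_of_nonneg_left (hdiff.trans (add_le_add ?_ ?_)) hpi.le
        · exact mul_le_mul_of_nonneg_left (by linarith) hsq
        · nlinarith
    _ = _ := by ring

/-! ### Average reflectionlessness along a sequence of energies approaching the real axis -/

theorem mFun_norm_le_one' {v : ℕ → ℝ} (hv : UnitSeq v) {z : ℂ} (hz : 0 < z.im)
    (h : 4 ≤ |z.re| ∨ 1 ≤ z.im) : ‖mFun v z‖ ≤ 1 := by
  rcases h with h | h
  · exact mFun_norm_le_one hv hz h
  · exact (mFun_norm_le hv hz).trans (inv_le_one_of_one_le₀ h)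

theorem differentiableOn_mRight {ω : ℤ → ℝ} (hω : ∀ n, ω n ∈ Icc (0 : ℝ) 1) :
    DifferentiableOn ℂ (mRight ω) {z | 0 < z.im} :=
  ((mFun_differentiableOn (unitSeq_right hω)).add differentiableOn_id).sub_const _

theorem differentiableOn_mLeft {ω : ℤ → ℝ} (hω : ∀ n, ω n ∈ Icc (0 : ℝ) 1) :
    DifferentiableOn ℂ (mLeft ω) {z | 0 < z.im} := mFun_differentiableOn (unitSeq_left hω)

section Circle

variable (α β : ℝ)

theorem differentiableOn_neg_inv_twoDen (θ : ℝ) :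
    DifferentiableOn ℂ (fun z => -(twoDen α β θ z z)⁻¹) {z | 0 < z.im} :=
  (((differentiableOn_mLeft (circleV_mem α β θ)).add
    (differentiableOn_mRight (circleV_mem α β θ))).inv
      fun _ hz => twoDen_ne_zero α β θ hz hz).neg

theorem one_le_norm_twoDen (θ : ℝ) {z : ℂ} (hz : 0 < z.im) (h : 4 ≤ |z.re| ∨ 1 ≤ z.im) :
    1 ≤ ‖twoDen α β θ z z‖ := by
  rcases h with h | h
  · have e1 : ‖mLeft (circleV α β θ) z‖ ≤ 1 :=
      mFun_norm_le_one (unitSeq_left (circleV_mem α β θ)) hz h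
    have e2 : ‖mPlus α β (θ + α) z‖ ≤ 1 := mFun_norm_le_one (unitSeq_fwd (circleV_mem α β _)) hz h
    have e3 := circleV_mem α β θ 0
    have e4 : ‖(circleV α β θ 0 : ℂ)‖ ≤ 1 := by
      rw [Complex.norm_real, Real.norm_eq_abs, abs_le]; exact ⟨by linarith [e3.1], e3.2⟩
    have e5 : z = twoDen α β θ z z - mLeft (circleV α β θ) z - mPlus α β (θ + α) z
        + circleV α β θ 0 := by rw [twoDen, mRight_eq]; ring
    have e6 := h.trans (Complex.abs_re_le_norm z)
    have e7 : ‖z‖ ≤ ‖twoDen α β θ z z‖ + ‖mLeft (circleV α β θ) z‖ + ‖mPlus α β (θ + α) z‖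
        + ‖(circleV α β θ 0 : ℂ)‖ := by
      conv_lhs => rw [e5]
      exact (norm_add_le _ _).trans (add_le_add_left ((norm_sub_le _ _).trans
        (add_le_add_left (norm_sub_le _ _) _)) _)
    linarith
  · exact h.trans ((lt_twoDen_im α β θ hz hz).le.trans
      ((le_abs_self _).trans (Complex.abs_im_le_norm _)))

theorem integral_greenIm_le (θ : ℝ) {M ε : ℝ} (hM : 4 ≤ M) (hε : 0 < ε) (hε1 : ε ≤ 1) :
    ∫ E in (-M)..M, greenIm α β θ (epoint E ε) ≤ 2 * M + 2 := by
  refine integral_im_le_of_norm_le_one (differentiableOn_neg_inv_twoDen α β θ) (by linarith)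
    (fun z hz h => ?_) hε hε1
  rw [norm_neg, norm_inv]
  exact inv_le_one_of_one_le₀ (one_le_norm_twoDen α β θ hz (h.imp_left hM.trans))

theorem integral_imLeft_le (θ : ℝ) {M ε : ℝ} (hM : 4 ≤ M) (hε : 0 < ε) (hε1 : ε ≤ 1) :
    ∫ E in (-M)..M, imLeft α β θ (epoint E ε) ≤ 3 * M + 2 := by
  have h := integral_im_le_of_norm_le_one (differentiableOn_mLeft (circleV_mem α β θ))
    (show (0 : ℝ) ≤ M by linarith) (fun z hz h =>
      mFun_norm_le_one' (unitSeq_left (circleV_mem α β θ)) hz (h.imp_left hM.trans)) hε hε1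
  simp only [imLeft, epoint_im]
  rw [intervalIntegral.integral_add _ (by simp)]
  · simp only [intervalIntegral.integral_const, smul_eq_mul]
    nlinarith
  · exact (Complex.continuous_im.comp
      (continuous_comp_epoint (differentiableOn_mLeft (circleV_mem α β θ)) hε)).intervalIntegrable
        _ _

end Circle

theorem integrable_uncurry {μ : Measure ℝ} [IsFiniteMeasure μ] {f : ℝ → ℝ → ℝ} {B : ℝ}
    (hm : Measurable (Function.uncurry f)) (hB : ∀ E θ, |f E θ| ≤ B) :
    Integrable (Function.uncurry f) (μ.prod phase) :=
  Integrable.of_bound hm.aestronglyMeasurable B (Eventually.of_forall fun x => hB x.1 x.2)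

theorem integral_integral_phase_le {f : ℝ → ℝ → ℝ} {B C M : ℝ} {S : Set ℝ}
    (hS : S ⊆ Ioc (-M) M) (hM : 0 ≤ M) (hm : Measurable (Function.uncurry f))
    (h0 : ∀ E θ, 0 ≤ f E θ) (hB : ∀ E θ, f E θ ≤ B)
    (hC : ∀ θ, ∫ E in (-M)..M, f E θ ≤ C) :
    ∫ E in S, ∫ θ, f E θ ∂phase ≤ C := by
  have hfin : volume S < ⊤ := (measure_mono hS).trans_lt (by simp)
  have : IsFiniteMeasure (volume.restrict S) := ⟨by simpa using hfin⟩
  have hi := integrable_uncurry (μ := volume.restrict S) hm fun E θ => by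
    rw [abs_of_nonneg (h0 E θ)]; exact hB E θ
  rw [integral_integral_swap hi]
  have hle : ∀ θ, ∫ E in S, f E θ ≤ C := by
    intro θ
    refine le_trans ?_ (hC θ)
    rw [intervalIntegral.integral_of_le (by linarith)]
    refine setIntegral_mono_set ?_ (Eventually.of_forall (h0 · θ)) hS.eventuallyLE
    refine Integrable.of_bound (Measurable.aestronglyMeasurable ?_) B
      (Eventually.of_forall fun E => ?_)
    · exact hm.comp (measurable_id.prodMk measurable_const)
    · rw [Real.norm_eq_abs, abs_of_nonneg (h0 E θ)]; exact hB E θ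
  calc _ ≤ ∫ _, C ∂phase := integral_mono hi.integral_prod_right (integrable_const C) hle
    _ = C := by simp

section Circle

variable {α β : ℝ}

theorem measurable_epoint_fst (ε : ℝ) : Measurable fun x : ℝ × ℝ => epoint x.1 ε :=
  ((continuous_epoint_left ε).comp continuous_fst).measurable

theorem measurable_lyap {ε : ℝ} (hε : 0 < ε) : Measurable fun E => lyap α β (epoint E ε) := by
  have hm : Measurable fun x : ℝ × ℝ => Real.log ‖mPlus α β x.2 (epoint x.1 ε)‖ :=
    (measurable_mPlus α β measurable_snd (measurable_epoint_fst ε) fun _ => by simpa).norm.log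
  exact (hm.stronglyMeasurable.integral_prod_right (ν := phase)).measurable.neg

theorem measurable_greenIm_epoint {ε : ℝ} (hε : 0 < ε) :
    Measurable (Function.uncurry fun E θ => greenIm α β θ (epoint E ε)) :=
  measurable_greenIm α β measurable_snd (measurable_epoint_fst ε) fun _ => by simpa

theorem measurable_meanGreen {ε : ℝ} (hε : 0 < ε) :
    Measurable fun E => meanGreen α β (epoint E ε) :=
  ((measurable_greenIm_epoint hε).stronglyMeasurable.integral_prod_right (ν := phase)).measurable

theorem meanGreen_nonneg {z : ℂ} (hz : 0 < z.im) : 0 ≤ meanGreen α β z :=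
  integral_nonneg fun θ => (greenIm_pos α β θ hz).le

theorem meanGreen_le {z : ℂ} (hz : 0 < z.im) : meanGreen α β z ≤ z.im⁻¹ := by
  calc _ ≤ ∫ _, z.im⁻¹ ∂phase := integral_mono (integrable_greenIm α β hz) (integrable_const _)
        fun θ => greenIm_le α β θ hz
    _ = _ := by simp

theorem norm_epoint_le {M E ε : ℝ} (hE : E ∈ Ioc (-M) M) (h0 : 0 ≤ ε) (h1 : ε ≤ 1) :
    ‖epoint E ε‖ ≤ M + 1 := by
  refine (norm_add_le _ _).trans (add_le_add ?_ ?_)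
  · rw [Complex.norm_real, Real.norm_eq_abs, abs_le]; exact ⟨hE.1.le, hE.2⟩
  · rw [norm_mul, Complex.norm_I, mul_one, Complex.norm_real, Real.norm_eq_abs, abs_of_nonneg h0]
    exact h1

theorem abs_lyap_le {M E ε : ℝ} (hE : E ∈ Ioc (-M) M) (h0 : 0 < ε) (h1 : ε ≤ 1) :
    |lyap α β (epoint E ε)| ≤ Real.log 2 + Real.log (M + 1 + 2) := by
  have hz : 0 < (epoint E ε).im := by simpa
  rw [abs_of_nonneg (lyap_nonneg α β hz)]
  refine (lyap_le α β hz).trans (add_le_add_right (Real.log_le_log (by positivity) ?_) _)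
  linarith [norm_epoint_le hE h0.le h1]

theorem hasDerivAt_integral_lyap {S : Set ℝ} {M ε : ℝ} (hSm : MeasurableSet S)
    (hS : S ⊆ Ioc (-M) M) (hε : 0 < ε) (hε1 : ε < 1) :
    HasDerivAt (fun e => ∫ E in S, lyap α β (epoint E e))
      (∫ E in S, meanGreen α β (epoint E ε)) ε := by
  have hfin : volume S < ⊤ := (measure_mono hS).trans_lt (by simp)
  have : IsFiniteMeasure (volume.restrict S) := ⟨by simpa using hfin⟩
  have hb : Integrable (fun _ : ℝ => 2 / ε) (volume.restrict S) := integrable_const _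
  refine (hasDerivAt_integral_of_dominated_loc_of_deriv_le (s := Ioi (ε / 2))
    (F := fun e E => lyap α β (epoint E e)) (F' := fun e E => meanGreen α β (epoint E e))
    (bound := fun _ => 2 / ε) (Ioi_mem_nhds (half_lt_self hε)) ?_ ?_ ?_ ?_ hb ?_).2
  · filter_upwards [lt_mem_nhds hε] with e he
    exact (measurable_lyap he).aestronglyMeasurable
  · refine Integrable.of_bound (measurable_lyap hε).aestronglyMeasurable
      (Real.log 2 + Real.log (M + 1 + 2)) ?_
    filter_upwards [ae_restrict_mem hSm] with E hE
    exact abs_lyap_le (hS hE) hε hε1.le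
  · exact (measurable_meanGreen hε).aestronglyMeasurable
  · refine Eventually.of_forall fun E e he => ?_
    have he' : ε / 2 < e := he
    have hz : 0 < (epoint E e).im := by simp; linarith
    rw [Real.norm_eq_abs, abs_of_nonneg (meanGreen_nonneg hz)]
    refine (meanGreen_le hz).trans ?_
    rw [epoint_im, ← inv_div]
    exact inv_anti₀ (by positivity) he'.le
  · refine Eventually.of_forall fun E e he => ?_
    have he' : ε / 2 < e := he
    exact hasDerivAt_lyap α β E (by linarith)

theorem tendsto_integral_lyap {S : Set ℝ} {M : ℝ} (hSm : MeasurableSet S)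
    (hS : S ⊆ Ioc (-M) M)
    (h : ∀ E ∈ S, Tendsto (fun ε => lyap α β (epoint E ε)) (𝓝[>] 0) (𝓝 0)) :
    Tendsto (fun ε => ∫ E in S, lyap α β (epoint E ε)) (𝓝[>] 0) (𝓝 0) := by
  have hfin : volume S < ⊤ := (measure_mono hS).trans_lt (by simp)
  have : IsFiniteMeasure (volume.restrict S) := ⟨by simpa using hfin⟩
  have h1 : ∀ᶠ ε in 𝓝[>] (0 : ℝ), ε < 1 := nhdsWithin_le_nhds (eventually_lt_nhds one_pos)
  rw [show (0 : ℝ) = ∫ E in S, 0 by simp]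
  refine tendsto_integral_filter_of_dominated_convergence
    (fun _ => Real.log 2 + Real.log (M + 1 + 2)) ?_ ?_ (integrable_const _) ?_
  · filter_upwards [self_mem_nhdsWithin] with ε hε
    simp only [integral_zero, mem_Ioi] at hε
    exact (measurable_lyap hε).aestronglyMeasurable
  · simp only [integral_zero]
    filter_upwards [self_mem_nhdsWithin, h1] with ε hε hε1
    filter_upwards [ae_restrict_mem hSm] with E hE
    exact abs_lyap_le (hS hE) hε hε1.le
  · simp only [integral_zero]
    filter_upwards [ae_restrict_mem hSm] with E hE
    exact h E hE

theorem sqrt_le_half_add {q y K : ℝ} (hq : 0 ≤ q) (hy : 0 < y) (hK : 0 < K) :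
    √q ≤ 1 / 2 * (K * (q * y⁻¹) + K⁻¹ * y) := by
  have h : 0 ≤ (√(K * y⁻¹) * √q - √(K⁻¹ * y)) ^ 2 := sq_nonneg _
  have h1 : √(K * y⁻¹) * √(K⁻¹ * y) = 1 := by
    rw [← Real.sqrt_mul (by positivity)]
    rw [show K * y⁻¹ * (K⁻¹ * y) = 1 by field_simp, Real.sqrt_one]
  have h2 := Real.sq_sqrt (show 0 ≤ K * y⁻¹ by positivity)
  have h3 := Real.sq_sqrt (show 0 ≤ K⁻¹ * y by positivity)
  have h4 := Real.sq_sqrt hq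
  have h5 : (√(K * y⁻¹) * √q - √(K⁻¹ * y)) ^ 2 =
      √(K * y⁻¹) ^ 2 * √q ^ 2 - 2 * √q * (√(K * y⁻¹) * √(K⁻¹ * y)) + √(K⁻¹ * y) ^ 2 := by ring
  rw [h5, h1, h2, h3, h4] at h
  nlinarith

theorem measurable_argDefect {ε : ℝ} (hε : 0 < ε) :
    Measurable (Function.uncurry fun E θ => argDefect (circleV α β θ) (epoint E ε)) :=
  (Complex.measurable_arg.comp ((measurable_mRight α β measurable_snd (measurable_epoint_fst ε)
    fun _ => by simpa).add_const I)).sub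
    (measurable_const.sub (Complex.measurable_arg.comp ((measurable_mLeft α β measurable_snd
      (measurable_epoint_fst ε) fun _ => by simpa).add_const I)))

theorem abs_argDefect_le_const (ω : ℤ → ℝ) (z : ℂ) : |argDefect ω z| ≤ 3 * Real.pi := by
  have h1 := Complex.abs_arg_le_pi (mRight ω z + I)
  have h2 := Complex.abs_arg_le_pi (mLeft ω z + I)
  have := Real.pi_pos
  rw [abs_le] at *
  rw [argDefect]
  constructor <;> linarith

/-- The bound of the averaged mismatch at height `ε` by the defect of the Kotani inequality. -/
theorem integral_argDefect_le {S : Set ℝ} {M ε K : ℝ} (hSm : MeasurableSet S)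
    (hS : S ⊆ Ioc (-M) M) (hM : 4 ≤ M) (hε : 0 < ε) (hε1 : ε < 1) (hK : 0 < K) :
    ∫ θ, |∫ E in S, argDefect (circleV α β θ) (epoint E ε)| ∂phase ≤
      Real.pi / 2 * (K * (4 * ((∫ E in S, lyap α β (epoint E ε)) / ε
        - ∫ E in S, meanGreen α β (epoint E ε))) + K⁻¹ * (3 * M + 2) + 2 * M * ε) := by
  have hfin : volume S < ⊤ := (measure_mono hS).trans_lt (by simp)
  have : IsFiniteMeasure (volume.restrict S) := ⟨by simpa using hfin⟩
  have hz : ∀ E, 0 < (epoint E ε).im := fun E => by simpa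
  have hpi := Real.pi_pos
  set μ := volume.restrict S with hμ
  set f : ℝ → ℝ → ℝ := fun E θ => argDefect (circleV α β θ) (epoint E ε)
  set q : ℝ → ℝ → ℝ := fun E θ => defectSq α β θ (epoint E ε)
  set y : ℝ → ℝ → ℝ := fun E θ => imLeft α β θ (epoint E ε)
  have hy0 : ∀ E θ, ε / 2 < y E θ := fun E θ => by
    have := lt_imLeft α β θ (hz E)
    simpa using this
  have hyB : ∀ E θ, y E θ ≤ ε⁻¹ + ε / 2 := fun E θ => by
    have h1 : ‖mLeft (circleV α β θ) (epoint E ε)‖ ≤ _ :=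
      mFun_norm_le (unitSeq_left (circleV_mem α β θ)) (hz E)
    have h2 := (le_abs_self _).trans (Complex.abs_im_le_norm (mLeft (circleV α β θ) (epoint E ε)))
    simp only [epoint_im] at h1
    simp only [y, imLeft, epoint_im]
    linarith
  have hqm : ∀ E θ, q E θ ∈ Icc (0 : ℝ) 1 := fun E θ => defectSq_mem α β θ (hz E)
  have my : Measurable (Function.uncurry y) :=
    measurable_imLeft α β measurable_snd (measurable_epoint_fst ε) fun _ => hz _
  have mq : Measurable (Function.uncurry q) :=
    measurable_defectSq α β measurable_snd (measurable_epoint_fst ε) fun _ => hz _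
  have mqy : Measurable (Function.uncurry fun E θ => q E θ * (y E θ)⁻¹) := mq.mul my.inv
  have if' := integrable_uncurry (μ := μ) (measurable_argDefect (α := α) (β := β) hε)
    (fun E θ => abs_argDefect_le_const _ _)
  have iy := integrable_uncurry (μ := μ) my (B := ε⁻¹ + ε / 2) fun E θ => by
    rw [abs_of_pos (by linarith [hy0 E θ])]; exact hyB E θ
  have iqy := integrable_uncurry (μ := μ) mqy (B := 1 * (2 * ε⁻¹)) fun E θ => by
    rw [abs_mul, abs_of_nonneg (hqm E θ).1]
    exact mul_le_mul (hqm E θ).2 (inv_le_of_half_lt hε (hy0 E θ)) (abs_nonneg _) zero_le_one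
  have s1 : ∫ θ, |∫ E in S, f E θ| ∂phase ≤ ∫ θ, (∫ E in S, |f E θ|) ∂phase := by
    refine integral_mono if'.integral_prod_right.abs if'.abs.integral_prod_right fun θ => ?_
    exact abs_integral_le_integral_abs
  have s2 : ∫ θ, (∫ E in S, |f E θ|) ∂phase = ∫ x, |Function.uncurry f x| ∂(μ.prod phase) :=
    (integral_prod_symm _ if'.abs).symm
  have s3 : ∫ x, |Function.uncurry f x| ∂(μ.prod phase) ≤
      ∫ x, Real.pi / 2 * (K * (Function.uncurry (fun E θ => q E θ * (y E θ)⁻¹) x)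
        + K⁻¹ * Function.uncurry y x + ε) ∂(μ.prod phase) := by
    refine integral_mono if'.abs
      ((((iqy.const_mul K).add (iy.const_mul K⁻¹)).add (integrable_const ε)).const_mul _) ?_
    rintro ⟨E, θ⟩
    have h1 := abs_argDefect_le α β θ (hz E) (by simpa using hε1.le)
    have h2 := sqrt_le_half_add (hqm E θ).1 (show 0 < y E θ by linarith [hy0 E θ]) hK
    have h3 := mul_le_mul_of_nonneg_left h2 hpi.le
    simp only [epoint_im] at h1
    simp only [Function.uncurry]
    refine h1.trans ?_
    calc _ ≤ Real.pi * (1 / 2 * (K * (q E θ * (y E θ)⁻¹) + K⁻¹ * y E θ)) + Real.pi / 2 * ε :=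
          add_le_add_left h3 _
      _ = _ := by ring
  have s4 : ∫ x, Real.pi / 2 * (K * (Function.uncurry (fun E θ => q E θ * (y E θ)⁻¹) x)
        + K⁻¹ * Function.uncurry y x + ε) ∂(μ.prod phase) =
      Real.pi / 2 * (K * (∫ E in S, ∫ θ, q E θ * (y E θ)⁻¹ ∂phase)
        + K⁻¹ * (∫ E in S, ∫ θ, y E θ ∂phase) + ∫ _, ε ∂(μ.prod phase)) := by
    rw [integral_const_mul]
    have a1 := integral_add ((iqy.const_mul K).add (iy.const_mul K⁻¹))
      (integrable_const (μ := μ.prod phase) ε)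
    have a2 := integral_add (iqy.const_mul K) (iy.const_mul K⁻¹)
    simp only [Pi.add_apply] at a1
    rw [a1, a2, integral_const_mul, integral_const_mul, integral_prod _ iqy, integral_prod _ iy]
    rfl
  have s5 : ∫ E in S, ∫ θ, q E θ * (y E θ)⁻¹ ∂phase ≤
      4 * ((∫ E in S, lyap α β (epoint E ε)) / ε - ∫ E in S, meanGreen α β (epoint E ε)) := by
    have il : Integrable (fun E => lyap α β (epoint E ε)) μ := by
      refine Integrable.of_bound (measurable_lyap hε).aestronglyMeasurable
        (Real.log 2 + Real.log (M + 1 + 2)) ?_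
      filter_upwards [ae_restrict_mem hSm] with E hE
      exact abs_lyap_le (hS hE) hε hε1.le
    have ig : Integrable (fun E => meanGreen α β (epoint E ε)) μ := by
      refine Integrable.of_bound (measurable_meanGreen hε).aestronglyMeasurable ε⁻¹
        (Eventually.of_forall fun E => ?_)
      rw [Real.norm_eq_abs, abs_of_nonneg (meanGreen_nonneg (hz E))]
      simpa using meanGreen_le (hz E)
    rw [← integral_div, ← integral_sub (il.div_const ε) ig, ← integral_const_mul]
    refine integral_mono iqy.integral_prod_left (((il.div_const ε).sub ig).const_mul 4) fun E => ?_
    have := integral_defectSq_div_le α β (hz E)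
    simpa using this
  have s6 : ∫ E in S, ∫ θ, y E θ ∂phase ≤ 3 * M + 2 :=
    integral_integral_phase_le hS (by linarith) my (fun E θ => by linarith [hy0 E θ]) hyB
      fun θ => integral_imLeft_le α β θ hM hε hε1.le
  have s7 : ∫ _, ε ∂(μ.prod phase) ≤ 2 * M * ε := by
    rw [integral_const, smul_eq_mul]
    refine mul_le_mul_of_nonneg_right ?_ hε.le
    have hv : (μ.prod phase).real univ = volume.real S := by
      rw [← univ_prod_univ, measureReal_prod_prod]
      simp [hμ]
    rw [hv]
    calc volume.real S ≤ volume.real (Ioc (-M) M) := measureReal_mono hS (by simp)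
      _ = 2 * M := by
        rw [Real.volume_real_Ioc_of_le (by linarith)]; ring
  refine s1.trans (s2.le.trans (s3.trans (s4.le.trans ?_)))
  have hKi : 0 < K⁻¹ := inv_pos.mpr hK
  refine mul_le_mul_of_nonneg_left (add_le_add (add_le_add ?_ ?_) s7) (by positivity)
  · exact mul_le_mul_of_nonneg_left s5 hK.le
  · exact mul_le_mul_of_nonneg_left s6 hKi.le

theorem exists_integral_argDefect_le {S : Set ℝ} {M : ℝ} (hSm : MeasurableSet S)
    (hS : S ⊆ Ioc (-M) M) (hM : 4 ≤ M)
    (h : ∀ E ∈ S, Tendsto (fun ε => lyap α β (epoint E ε)) (𝓝[>] 0) (𝓝 0)) {e η : ℝ}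
    (he : 0 < e) (hη : 0 < η) :
    ∃ ε, 0 < ε ∧ ε < η ∧ ε < 1 ∧
      ∫ θ, |∫ E in S, argDefect (circleV α β θ) (epoint E ε)| ∂phase ≤ e := by
  have hpi := Real.pi_pos
  have hM0 : 0 < M := by linarith
  set K : ℝ := 3 * Real.pi * (3 * M + 2) / (2 * e) with hK
  have hK0 : 0 < K := by positivity
  set c : ℝ := e / (6 * Real.pi * K) with hc
  have hc0 : 0 < c := by positivity
  set η' : ℝ := min (min η 1) (e / (3 * Real.pi * M)) with hη'
  have hη'0 : 0 < η' := by positivity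
  have hbd : ∀ ε, 0 < ε → ε < 1 → ∫ E in S, meanGreen α β (epoint E ε) ≤ 2 * M + 2 := by
    intro ε hε hε1
    exact integral_integral_phase_le hS hM0.le (measurable_greenIm_epoint hε)
      (fun E θ => (greenIm_pos α β θ (by simpa)).le) (B := ε⁻¹)
      (fun E θ => by simpa using greenIm_le α β θ (z := epoint E ε) (by simpa))
      fun θ => integral_greenIm_le α β θ hM hε hε1.le
  obtain ⟨ε, hε, hεη, hlt⟩ := exists_div_sub_deriv_lt
    (fun ε hε hε1 => hasDerivAt_integral_lyap (α := α) (β := β) hSm hS hε hε1)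
    (tendsto_integral_lyap hSm hS h) hbd hc0 hη'0
  have h1 : ε < η := hεη.trans_le ((min_le_left _ _).trans (min_le_left _ _))
  have h2 : ε < 1 := hεη.trans_le ((min_le_left _ _).trans (min_le_right _ _))
  have h3 : ε < e / (3 * Real.pi * M) := hεη.trans_le (min_le_right _ _)
  refine ⟨ε, hε, h1, h2, (integral_argDefect_le hSm hS hM hε h2 hK0).trans ?_⟩
  have t1 : Real.pi / 2 * (K * (4 * c)) = e / 3 := by rw [hc]; field_simp; norm_num
  have t2 : Real.pi / 2 * (K⁻¹ * (3 * M + 2)) = e / 3 := by rw [hK]; field_simp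
  have t3 : Real.pi / 2 * (2 * M * (e / (3 * Real.pi * M))) = e / 3 := by field_simp
  have u1 := mul_le_mul_of_nonneg_left
    (mul_le_mul_of_nonneg_left (mul_le_mul_of_nonneg_left hlt.le (show (0 : ℝ) ≤ 4 by norm_num))
      hK0.le) (show 0 ≤ Real.pi / 2 by positivity)
  have u3 := mul_le_mul_of_nonneg_left
    (mul_le_mul_of_nonneg_left h3.le (show (0 : ℝ) ≤ 2 * M by positivity))
      (show 0 ≤ Real.pi / 2 by positivity)
  rw [mul_add, mul_add]
  linarith

end Circle

/-! ### Uniformity of the boundary behaviour of the arguments -/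

theorem tendsto_setIntegral_of_intervals {ι : Type*} {l : Filter ι} {f : ι → ℝ → ℝ} {C M : ℝ}
    (hM : 0 ≤ M) (hm : ∀ i, Measurable (f i)) (hC : ∀ i E, |f i E| ≤ C)
    (h : ∀ b ∈ Icc (-M) M, Tendsto (fun i => ∫ E in Ioc (-M) b, f i E) l (𝓝 0))
    {S : Set ℝ} (hS : MeasurableSet S) :
    Tendsto (fun i => ∫ E in S ∩ Ioc (-M) M, f i E) l (𝓝 0) := by
  have hint : ∀ i, IntegrableOn (f i) (Ioc (-M) M) := fun i =>
    Measure.integrableOn_of_bounded (M := C) (by simp) (hm i).aestronglyMeasurable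
      (Eventually.of_forall (hC i))
  induction S, hS using MeasurableSpace.induction_on_inter
    ((BorelSpace.measurable_eq (α := ℝ)).trans (borel_eq_generateFrom_Iic ℝ)) isPiSystem_Iic with
  | empty => simpa using tendsto_const_nhds
  | basic t ht =>
    obtain ⟨a, rfl⟩ := ht
    have : Iic a ∩ Ioc (-M) M = Ioc (-M) (min a M) := by
      ext x; simp only [mem_inter_iff, mem_Iic, mem_Ioc, le_min_iff]; tauto
    rw [this]
    rcases le_total (-M) (min a M) with h1 | h1
    · exact h _ ⟨h1, min_le_right _ _⟩
    · simpa [Ioc_eq_empty_of_le h1] using tendsto_const_nhds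
  | compl t ht ih =>
    have h1 := (h M ⟨by linarith, le_rfl⟩).sub ih
    rw [sub_zero] at h1
    refine h1.congr fun i => ?_
    have := integral_inter_add_sdiff (f := f i) (s := Ioc (-M) M) ht (hint i)
    rw [inter_comm, ← this, inter_comm tᶜ, ← Set.sdiff_eq]
    ring
  | iUnion g hd hg ih =>
    have key : ∀ i, ∫ E in (⋃ n, g n) ∩ Ioc (-M) M, f i E =
        ∑' n, ∫ E in g n ∩ Ioc (-M) M, f i E := by
      intro i
      rw [iUnion_inter]
      refine integral_iUnion (fun n => (hg n).inter measurableSet_Ioc) (fun a b hab =>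
        (hd hab).mono inter_subset_left inter_subset_left) ?_
      exact (hint i).mono_set (iUnion_subset fun n => inter_subset_right)
    simp only [key]
    rw [show (0 : ℝ) = ∑' _ : ℕ, (0 : ℝ) by simp]
    refine tendsto_tsum_of_dominated_convergence
      (bound := fun n => C * volume.real (g n ∩ Ioc (-M) M)) ?_ ih ?_
    · refine Summable.mul_left _ ?_
      refine ENNReal.summable_toReal ?_
      rw [← measure_iUnion (fun a b hab => (hd hab).mono inter_subset_left inter_subset_left)
        fun n => (hg n).inter measurableSet_Ioc]
      exact ((measure_mono (iUnion_subset fun n => inter_subset_right)).trans_lt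
        (show volume (Ioc (-M) M) < ⊤ by simp)).ne
    · refine Eventually.of_forall fun i n => ?_
      exact norm_setIntegral_le_of_norm_le_const
        ((measure_mono inter_subset_right).trans_lt (by simp)) fun x _ => hC i x

theorem norm_log_add_I_le {a : ℂ} {y C : ℝ} (ha : 0 < a.im) (hy : 0 < y) (hy1 : y ≤ 1)
    (h : ‖a‖ ≤ C / y) : ‖Complex.log (a + I)‖ ≤ (2 * √(C + 1) + Real.pi) * y ^ (-(1 / 2) : ℝ) := by
  have h0 : 1 ≤ ‖a + I‖ := by
    have : 1 ≤ (a + I).im := by simp [ha.le]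
    exact this.trans ((le_abs_self _).trans (Complex.abs_im_le_norm _))
  have hC : 0 ≤ C := by
    have := (norm_nonneg a).trans h
    by_contra hn
    exact absurd this (not_le.2 (div_neg_of_neg_of_pos (not_le.1 hn) hy))
  have h1 : ‖a + I‖ ≤ (C + 1) / y := by
    refine (norm_add_le _ _).trans ?_
    rw [add_div, Complex.norm_I]
    exact add_le_add h ((one_le_div hy).2 hy1)
  have h2 : Real.log ‖a + I‖ ≤ 2 * √(C + 1) * y ^ (-(1 / 2) : ℝ) := by
    have e1 : √((C + 1) / y) = √(C + 1) * y ^ (-(1 / 2) : ℝ) := by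
      rw [Real.sqrt_div (by linarith), Real.rpow_neg hy.le, ← Real.sqrt_eq_rpow, div_eq_mul_inv]
    have e2 : Real.log ((C + 1) / y) = 2 * Real.log √((C + 1) / y) := by
      rw [Real.log_sqrt (by positivity)]; ring
    have e3 := Real.log_le_sub_one_of_pos (show 0 < √((C + 1) / y) by positivity)
    have e4 := Real.log_le_log (by linarith) h1
    rw [mul_assoc, ← e1]
    linarith
  have h3 : 1 ≤ y ^ (-(1 / 2) : ℝ) := Real.one_le_rpow_of_pos_of_le_one_of_nonpos hy hy1
    (by norm_num)
  have h4 := Complex.norm_le_abs_re_add_abs_im (Complex.log (a + I))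
  rw [Complex.log_re, Complex.log_im, abs_of_nonneg (Real.log_nonneg h0)] at h4
  have h5 := Complex.abs_arg_le_pi (a + I)
  have h6 : Real.pi * 1 ≤ Real.pi * y ^ (-(1 / 2) : ℝ) :=
    mul_le_mul_of_nonneg_left h3 Real.pi_pos.le
  rw [add_mul]
  linarith

theorem differentiableOn_log_add_I {g : ℂ → ℂ} (hg : DifferentiableOn ℂ g {z | 0 < z.im})
    (h : ∀ z : ℂ, 0 < z.im → 0 < (g z).im) :
    DifferentiableOn ℂ (fun z => Complex.log (g z + I)) {z | 0 < z.im} :=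
  (hg.add_const I).clog fun z hz => Or.inr (by have := h z hz; simp; linarith)

theorem mRight_im_pos {ω : ℤ → ℝ} (hω : ∀ n, ω n ∈ Icc (0 : ℝ) 1) {z : ℂ} (hz : 0 < z.im) :
    0 < (mRight ω z).im := hz.trans_le (le_mRight_im hω hz)

theorem abs_le_one_of_mem {x : ℝ} (hx : x ∈ Icc (0 : ℝ) 1) : ‖(x : ℂ)‖ ≤ 1 := by
  rw [Complex.norm_real, Real.norm_eq_abs, abs_le]; exact ⟨by linarith [hx.1], hx.2⟩

theorem norm_mRight_le {ω : ℤ → ℝ} (hω : ∀ n, ω n ∈ Icc (0 : ℝ) 1) {M E y : ℝ}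
    (hE : E ∈ Icc (-M) M) (hy : 0 < y) (hy1 : y ≤ 1) :
    ‖mRight ω (epoint E y)‖ ≤ (M + 3) / y := by
  have hz : 0 < (epoint E y).im := by simpa
  have h1 := mFun_norm_le (unitSeq_right hω) hz
  rw [epoint_im] at h1
  have h2 : ‖epoint E y‖ ≤ M + 1 := by
    refine (norm_add_le _ _).trans (add_le_add ?_ ?_)
    · rw [Complex.norm_real, Real.norm_eq_abs, abs_le]; exact hE
    · rw [norm_mul, Complex.norm_I, mul_one, Complex.norm_real, Real.norm_eq_abs, abs_of_pos hy]
      exact hy1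
  have h3 := abs_le_one_of_mem (hω 0)
  have hM : 0 ≤ M := by linarith [hE.1, hE.2]
  have h4 : M + 2 ≤ (M + 2) / y := le_div_self (by linarith) hy hy1
  refine (norm_sub_le _ _).trans ((add_le_add_left (norm_add_le _ _) _).trans ?_)
  rw [show (M + 3) / y = (M + 2) / y + y⁻¹ by field_simp; ring]
  linarith

theorem norm_mLeft_le {ω : ℤ → ℝ} (hω : ∀ n, ω n ∈ Icc (0 : ℝ) 1) {M E y : ℝ} (hM : 0 ≤ M)
    (hy : 0 < y) : ‖mLeft ω (epoint E y)‖ ≤ (M + 3) / y := by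
  have hz : 0 < (epoint E y).im := by simpa
  have h1 := mFun_norm_le (unitSeq_left hω) hz
  rw [epoint_im, ← one_div] at h1
  exact h1.trans (div_le_div_of_nonneg_right (by linarith) hy.le)

theorem continuous_argDefect {ω : ℤ → ℝ} (hω : ∀ n, ω n ∈ Icc (0 : ℝ) 1) {ε : ℝ} (hε : 0 < ε) :
    Continuous fun E => argDefect ω (epoint E ε) := by
  have hz : ∀ E, 0 < (epoint E ε).im := fun E => by simpa
  have key : ∀ g : ℂ → ℂ, DifferentiableOn ℂ g {z | 0 < z.im} → (∀ z : ℂ, 0 < z.im → 0 < (g z).im) →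
      Continuous fun E => (g (epoint E ε) + I).arg := fun g hg hp => by
    simp only [← Complex.log_im]
    exact Complex.continuous_im.comp
      (continuous_comp_epoint (differentiableOn_log_add_I hg hp) hε)
  exact (key _ (differentiableOn_mRight hω) fun z => mRight_im_pos hω).sub
    (continuous_const.sub (key _ (differentiableOn_mLeft hω) fun z => mLeft_im_pos hω))

theorem integral_rpow_neg_half_le {B ε η : ℝ} (hε : 0 < ε) (hB : 0 ≤ B) :
    ∫ y in ε..η, B * y ^ (-(1 / 2) : ℝ) ≤ B * (2 * √η) := by
  rw [intervalIntegral.integral_const_mul, integral_rpow (Or.inl (by norm_num))]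
  refine mul_le_mul_of_nonneg_left ?_ hB
  have h1 : (0 : ℝ) ≤ ε ^ ((1 : ℝ) / 2) := by positivity
  rw [Real.sqrt_eq_rpow]
  norm_num at h1 ⊢
  linarith

theorem intervalIntegrable_rpow_neg_half {B ε η : ℝ} (hε : 0 < ε) (hεη : ε ≤ η) :
    IntervalIntegrable (fun y => B * y ^ (-(1 / 2) : ℝ)) volume ε η := by
  refine (intervalIntegral.intervalIntegrable_rpow (Or.inr ?_)).const_mul _
  rw [uIcc_of_le hεη]
  exact fun h => absurd h.1 (not_le.2 hε)

theorem abs_integral_argDefect_sub_le {ω : ℤ → ℝ} (hω : ∀ n, ω n ∈ Icc (0 : ℝ) 1)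
    {M b ε η : ℝ} (hb : b ∈ Icc (-M) M) (hε : 0 < ε) (hεη : ε ≤ η) (hη : η ≤ 1) :
    |∫ E in Ioc (-M) b, (argDefect ω (epoint E ε) - argDefect ω (epoint E η))| ≤
      8 * (2 * √(M + 4) + Real.pi) * √η := by
  have hM : 0 ≤ M := by linarith [hb.1, hb.2]
  set B : ℝ := 2 * √(M + 4) + Real.pi with hB
  have hB0 : 0 ≤ B := by positivity
  have hη0 : 0 < η := hε.trans_le hεη
  set g : ℂ → ℂ := fun z => Complex.log (mRight ω z + I) + Complex.log (mLeft ω z + I) with hg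
  have gd : DifferentiableOn ℂ g {z | 0 < z.im} :=
    (differentiableOn_log_add_I (differentiableOn_mRight hω) fun z => mRight_im_pos hω).add
      (differentiableOn_log_add_I (differentiableOn_mLeft hω) fun z => mLeft_im_pos hω)
  have gim : ∀ z, (g z).im = argDefect ω z + Real.pi := fun z => by
    simp only [hg, Complex.add_im, Complex.log_im, argDefect]; ring
  have gb : ∀ E ∈ Icc (-M) M, ∀ y, ε ≤ y → y ≤ η →
      ‖g (epoint E y)‖ ≤ (2 * B) * y ^ (-(1 / 2) : ℝ) := by
    intro E hE y h1 h2
    have hy := hε.trans_le h1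
    have hz : 0 < (epoint E y).im := by simpa
    have a1 := norm_log_add_I_le (mRight_im_pos hω hz) hy (h2.trans hη)
      (norm_mRight_le hω hE hy (h2.trans hη))
    have a2 := norm_log_add_I_le (mLeft_im_pos hω hz) hy (h2.trans hη)
      (norm_mLeft_le hω (E := E) hM hy)
    rw [show M + 3 + 1 = M + 4 by ring, ← hB] at a1 a2
    refine (norm_add_le _ _).trans ?_
    linarith
  have h1 := norm_integral_epoint_sub_le gd hε hεη
    (intervalIntegrable_rpow_neg_half (B := 2 * B) hε hεη) (gb (-M) ⟨le_rfl, by linarith⟩) (gb b hb)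
  have h2 := integral_rpow_neg_half_le hε (η := η) (show 0 ≤ 2 * B by positivity)
  have h3 : ∀ y, 0 < y → IntervalIntegrable (fun E => (g (epoint E y)).im) volume (-M) b :=
    fun y hy => (Complex.continuous_im.comp (continuous_comp_epoint gd hy)).intervalIntegrable _ _
  have h4 : ∫ E in Ioc (-M) b, (argDefect ω (epoint E ε) - argDefect ω (epoint E η)) =
      ((∫ x in (-M)..b, g (epoint x ε)) - ∫ x in (-M)..b, g (epoint x η)).im := by
    rw [Complex.sub_im, ← integral_im_eq gd hε, ← integral_im_eq gd hη0,
      ← intervalIntegral.integral_sub (h3 ε hε) (h3 η hη0),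
      intervalIntegral.integral_of_le hb.1]
    refine integral_congr_ae (Eventually.of_forall fun E => ?_)
    simp only [gim]; ring
  rw [h4]
  refine (Complex.abs_im_le_norm _).trans (h1.trans ?_)
  linarith

theorem exists_abs_integral_argDefect_sub_le {S : Set ℝ} {M e : ℝ} (hSm : MeasurableSet S)
    (hS : S ⊆ Ioc (-M) M) (hM : 0 ≤ M) (he : 0 < e) :
    ∃ η₀ > 0, ∀ ω : ℤ → ℝ, (∀ n, ω n ∈ Icc (0 : ℝ) 1) → ∀ ε η, 0 < ε → ε ≤ η → η < η₀ →
      |(∫ E in S, argDefect ω (epoint E ε)) - ∫ E in S, argDefect ω (epoint E η)| ≤ e := by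
  have hpi := Real.pi_pos
  let ι := {p : (ℤ → ℝ) × ℝ × ℝ // (∀ n, p.1 n ∈ Icc (0 : ℝ) 1) ∧ 0 < p.2.1 ∧ p.2.1 ≤ p.2.2}
  let f : ι → ℝ → ℝ := fun p E =>
    argDefect p.1.1 (epoint E p.1.2.1) - argDefect p.1.1 (epoint E p.1.2.2)
  let l : Filter ι := comap (fun p => p.1.2.2) (𝓝 0)
  have hl : Tendsto (fun p : ι => p.1.2.2) l (𝓝 0) := tendsto_comap
  have h := tendsto_setIntegral_of_intervals (l := l) (f := f) (C := 6 * Real.pi) hM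
    (fun p => ((continuous_argDefect p.2.1 p.2.2.1).sub
      (continuous_argDefect p.2.1 (p.2.2.1.trans_le p.2.2.2))).measurable)
    (fun p E => by
      have h1 := abs_argDefect_le_const p.1.1 (epoint E p.1.2.1)
      have h2 := abs_argDefect_le_const p.1.1 (epoint E p.1.2.2)
      exact (abs_sub _ _).trans (by linarith)) (fun b hb => by
      have h1 : Tendsto (fun p : ι => 8 * (2 * √(M + 4) + Real.pi) * √(p.1.2.2)) l (𝓝 0) := by
        have := ((Real.continuous_sqrt.tendsto 0).comp hl).const_mul
          (8 * (2 * √(M + 4) + Real.pi))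
        simpa using this
      refine squeeze_zero_norm' ?_ h1
      filter_upwards [hl.eventually (eventually_le_nhds one_pos)] with p hp
      exact abs_integral_argDefect_sub_le p.2.1 hb p.2.2.1 p.2.2.2 hp) hSm
  rw [inter_eq_self_of_subset_left hS] at h
  have h1 := h.eventually (Metric.closedBall_mem_nhds 0 he)
  rw [eventually_comap] at h1
  obtain ⟨η₀, hη₀, h2⟩ := Metric.eventually_nhds_iff.1 h1
  refine ⟨η₀, hη₀, fun ω hω ε η hε hεη hη => ?_⟩
  have hη0 : 0 < η := hε.trans_le hεη
  have h3 := h2 (y := η) (by rw [Real.dist_eq, sub_zero, abs_of_pos hη0]; exact hη)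
    ⟨(ω, ε, η), hω, hε, hεη⟩ rfl
  have hfin : volume S < ⊤ := (measure_mono hS).trans_lt (by simp)
  have hi : ∀ y, 0 < y → IntegrableOn (fun E => argDefect ω (epoint E y)) S := fun y hy =>
    Measure.integrableOn_of_bounded (M := 3 * Real.pi) hfin.ne
      (continuous_argDefect hω hy).aestronglyMeasurable
      (Eventually.of_forall fun E => abs_argDefect_le_const _ _)
  rw [← integral_sub (hi ε hε) (hi η hη0)]
  simpa [f] using h3

/-! ### Vanishing of the spectrum by comparison at the discontinuity -/

theorem exists_mem_Ioo_of_ae_phase {P : ℝ → Prop} (h : ∀ᵐ θ ∂phase, P θ) {a b : ℝ} (hab : a < b)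
    (ha : 0 ≤ a) (hb : b ≤ 1) : ∃ θ ∈ Ioo a b, P θ := by
  by_contra! hn
  have h1 : volume (Ioo a b) = 0 := by
    have h2 : phase (Ioo a b) = 0 := measure_mono_null (fun θ hθ => hn θ hθ) h
    rwa [phase, Measure.restrict_apply measurableSet_Ioo, inter_eq_self_of_subset_left] at h2
    exact fun x hx => ⟨ha.trans_lt hx.1, hx.2.le.trans hb⟩
  rw [Real.volume_Ioo, ENNReal.ofReal_eq_zero] at h1
  linarith

theorem frequently_nhdsGT_of_ae_phase {P : ℝ → Prop} (h : ∀ᵐ θ ∂phase, P θ) {a : ℝ}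
    (ha : a ∈ Ioo (0 : ℝ) 1) : ∃ᶠ θ in 𝓝[>] a, P θ := by
  intro hn
  obtain ⟨u, hu, hs⟩ := mem_nhdsGT_iff_exists_Ioo_subset.1 hn
  obtain ⟨θ, hθ, hP⟩ := exists_mem_Ioo_of_ae_phase h (lt_min hu ha.2) ha.1.le (min_le_right _ _)
  exact hs ⟨hθ.1, hθ.2.trans_le (min_le_left _ _)⟩ hP

theorem frequently_nhdsLT_of_ae_phase {P : ℝ → Prop} (h : ∀ᵐ θ ∂phase, P θ) {a : ℝ}
    (ha : a ∈ Ioo (0 : ℝ) 1) : ∃ᶠ θ in 𝓝[<] a, P θ := by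
  intro hn
  obtain ⟨u, hu, hs⟩ := mem_nhdsLT_iff_exists_Ioo_subset.1 hn
  obtain ⟨θ, hθ, hP⟩ := exists_mem_Ioo_of_ae_phase h (max_lt hu ha.1) (le_max_right _ _) ha.2.le
  exact hs ⟨(le_max_left _ _).trans_lt hθ.1, hθ.2⟩ hP

theorem eventually_circleV_nhdsGT (α : ℝ) {β : ℝ} (hβ : β ∈ Ioo (0 : ℝ) 1) (θ : ℝ) (n : ℤ) :
    ∀ᶠ φ in 𝓝[>] θ, circleV α β φ n = circleV α β θ n := by
  obtain ⟨ε, hε, h⟩ := circleV_right_const α hβ θ n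
  filter_upwards [Ioo_mem_nhdsGT (show θ < θ + ε by linarith)] with φ hφ
  exact h φ hφ.1.le hφ.2

theorem eventually_floor_eq {x : ℝ} (h : ∀ m : ℤ, x ≠ m) : ∀ᶠ y in 𝓝 x, ⌊y⌋ = ⌊x⌋ := by
  filter_upwards [Ioo_mem_nhds (lt_of_le_of_ne (Int.floor_le x) (h _).symm)
    (Int.lt_floor_add_one x)] with y hy
  exact Int.floor_eq_iff.2 ⟨hy.1.le, hy.2⟩

theorem eventually_circleV_nhds {α β : ℝ} (hα : Irrational α) (hβ : β ∈ Ioo (0 : ℝ) 1)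
    (hgood : ∀ j m : ℤ, j * α + m ≠ β) {n : ℤ} (hn : n ≠ 0) :
    ∀ᶠ φ in 𝓝 (1 - β), circleV α β φ n = circleV α β (1 - β) n := by
  simp only [circleV_eq_floor α hβ]
  have c1 : Tendsto (fun φ : ℝ => n * α + φ + β) (𝓝 (1 - β)) (𝓝 (n * α + (1 - β) + β)) :=
    Continuous.tendsto (by fun_prop) _
  have c2 : Tendsto (fun φ : ℝ => n * α + φ) (𝓝 (1 - β)) (𝓝 (n * α + (1 - β))) :=
    Continuous.tendsto (by fun_prop) _
  have h1 : ∀ m : ℤ, n * α + (1 - β) + β ≠ m := fun m hm =>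
    (hα.intCast_mul hn).ne_int (m - 1) (by push_cast; linarith)
  have h2 : ∀ m : ℤ, n * α + (1 - β) ≠ m := fun m hm => hgood n (1 - m) (by push_cast; linarith)
  filter_upwards [c1.eventually (eventually_floor_eq h1), c2.eventually (eventually_floor_eq h2)]
    with φ e1 e2
  rw [e1, e2]

theorem eventually_circleV_nhdsLT {α β : ℝ} (hα : Irrational α) (hβ : β ∈ Ioo (0 : ℝ) 1)
    (hgood : ∀ j m : ℤ, j * α + m ≠ β) (n : ℤ) :
    ∀ᶠ φ in 𝓝[<] (1 - β), circleV α β φ n = Function.update (circleV α β (1 - β)) 0 0 n := by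
  rcases eq_or_ne n 0 with rfl | hn
  · rw [Function.update_self]
    filter_upwards [Ioo_mem_nhdsLT (show 0 < 1 - β by linarith [hβ.2])] with φ hφ
    rw [circleV, indicator_of_notMem]
    rw [Int.cast_zero, zero_mul, zero_add,
      Int.fract_eq_self.2 ⟨hφ.1.le, by linarith [hφ.2, hβ.1]⟩]
    exact fun h => absurd h.1 (not_le.2 hφ.2)
  · rw [Function.update_of_ne hn]
    exact nhdsWithin_le_nhds (eventually_circleV_nhds hα hβ hgood hn)

theorem circleV_discontinuity (α : ℝ) {β : ℝ} (hβ : β ∈ Ioo (0 : ℝ) 1) :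
    circleV α β (1 - β) 0 = 1 := by
  rw [circleV, indicator_of_mem]
  rw [Int.cast_zero, zero_mul, zero_add,
    Int.fract_eq_self.2 ⟨by linarith [hβ.2], by linarith [hβ.1]⟩]
  exact ⟨le_rfl, by linarith [hβ.1]⟩

section Circle

variable {α β : ℝ}

theorem tendsto_integral_argDefect {S : Set ℝ} {M η : ℝ} (hS : S ⊆ Ioc (-M) M) (hη : 0 < η)
    {l : Filter ℝ} [l.IsCountablyGenerated] {ω : ℤ → ℝ} (hω : ∀ n, ω n ∈ Icc (0 : ℝ) 1)
    (h : ∀ n, ∀ᶠ θ in l, circleV α β θ n = ω n) :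
    Tendsto (fun θ => ∫ E in S, argDefect (circleV α β θ) (epoint E η)) l
      (𝓝 (∫ E in S, argDefect ω (epoint E η))) := by
  have hfin : volume S < ⊤ := (measure_mono hS).trans_lt (by simp)
  have : IsFiniteMeasure (volume.restrict S) := ⟨by simpa using hfin⟩
  refine tendsto_integral_filter_of_dominated_convergence (fun _ => 3 * Real.pi)
    (Eventually.of_forall fun θ =>
      (continuous_argDefect (circleV_mem α β θ) hη).aestronglyMeasurable)
    (Eventually.of_forall fun θ => Eventually.of_forall fun E => abs_argDefect_le_const _ _)
    (integrable_const _) (Eventually.of_forall fun E => ?_)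
  have hz : 0 < (epoint E η).im := by simpa
  have harg : ∀ {u : ℝ → ℂ} {a : ℂ}, 0 < a.im → Tendsto u l (𝓝 a) →
      Tendsto (fun θ => (u θ + I).arg) l (𝓝 (a + I).arg) := fun {u a} ha hu =>
    (Complex.continuousAt_arg (Or.inr (by simp; linarith))).tendsto.comp (hu.add_const I)
  have hL : Tendsto (fun θ => mLeft (circleV α β θ) (epoint E η)) l (𝓝 (mLeft ω (epoint E η))) :=
    tendsto_mFun_of_eventually_eq (fun θ => unitSeq_left (circleV_mem α β θ)) (unitSeq_left hω) hz
      fun n => h _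
  have hR : Tendsto (fun θ => mRight (circleV α β θ) (epoint E η)) l
      (𝓝 (mRight ω (epoint E η))) := by
    refine ((tendsto_mFun_of_eventually_eq (fun θ => unitSeq_right (circleV_mem α β θ))
      (unitSeq_right hω) hz fun n => h _).add_const _).sub ?_
    refine tendsto_const_nhds.congr' ?_
    filter_upwards [h 0] with θ hθ
    rw [hθ]
  exact (harg (mRight_im_pos hω hz) hR).sub (tendsto_const_nhds.sub (harg (mLeft_im_pos hω hz) hL))

theorem exists_ae_abs_integral_argDefect_le {S : Set ℝ} {M e : ℝ} (hSm : MeasurableSet S)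
    (hS : S ⊆ Ioc (-M) M) (hM : 4 ≤ M)
    (h : ∀ E ∈ S, Tendsto (fun ε => lyap α β (epoint E ε)) (𝓝[>] 0) (𝓝 0)) (he : 0 < e) :
    ∃ η₀ > 0, ∀ η, 0 < η → η < η₀ →
      ∀ᵐ θ ∂phase, |∫ E in S, argDefect (circleV α β θ) (epoint E η)| ≤ e := by
  obtain ⟨η₀, hη₀, h0⟩ := exists_abs_integral_argDefect_sub_le hSm hS (by linarith) he
  refine ⟨η₀, hη₀, fun η hη hlt => ?_⟩
  have hfin : volume S < ⊤ := (measure_mono hS).trans_lt (by simp)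
  have : IsFiniteMeasure (volume.restrict S) := ⟨by simpa using hfin⟩
  set F : ℝ → ℝ → ℝ := fun y θ => ∫ E in S, argDefect (circleV α β θ) (epoint E y) with hF
  have hi : ∀ y, 0 < y → Integrable (F y) phase := fun y hy =>
    (integrable_uncurry (μ := volume.restrict S) (measurable_argDefect (α := α) (β := β) hy)
      fun E θ => abs_argDefect_le_const _ _).integral_prod_right
  set G : ℝ → ℝ := fun θ => max (|F η θ| - e) 0 with hG
  have hGi : Integrable G phase := ((hi η hη).abs.sub (integrable_const e)).sup (integrable_zero _ _ _)
  have hG0 : 0 ≤ G := fun θ => le_max_right _ _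
  have hle : ∫ θ, G θ ∂phase ≤ 0 := by
    refine le_of_forall_pos_le_add fun e' he' => ?_
    rw [zero_add]
    obtain ⟨ε, hε, hεη, -, h1⟩ := exists_integral_argDefect_le hSm hS hM h he' hη
    refine le_trans (integral_mono hGi (hi ε hε).abs fun θ => ?_) h1
    have h2 : |F ε θ - F η θ| ≤ e := h0 _ (circleV_mem α β θ) ε η hε hεη.le hlt
    refine max_le ?_ (abs_nonneg _)
    have h3 := abs_sub_abs_le_abs_sub (F η θ) (F ε θ)
    rw [abs_sub_comm] at h3
    show |F η θ| - e ≤ |F ε θ|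
    linarith
  have hz := (integral_eq_zero_iff_of_nonneg hG0 hGi).1 (le_antisymm hle (integral_nonneg hG0))
  filter_upwards [hz] with θ hθ
  have h1 : |F η θ| - e ≤ G θ := le_max_left _ _
  have h2 : G θ = 0 := hθ
  rw [h2] at h1
  show |F η θ| ≤ e
  linarith

/-- The half-line function to the right of the discontinuity of the circle potential. -/
noncomputable def jumpFun (α β : ℝ) (z : ℂ) : ℂ :=
  mFun (fun j : ℕ => circleV α β (1 - β) (j + 1)) z + z

theorem exists_integral_arg_sub_le {S : Set ℝ} {M e : ℝ} (hα : Irrational α)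
    (hβ : β ∈ Ioo (0 : ℝ) 1) (hgood : ∀ j m : ℤ, j * α + m ≠ β) (hSm : MeasurableSet S)
    (hS : S ⊆ Ioc (-M) M) (hM : 4 ≤ M)
    (h : ∀ E ∈ S, Tendsto (fun ε => lyap α β (epoint E ε)) (𝓝[>] 0) (𝓝 0)) (he : 0 < e) :
    ∃ η, 0 < η ∧ η < 1 ∧
      ∫ E in S, ((jumpFun α β (epoint E η) + I - 1).arg - (jumpFun α β (epoint E η) + I).arg) ≤
        2 * e := by
  obtain ⟨η₀, hη₀, h0⟩ := exists_ae_abs_integral_argDefect_le hSm hS hM h he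
  obtain ⟨η, hη, hlt⟩ := exists_between (lt_min hη₀ one_pos)
  refine ⟨η, hη, hlt.trans_le (min_le_right _ _), ?_⟩
  have hae := h0 η hη (hlt.trans_le (min_le_left _ _))
  have hθ : 1 - β ∈ Ioo (0 : ℝ) 1 := ⟨by linarith [hβ.2], by linarith [hβ.1]⟩
  set ω := circleV α β (1 - β) with hω
  set ω' := Function.update ω 0 0 with hω'
  have m1 : ∀ n, ω n ∈ Icc (0 : ℝ) 1 := circleV_mem α β _
  have m2 : ∀ n, ω' n ∈ Icc (0 : ℝ) 1 := fun n => by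
    rcases eq_or_ne n 0 with rfl | hn
    · simp [hω']
    · rw [hω', Function.update_of_ne hn]; exact m1 n
  have b1 : |∫ E in S, argDefect ω (epoint E η)| ≤ e :=
    le_of_tendsto_of_frequently (tendsto_integral_argDefect hS hη m1
      (eventually_circleV_nhdsGT α hβ (1 - β))).abs (frequently_nhdsGT_of_ae_phase hae hθ)
  have b2 : |∫ E in S, argDefect ω' (epoint E η)| ≤ e :=
    le_of_tendsto_of_frequently (tendsto_integral_argDefect hS hη m2
      (eventually_circleV_nhdsLT hα hβ hgood)).abs (frequently_nhdsLT_of_ae_phase hae hθ)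
  have hfin : volume S < ⊤ := (measure_mono hS).trans_lt (by simp)
  have : IsFiniteMeasure (volume.restrict S) := ⟨by simpa using hfin⟩
  have hi : ∀ v : ℤ → ℝ, (∀ n, v n ∈ Icc (0 : ℝ) 1) →
      IntegrableOn (fun E => argDefect v (epoint E η)) S := fun v hv =>
    Integrable.of_bound (continuous_argDefect hv hη).aestronglyMeasurable (3 * Real.pi)
      (Eventually.of_forall fun E => abs_argDefect_le_const _ _)
  have key : ∀ z, (jumpFun α β z + I - 1).arg - (jumpFun α β z + I).arg =
      argDefect ω z - argDefect ω' z := by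
    intro z
    have r1 : mRight ω z + I = jumpFun α β z + I - 1 := by
      rw [mRight, hω, circleV_discontinuity α hβ, jumpFun]; push_cast; ring
    have r2 : mRight ω' z + I = jumpFun α β z + I := by
      have : (fun j : ℕ => ω' (j + 1)) = fun j : ℕ => ω (j + 1) := funext fun j =>
        Function.update_of_ne (by omega) _ _
      rw [mRight, this, jumpFun, hω', Function.update_self]; push_cast; ring
    have r3 : mLeft ω' z = mLeft ω z := by
      have : (fun j : ℕ => ω' (-1 - j)) = fun j : ℕ => ω (-1 - j) := funext fun j =>
        Function.update_of_ne (by omega) _ _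
      rw [mLeft, this, mLeft]
    rw [argDefect, argDefect, r1, r2, r3]; ring
  simp only [key]
  rw [integral_sub (hi ω m1) (hi ω' m2)]
  rw [abs_le] at b1 b2
  linarith

end Circle

theorem inv_two_mul_norm_sq_le_arg_sub {w : ℂ} (hw : 1 ≤ w.im) :
    (2 * ‖w‖ ^ 2)⁻¹ ≤ (w - 1).arg - w.arg := by
  have i1 : (w - 1).im = w.im := by simp
  have n1 : 1 ≤ ‖w‖ := hw.trans ((le_abs_self _).trans (Complex.abs_im_le_norm _))
  have n2 : 1 ≤ ‖w - 1‖ := by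
    rw [← i1] at hw
    exact hw.trans ((le_abs_self _).trans (Complex.abs_im_le_norm _))
  have n3 : ‖w - 1‖ ≤ 2 * ‖w‖ := by
    have := norm_sub_le w 1
    rw [norm_one] at this
    linarith
  have h0 : w ≠ 0 := norm_pos_iff.1 (by linarith)
  have h1 : w - 1 ≠ 0 := norm_pos_iff.1 (by linarith)
  have a1 := Complex.arg_lt_pi_iff.2 (Or.inr (show w.im ≠ 0 by linarith))
  have a2 := Complex.arg_nonneg_iff.2 (show 0 ≤ (w - 1).im by linarith)
  have hs : Real.sin ((w - 1).arg - w.arg) = w.im / (‖w - 1‖ * ‖w‖) := by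
    rw [Real.sin_sub, Complex.sin_arg, Complex.sin_arg, Complex.cos_arg h0, Complex.cos_arg h1]
    have : ‖w‖ ≠ 0 := by linarith
    have : ‖w - 1‖ ≠ 0 := by linarith
    field_simp
    simp only [Complex.sub_im, Complex.sub_re, Complex.one_im, Complex.one_re]
    ring
  have hspos : 0 < Real.sin ((w - 1).arg - w.arg) := by
    rw [hs]; exact div_pos (by linarith) (by positivity)
  have hn : 0 ≤ (w - 1).arg - w.arg := by
    by_contra hlt
    exact absurd (Real.sin_neg_of_neg_of_neg_pi_lt (not_le.1 hlt) (by linarith))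
      (not_lt.2 hspos.le)
  refine le_trans ?_ (Real.sin_le hn)
  rw [hs, inv_eq_one_div]
  have h5 : ‖w - 1‖ * ‖w‖ ≤ 2 * ‖w‖ ^ 2 := by nlinarith
  exact div_le_div₀ (by linarith) hw (by positivity) h5

theorem tangent_le_inv_sq {x : ℝ} (hx : 0 < x) (T : ℝ) :
    Real.exp (-2 * T) * (1 - 2 * (Real.log x - T)) ≤ (x ^ 2)⁻¹ := by
  have h1 : (x ^ 2)⁻¹ = Real.exp (-2 * T) * Real.exp (-2 * (Real.log x - T)) := by
    rw [← Real.exp_add, show -2 * T + -2 * (Real.log x - T) = -(Real.log x + Real.log x) by ring,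
      Real.exp_neg, Real.exp_add, Real.exp_log hx, sq]
  rw [h1]
  refine mul_le_mul_of_nonneg_left ?_ (Real.exp_pos _).le
  linarith [Real.add_one_le_exp (-2 * (Real.log x - T))]

section Circle

variable {α β : ℝ}

theorem jumpFun_im_pos {z : ℂ} (hz : 0 < z.im) : 0 < (jumpFun α β z).im := by
  have := mFun_im_pos (unitSeq_right (circleV_mem α β (1 - β))) hz
  simp only [jumpFun, Complex.add_im]
  linarith

theorem differentiableOn_jumpFun : DifferentiableOn ℂ (jumpFun α β) {z | 0 < z.im} :=
  (mFun_differentiableOn (unitSeq_right (circleV_mem α β (1 - β)))).add differentiableOn_id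

theorem norm_jumpFun_le {M E y : ℝ} (hE : E ∈ Icc (-M) M) (hy : 0 < y) (hy1 : y ≤ 1) :
    ‖jumpFun α β (epoint E y)‖ ≤ (M + 4) / y := by
  have h1 := norm_mRight_le (circleV_mem α β (1 - β)) hE hy hy1
  have h2 : jumpFun α β (epoint E y) =
      mRight (circleV α β (1 - β)) (epoint E y) + circleV α β (1 - β) 0 := by
    rw [jumpFun, mRight]; ring
  have h3 := abs_le_one_of_mem (circleV_mem α β (1 - β) 0)
  rw [h2]
  refine (norm_add_le _ _).trans ?_
  rw [show (M + 4) / y = (M + 3) / y + 1 / y by ring]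
  exact add_le_add h1 (h3.trans ((one_le_div hy).2 hy1))

theorem integral_log_jumpFun_le {M η : ℝ} (hM : 0 ≤ M) (hη : 0 < η) (hη1 : η ≤ 1) :
    ∫ E in Ioc (-M) M, Real.log ‖jumpFun α β (epoint E η) + I‖ ≤
      (2 * √(M + 5) + Real.pi) * (2 * M + 4) := by
  have hpi := Real.pi_pos
  set B : ℝ := 2 * √(M + 5) + Real.pi with hB
  have hB0 : 0 ≤ B := by positivity
  set g : ℂ → ℂ := fun z => I * Complex.log (jumpFun α β z + I) with hg
  have gd : DifferentiableOn ℂ g {z | 0 < z.im} :=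
    (differentiableOn_log_add_I differentiableOn_jumpFun fun z => jumpFun_im_pos).const_mul I
  have gb : ∀ E ∈ Icc (-M) M, ∀ y, 0 < y → y ≤ 1 →
      ‖g (epoint E y)‖ ≤ B * y ^ (-(1 / 2) : ℝ) := by
    intro E hE y h1 h2
    have hz : 0 < (epoint E y).im := by simpa
    have a1 := norm_log_add_I_le (jumpFun_im_pos (α := α) (β := β) hz) h1 h2
      (norm_jumpFun_le hE h1 h2)
    rw [show M + 4 + 1 = M + 5 by ring, ← hB] at a1
    rwa [hg, norm_mul, Complex.norm_I, one_mul]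
  have h1 := norm_integral_epoint_sub_le gd hη hη1
    (intervalIntegrable_rpow_neg_half (B := B) hη hη1)
    (fun y h1 h2 => gb (-M) ⟨le_rfl, by linarith⟩ y (hη.trans_le h1) h2)
    (fun y h1 h2 => gb M ⟨by linarith, le_rfl⟩ y (hη.trans_le h1) h2)
  have h2 := integral_rpow_neg_half_le hη (η := 1) hB0
  have h3 : ‖∫ x in (-M)..M, g (epoint x 1)‖ ≤ B * |M - -M| := by
    refine intervalIntegral.norm_integral_le_of_norm_le_const fun x hx => ?_
    rw [uIoc_of_le (by linarith)] at hx
    simpa using gb x ⟨hx.1.le, hx.2⟩ 1 one_pos le_rfl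
  rw [show M - -M = 2 * M by ring, abs_of_nonneg (by linarith)] at h3
  have h4 : ∫ E in Ioc (-M) M, Real.log ‖jumpFun α β (epoint E η) + I‖ =
      (∫ x in (-M)..M, g (epoint x η)).im := by
    rw [← integral_im_eq gd hη, intervalIntegral.integral_of_le (by linarith)]
    refine integral_congr_ae (Eventually.of_forall fun E => ?_)
    simp [hg, Complex.mul_im, Complex.log_re]
  rw [h4]
  rw [Real.sqrt_one] at h2
  have h5 := norm_sub_norm_le (∫ x in (-M)..M, g (epoint x η)) (∫ x in (-M)..M, g (epoint x 1))
  refine ((le_abs_self _).trans (Complex.abs_im_le_norm _)).trans ?_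
  linarith

/-- If the Lyapunov exponent tends to zero at every point of `S`, then `S` is a null set. -/
theorem volume_eq_zero_of_tendsto_lyap {S : Set ℝ} {M : ℝ} (hα : Irrational α)
    (hβ : β ∈ Ioo (0 : ℝ) 1) (hgood : ∀ j m : ℤ, j * α + m ≠ β) (hSm : MeasurableSet S)
    (hS : S ⊆ Ioc (-M) M) (hM : 4 ≤ M)
    (h : ∀ E ∈ S, Tendsto (fun ε => lyap α β (epoint E ε)) (𝓝[>] 0) (𝓝 0)) : volume S = 0 := by
  have hfin : volume S < ⊤ := (measure_mono hS).trans_lt (by simp)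
  have : IsFiniteMeasure (volume.restrict S) := ⟨by simpa using hfin⟩
  by_contra hne
  have hs : 0 < volume.real S := ENNReal.toReal_pos hne hfin.ne
  set s := volume.real S with hsdef
  set C : ℝ := (2 * √(M + 5) + Real.pi) * (2 * M + 4) with hC
  set T : ℝ := C / s with hT
  set e : ℝ := Real.exp (-2 * T) * s / 8 with he
  have he0 : 0 < e := by positivity
  obtain ⟨η, hη, hη1, hle⟩ := exists_integral_arg_sub_le hα hβ hgood hSm hS hM h he0
  have hz : ∀ E, 0 < (epoint E η).im := fun E => by simpa
  set w : ℝ → ℂ := fun E => jumpFun α β (epoint E η) + I with hw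
  have wim : ∀ E, 1 ≤ (w E).im := fun E => by
    have := jumpFun_im_pos (α := α) (β := β) (hz E)
    simp [hw]; linarith
  have wn : ∀ E, 1 ≤ ‖w E‖ := fun E =>
    (wim E).trans ((le_abs_self _).trans (Complex.abs_im_le_norm _))
  have wc : Continuous w := (continuous_comp_epoint differentiableOn_jumpFun hη).add_const I
  have lc : Continuous fun E => Real.log ‖w E‖ :=
    wc.norm.log fun E => by linarith [wn E]
  have li : IntegrableOn (fun E => Real.log ‖w E‖) (Ioc (-M) M) :=
    (lc.integrableOn_Icc (a := -M) (b := M)).mono_set Ioc_subset_Icc_self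
  have hl : ∫ E in S, Real.log ‖w E‖ ≤ C :=
    (setIntegral_mono_set li (Eventually.of_forall fun E => Real.log_nonneg (wn E))
      hS.eventuallyLE).trans (integral_log_jumpFun_le (by linarith) hη hη1.le)
  have hai : IntegrableOn (fun E => (w E - 1).arg - (w E).arg) S := by
    have := Real.pi_pos
    refine Integrable.of_bound (((Complex.measurable_arg.comp (wc.measurable.sub_const 1)).sub
      (Complex.measurable_arg.comp wc.measurable)).aestronglyMeasurable) (2 * Real.pi)
      (Eventually.of_forall fun E => ?_)
    have h1 := Complex.abs_arg_le_pi (w E - 1)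
    have h2 := Complex.abs_arg_le_pi (w E)
    exact (abs_sub _ _).trans (by linarith)
  have hmono : ∫ E in S, Real.exp (-2 * T) / 2 * (1 - 2 * (Real.log ‖w E‖ - T)) ≤
      ∫ E in S, ((w E - 1).arg - (w E).arg) := by
    refine integral_mono ?_ hai fun E => ?_
    · exact ((integrable_const _).sub (((li.mono_set hS).sub (integrable_const T)).const_mul
        2)).const_mul _
    · have h1 := tangent_le_inv_sq (x := ‖w E‖) (by linarith [wn E]) T
      have h2 := inv_two_mul_norm_sq_le_arg_sub (wim E)
      rw [mul_inv] at h2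
      show Real.exp (-2 * T) / 2 * (1 - 2 * (Real.log ‖w E‖ - T)) ≤ (w E - 1).arg - (w E).arg
      linarith
  have heq : ∫ E in S, Real.exp (-2 * T) / 2 * (1 - 2 * (Real.log ‖w E‖ - T)) =
      Real.exp (-2 * T) / 2 * (s - 2 * ((∫ E in S, Real.log ‖w E‖) - s * T)) := by
    have i1 : Integrable (fun E => Real.log ‖w E‖) (volume.restrict S) := li.mono_set hS
    have i2 : Integrable (fun E => 2 * (Real.log ‖w E‖ - T)) (volume.restrict S) :=
      (i1.sub (integrable_const T)).const_mul 2
    rw [integral_const_mul, integral_sub (integrable_const _) i2, integral_const_mul,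
      integral_sub i1 (integrable_const T)]
    simp [hsdef]
  have hsT : s * T = C := by rw [hT]; field_simp
  rw [heq, hsT] at hmono
  have h1 : Real.exp (-2 * T) / 2 * s ≤
      Real.exp (-2 * T) / 2 * (s - 2 * ((∫ E in S, Real.log ‖w E‖) - C)) :=
    mul_le_mul_of_nonneg_left (by linarith) (by positivity)
  have h2 := (h1.trans hmono).trans hle
  have h3 : 0 < Real.exp (-2 * T) * s := by positivity
  rw [he] at h2
  linarith

end Circle

end CircleMapSpectrum

/-- for irrational `α` and almost every `β`, the circle map Schrödinger
operator has zero-measure Cantor spectrum for every `θ`. -/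
theorem stmt2 (α : ℝ) (hα : α ∈ Set.Ioo (0 : ℝ) 1) (hirr : Irrational α) :
    ∀ᵐ β ∂(volume : Measure ℝ), β ∈ Set.Ioo (0 : ℝ) 1 →
      ∀ θ ∈ Set.Ioo (0 : ℝ) 1,
        ∀ H : lp (fun _ : ℤ => ℝ) 2 →L[ℝ] lp (fun _ : ℤ => ℝ) 2,
          IsSchrodingerOp (circleV α β θ) H →
            IsCantorSet (spectrum ℝ H) ∧ MeasureTheory.volume (spectrum ℝ H) = 0 := by
  filter_upwards [CircleMapSpectrum.ae_goodBeta hirr] with β hβ' hβ θ hθ H hH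
  have hgood := hβ' hβ
  have hc : IsCompact (spectrum ℝ H) := spectrum.isCompact H
  obtain ⟨R, hR⟩ := hc.isBounded.subset_closedBall 0
  have hsub : spectrum ℝ H ⊆ Ioc (-(max 4 (R + 1))) (max 4 (R + 1)) := fun E hE => by
    have h1 := hR hE
    rw [Metric.mem_closedBall, Real.dist_eq, sub_zero, abs_le] at h1
    have h2 := le_max_right 4 (R + 1)
    exact ⟨by linarith [h1.1], by linarith [h1.2]⟩
  have hzero : volume (spectrum ℝ H) = 0 :=
    CircleMapSpectrum.volume_eq_zero_of_tendsto_lyap hirr hβ hgood.1 hc.measurableSet hsub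
      (le_max_left _ _) fun E hE => CircleMapSpectrum.tendsto_lyap fun δ hδ =>
        CircleMapSpectrum.exists_logNorm_le_mul hirr hβ hgood hH
          (CircleMapSpectrum.exists_norm_gt_of_mem_spectrum hH hE) hδ
  refine ⟨⟨hc, Measure.interior_eq_empty_of_null hzero, fun E hE => ?_⟩, hzero⟩
  rw [accPt_iff_nhds]
  intro U hU
  obtain ⟨r, hr, hrU⟩ := Metric.mem_nhds_iff.1 hU
  obtain ⟨t, ht, hne, hlt⟩ := CircleMapSpectrum.exists_ne_mem_spectrum hirr hβ hH hE hr
  exact ⟨t, ⟨hrU (by rwa [Metric.mem_ball, Real.dist_eq]), ht⟩, hne⟩
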